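/- Let s ≥ 9 be an integer, let η > 0, let τ be a real number, and let h₁, …, h_s ∈ ℝ[x] be cubic polynomials satisfying the irrationality condition. Put H(x₁, …, x_s) = h₁(x₁) + ⋯ + h_s(x_s). Then there exists x ∈ ℤ^s such that |H(x) − τ| < η. -/

import Mathlib

open Finset MeasureTheory Filter

/-! ### Divisor bound -/

theorem exists_succ_pow_le_mul_two_pow (j : ℕ) : ∃ K : ℕ, 1 ≤ K ∧ ∀ a : ℕ, (a + 1) ^ j ≤ K * 2 ^ a := by
  have h : Tendsto (fun n : ℕ => (n : ℝ) ^ j / (2 : ℝ) ^ n) atTop (nhds 0) :=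
    tendsto_pow_const_div_const_pow_of_one_lt j one_lt_two
  obtain ⟨B, hB⟩ := h.bddAbove_range
  refine ⟨2 * ⌈max B 1⌉₊, ?_, fun a => ?_⟩
  · have : 0 < ⌈max B 1⌉₊ := Nat.ceil_pos.2 (by positivity)
    lia
  · have h1 : ((a + 1 : ℕ) : ℝ) ^ j / 2 ^ (a + 1) ≤ B := hB ⟨a + 1, rfl⟩
    rw [div_le_iff₀ (by positivity)] at h1
    have h2 : max B 1 ≤ ⌈max B 1⌉₊ := Nat.le_ceil _
    have h3 : ((a + 1 : ℕ) : ℝ) ^ j ≤ ((2 * ⌈max B 1⌉₊ * 2 ^ a : ℕ) : ℝ) := by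
      push_cast at h1 ⊢
      have h4 : B ≤ (⌈max B 1⌉₊ : ℝ) := (le_max_left _ _).trans h2
      have : B * 2 ^ (a + 1) ≤ (⌈max B 1⌉₊ : ℝ) * 2 ^ (a + 1) := by gcongr
      rw [pow_succ (2 : ℝ) a] at *
      linarith
    exact_mod_cast h3

theorem exists_card_divisors_pow_le (j : ℕ) :
    ∃ C : ℕ, 1 ≤ C ∧ ∀ n : ℕ, n ≠ 0 → n.divisors.card ^ j ≤ C * n := by
  obtain ⟨K, hK, h⟩ := exists_succ_pow_le_mul_two_pow j
  refine ⟨K ^ 2 ^ j, Nat.one_le_pow _ _ hK, fun n hn => ?_⟩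
  rw [Nat.card_divisors hn, ← Finset.prod_pow]
  have h1 : ∀ p ∈ n.primeFactors, (n.factorization p + 1) ^ j ≤
      (if p < 2 ^ j then K else 1) * p ^ n.factorization p := by
    intro p hp
    have hp2 := (Nat.prime_of_mem_primeFactors hp).two_le
    split_ifs with hpj
    · exact (h _).trans (Nat.mul_le_mul le_rfl (Nat.pow_le_pow_left hp2 _))
    · rw [one_mul]
      calc (n.factorization p + 1) ^ j ≤ (2 ^ n.factorization p) ^ j :=
            Nat.pow_le_pow_left (Nat.lt_two_pow_self) _
        _ = (2 ^ j) ^ n.factorization p := by rw [← pow_mul, ← pow_mul, mul_comm]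
        _ ≤ _ := Nat.pow_le_pow_left (not_lt.1 hpj) _
  refine (Finset.prod_le_prod' h1).trans ?_
  rw [Finset.prod_mul_distrib]
  have h2 : ∏ p ∈ n.primeFactors, p ^ n.factorization p = n := Nat.prod_factorization_pow_eq_self hn
  rw [h2]
  refine Nat.mul_le_mul ?_ le_rfl
  rw [Finset.prod_ite, Finset.prod_const, Finset.prod_const_one, mul_one]
  refine Nat.pow_le_pow_right hK ?_
  calc _ ≤ (Finset.range (2 ^ j)).card := Finset.card_le_card fun p hp => by
        simpa using (Finset.mem_filter.1 hp).2
    _ = _ := Finset.card_range _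

/-- Divisor bound: `d(n)² ≤ m` as soon as `n ≤ m ^ B` and `m` is large. -/
theorem eventually_card_divisors_sq_le (B : ℕ) :
    ∀ᶠ m : ℕ in atTop, ∀ n : ℕ, n ≠ 0 → n ≤ m ^ B → n.divisors.card ^ 2 ≤ m := by
  obtain ⟨C, hC, h⟩ := exists_card_divisors_pow_le (2 * (B + 1))
  filter_upwards [eventually_ge_atTop C, eventually_ge_atTop 1] with m hm hm1 n hn hnB
  have h1 : (n.divisors.card ^ 2) ^ (B + 1) ≤ m ^ (B + 1) := by
    rw [← pow_mul]
    calc _ ≤ C * n := h n hn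
      _ ≤ m * m ^ B := Nat.mul_le_mul hm hnB
      _ = _ := by rw [pow_succ, mul_comm]
  exact (Nat.pow_le_pow_iff_left (by lia)).1 h1

/-! ### The additive character and the distance to the nearest integer -/

/-- The additive character `x ↦ exp(2πix)`. -/
noncomputable def unitExp (x : ℝ) : ℂ := Complex.exp ((2 * Real.pi * x : ℝ) * Complex.I)

theorem unitExp_add (x y : ℝ) : unitExp (x + y) = unitExp x * unitExp y := by
  simp only [unitExp, ← Complex.exp_add]; congr 1; push_cast; ring

@[simp] theorem norm_unitExp (x : ℝ) : ‖unitExp x‖ = 1 := Complex.norm_exp_ofReal_mul_I _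

@[simp] theorem unitExp_zero : unitExp 0 = 1 := by simp [unitExp]

theorem conj_unitExp (x : ℝ) : (starRingEnd ℂ) (unitExp x) = unitExp (-x) := by
  rw [unitExp, unitExp, ← Complex.exp_conj, map_mul, Complex.conj_ofReal, Complex.conj_I]
  congr 1; push_cast; ring

@[simp] theorem unitExp_intCast (n : ℤ) : unitExp n = 1 := by
  have := Complex.exp_int_mul_two_pi_mul_I n
  rw [← this, unitExp]; congr 1; push_cast; ring

theorem unitExp_add_intCast (x : ℝ) (n : ℤ) : unitExp (x + n) = unitExp x := by
  rw [unitExp_add, unitExp_intCast, mul_one]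

theorem unitExp_sum {ι : Type*} (s : Finset ι) (f : ι → ℝ) :
    unitExp (∑ i ∈ s, f i) = ∏ i ∈ s, unitExp (f i) := by
  classical
  induction s using Finset.induction_on with
  | empty => simp
  | insert a s ha ih => rw [Finset.sum_insert ha, Finset.prod_insert ha, unitExp_add, ih]

theorem norm_unitExp_sub_one_le (x : ℝ) : ‖unitExp x - 1‖ ≤ 2 * Real.pi * |x| := by
  have := Real.norm_exp_I_mul_ofReal_sub_one_le (x := 2 * Real.pi * x)
  rw [mul_comm] at this
  simpa [unitExp, abs_mul, abs_of_pos Real.pi_pos] using this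

@[fun_prop] theorem continuous_unitExp : Continuous unitExp := by unfold unitExp; fun_prop

theorem unitExp_re (x : ℝ) : (unitExp x).re = Real.cos (2 * Real.pi * x) :=
  Complex.exp_ofReal_mul_I_re _

/-- The distance to the nearest integer. -/
noncomputable def distInt (x : ℝ) : ℝ := |x - round x|

theorem distInt_nonneg (x : ℝ) : 0 ≤ distInt x := abs_nonneg _

theorem distInt_le (x : ℝ) (n : ℤ) : distInt x ≤ |x - n| := round_le x n

theorem distInt_le_half (x : ℝ) : distInt x ≤ 1 / 2 := abs_sub_round x

theorem distInt_add_le (x y : ℝ) : distInt (x + y) ≤ distInt x + distInt y := by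
  calc _ ≤ |x + y - ((round x + round y : ℤ) : ℝ)| := distInt_le _ _
    _ = |(x - round x) + (y - round y)| := by push_cast; ring_nf
    _ ≤ _ := abs_add_le _ _

theorem distInt_nat_mul_le (x : ℝ) (n : ℕ) : distInt (n * x) ≤ n * distInt x := by
  calc _ ≤ |n * x - ((n * round x : ℤ) : ℝ)| := distInt_le _ _
    _ = |n * (x - round x)| := by push_cast; ring_nf
    _ = _ := by rw [abs_mul, Nat.abs_cast, distInt]

theorem unitExp_sub_round (x : ℝ) (k : ℤ) : unitExp (k * (x - round x)) = unitExp (k * x) := by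
  have := unitExp_add_intCast (k * (x - round x)) (k * round x)
  rw [← this]; congr 1; push_cast; ring

theorem two_mul_distInt_le_norm (x : ℝ) : 4 * distInt x ≤ ‖unitExp x - 1‖ := by
  have h0 := unitExp_sub_round x 1
  simp only [Int.cast_one, one_mul] at h0
  rw [← h0]
  set y := x - round x
  have hy : |y| ≤ 1 / 2 := abs_sub_round x
  have h1 : ‖unitExp y - 1‖ = ‖2 * Real.sin (Real.pi * y)‖ := by
    have := Complex.norm_exp_I_mul_ofReal_sub_one (2 * Real.pi * y)
    rw [mul_comm] at this
    rw [unitExp, this]; congr 3; ring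
  rw [h1, norm_mul, Real.norm_eq_abs, Real.norm_eq_abs, abs_two, distInt]
  have h2 : 2 / Real.pi * |Real.pi * y| ≤ |Real.sin (Real.pi * y)| := by
    apply Real.mul_abs_le_abs_sin
    rw [abs_mul, abs_of_pos Real.pi_pos]
    nlinarith [Real.pi_pos]
  rw [abs_mul, abs_of_pos Real.pi_pos] at h2
  have : 2 / Real.pi * (Real.pi * |y|) = 2 * |y| := by field_simp
  change 4 * |y| ≤ _
  linarith

theorem norm_sum_unitExp_linear_le (M : ℕ) (θ c : ℝ) :
    ‖∑ x ∈ range M, unitExp (θ * x + c)‖ ≤ M := by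
  calc _ ≤ ∑ x ∈ range M, ‖unitExp (θ * x + c)‖ := norm_sum_le _ _
    _ = _ := by simp

theorem norm_sum_unitExp_linear_mul_distInt_le (M : ℕ) (θ c : ℝ) :
    ‖∑ x ∈ range M, unitExp (θ * x + c)‖ * distInt θ ≤ 1 / 2 := by
  have h1 : ∀ x : ℕ, unitExp (θ * x + c) = unitExp c * unitExp θ ^ x := by
    intro x
    induction x with
    | zero => simp
    | succ n ih =>
      rw [pow_succ, ← mul_assoc, ← ih, ← unitExp_add]; congr 1; push_cast; ring
  simp only [h1]
  rw [← Finset.mul_sum, norm_mul, norm_unitExp, one_mul]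
  have h2 := geom_sum_mul (unitExp θ) M
  have h3 : ‖∑ i ∈ range M, unitExp θ ^ i‖ * ‖unitExp θ - 1‖ ≤ 2 := by
    rw [← norm_mul, h2]
    calc _ ≤ ‖unitExp θ ^ M‖ + ‖(1 : ℂ)‖ := norm_sub_le _ _
      _ = 2 := by simp; norm_num
  have h4 := two_mul_distInt_le_norm θ
  nlinarith [norm_nonneg (∑ i ∈ range M, unitExp θ ^ i)]

/-- Lower bound for the Dirichlet kernel near an integer. -/
theorem le_norm_dirichlet {H : ℕ} {θ : ℝ} (h : 8 * H * distInt θ ≤ 1) :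
    (H : ℝ) / 2 ≤ ‖∑ a ∈ range H, unitExp (a * θ)‖ := by
  refine le_trans ?_ (Complex.re_le_norm _)
  rw [Complex.re_sum]
  calc (H : ℝ) / 2 = ∑ a ∈ range H, (1 / 2 : ℝ) := by simp; ring
    _ ≤ _ := by
      refine Finset.sum_le_sum fun a ha => ?_
      have ha' : (a : ℝ) ≤ H := by exact_mod_cast (Finset.mem_range.1 ha).le
      have h0 := unitExp_sub_round θ a
      simp only [Int.cast_natCast] at h0
      rw [← h0, unitExp_re]
      set y := θ - round θ
      have hy : 8 * H * |y| ≤ 1 := h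
      have h1 : |2 * Real.pi * (a * y)| ≤ 1 := by
        rw [abs_mul, abs_mul, abs_mul, abs_two, abs_of_pos Real.pi_pos, Nat.abs_cast]
        have : (a : ℝ) * |y| ≤ H * |y| := by gcongr
        nlinarith [Real.pi_pos, Real.pi_lt_four, abs_nonneg y]
      have h2 := Real.one_sub_sq_div_two_le_cos (x := 2 * Real.pi * (a * y))
      have h3 : (2 * Real.pi * (a * y)) ^ 2 ≤ 1 := by
        rw [← sq_abs]; exact pow_le_one₀ (abs_nonneg _) h1
      linarith

/-- The squared Dirichlet kernel dominates the indicator of `‖θ‖ ≤ 1/(8H)`. -/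
theorem one_le_dirichlet_sq {H : ℕ} (hH : 0 < H) {θ : ℝ} (h : 8 * H * distInt θ ≤ 1) :
    1 ≤ 4 / (H : ℝ) ^ 2 * ‖∑ a ∈ range H, unitExp (a * θ)‖ ^ 2 := by
  have h1 := le_norm_dirichlet h
  have hH' : (0 : ℝ) < H := by exact_mod_cast hH
  have : ((H : ℝ) / 2) ^ 2 ≤ ‖∑ a ∈ range H, unitExp (a * θ)‖ ^ 2 := by gcongr
  rw [div_mul_eq_mul_div, le_div_iff₀ (by positivity)]
  nlinarith

/-- A dyadic Fejér majorant for linear exponential sums. -/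
noncomputable def fejerMajorant (J : ℕ) (θ : ℝ) : ℝ :=
  64 * ∑ j ∈ range (J + 1), ((2 : ℝ) ^ j)⁻¹ * ‖∑ a ∈ range (2 ^ j), unitExp (a * θ)‖ ^ 2

theorem fejerMajorant_nonneg (J : ℕ) (θ : ℝ) : 0 ≤ fejerMajorant J θ := by
  unfold fejerMajorant; positivity

theorem le_fejerMajorant_of_distInt {J j : ℕ} (hj : j ≤ J) {θ : ℝ} (h : 8 * 2 ^ j * distInt θ ≤ 1) :
    16 * 2 ^ j ≤ fejerMajorant J θ := by
  have h1 := le_norm_dirichlet (H := 2 ^ j) (θ := θ) (by exact_mod_cast h)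
  push_cast at h1
  have h2 : ((2 : ℝ) ^ j)⁻¹ * ‖∑ a ∈ range (2 ^ j), unitExp (a * θ)‖ ^ 2 ≤
      ∑ j ∈ range (J + 1), ((2 : ℝ) ^ j)⁻¹ * ‖∑ a ∈ range (2 ^ j), unitExp (a * θ)‖ ^ 2 :=
    Finset.single_le_sum (f := fun j : ℕ => ((2 : ℝ) ^ j)⁻¹ *
      ‖∑ a ∈ range (2 ^ j), unitExp (a * θ)‖ ^ 2) (fun i _ => by positivity)
      (Finset.mem_range.2 (by lia))
  have h3 : ((2 : ℝ) ^ j)⁻¹ * ((2 : ℝ) ^ j / 2) ^ 2 ≤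
      ((2 : ℝ) ^ j)⁻¹ * ‖∑ a ∈ range (2 ^ j), unitExp (a * θ)‖ ^ 2 := by gcongr
  have h4 : ((2 : ℝ) ^ j)⁻¹ * ((2 : ℝ) ^ j / 2) ^ 2 = 2 ^ j / 4 := by field_simp; norm_num
  unfold fejerMajorant
  linarith

theorem le_fejerMajorant {M J : ℕ} (hJ : M ≤ 2 ^ J) {θ S : ℝ} (hS : 0 ≤ S) (hM : S ≤ M)
    (hd : S * distInt θ ≤ 1 / 2) : S ≤ fejerMajorant J θ := by
  have hM' : (M : ℝ) ≤ 2 ^ J := by exact_mod_cast hJ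
  by_cases h0 : 8 * 2 ^ J * distInt θ ≤ 1
  · have := le_fejerMajorant_of_distInt le_rfl h0
    have : (0 : ℝ) < 2 ^ J := by positivity
    linarith
  · classical
    have hex : ∃ j : ℕ, 1 < 8 * (2 : ℝ) ^ j * distInt θ := ⟨J, not_le.1 h0⟩
    have hspec := Nat.find_spec hex
    have hle : Nat.find hex ≤ J := Nat.find_min' hex (not_le.1 h0)
    rcases Nat.eq_zero_or_pos (Nat.find hex) with hz | hz
    · rw [hz] at hspec
      have h1 : 1 ≤ fejerMajorant J θ / 64 := by
        have h2 : ((2 : ℝ) ^ 0)⁻¹ * ‖∑ a ∈ range (2 ^ 0), unitExp (a * θ)‖ ^ 2 ≤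
          ∑ j ∈ range (J + 1), ((2 : ℝ) ^ j)⁻¹ * ‖∑ a ∈ range (2 ^ j), unitExp (a * θ)‖ ^ 2 :=
          Finset.single_le_sum (f := fun j : ℕ => ((2 : ℝ) ^ j)⁻¹ *
            ‖∑ a ∈ range (2 ^ j), unitExp (a * θ)‖ ^ 2) (fun i _ => by positivity)
            (Finset.mem_range.2 (by lia))
        have h3 : ((2 : ℝ) ^ 0)⁻¹ * ‖∑ a ∈ range (2 ^ 0), unitExp (a * θ)‖ ^ 2 = 1 := by simp
        unfold fejerMajorant
        linarith
      nlinarith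
    · obtain ⟨i, hi⟩ : ∃ i, Nat.find hex = i + 1 := ⟨Nat.find hex - 1, by lia⟩
      have hm := Nat.find_min hex (m := i) (by lia)
      have h1 := le_fejerMajorant_of_distInt (J := J) (by lia) (not_lt.1 hm)
      rw [hi, pow_succ] at hspec
      have : (0 : ℝ) < 2 ^ i := by positivity
      nlinarith

/-- The standard bound for a linear exponential sum of length at most `M` and frequency `θ`. -/
noncomputable def linBound (M : ℕ) (θ : ℝ) : ℝ := M / max 1 (2 * M * distInt θ)

theorem linBound_nonneg (M : ℕ) (θ : ℝ) : 0 ≤ linBound M θ := by unfold linBound; positivity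

theorem linBound_le (M : ℕ) (θ : ℝ) : linBound M θ ≤ M :=
  div_le_self (Nat.cast_nonneg _) (le_max_left _ _)

theorem linBound_mul_distInt_le (M : ℕ) (θ : ℝ) : linBound M θ * distInt θ ≤ 1 / 2 := by
  rw [linBound, div_mul_eq_mul_div, div_le_iff₀ (by positivity)]
  linarith [le_max_right 1 (2 * M * distInt θ)]

theorem linBound_le_fejerMajorant {M J : ℕ} (hJ : M ≤ 2 ^ J) (θ : ℝ) :
    linBound M θ ≤ fejerMajorant J θ :=
  le_fejerMajorant hJ (linBound_nonneg _ _) (linBound_le _ _) (linBound_mul_distInt_le _ _)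

theorem norm_sum_unitExp_linear_le_linBound {M M' : ℕ} (h : M' ≤ M) (θ c : ℝ) :
    ‖∑ x ∈ range M', unitExp (θ * x + c)‖ ≤ linBound M θ := by
  have h1 := (norm_sum_unitExp_linear_le M' θ c).trans (Nat.cast_le.2 h : (M' : ℝ) ≤ M)
  have h2 := norm_sum_unitExp_linear_mul_distInt_le M' θ c
  rw [linBound, le_div_iff₀ (by positivity)]
  rcases max_cases 1 (2 * M * distInt θ) with ⟨h, _⟩ | ⟨h, _⟩ <;> rw [h]
  · linarith
  · nlinarith [(Nat.cast_nonneg M : (0 : ℝ) ≤ M)]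

/-! ### Weyl differencing -/

theorem sum_range_sum_range_eq {E : Type*} [AddCommMonoid E] (M : ℕ) (W : ℕ → ℕ → E) :
    ∑ x ∈ range M, ∑ y ∈ range M, W x y = ∑ x ∈ range M, W x x +
      ∑ d ∈ Ico 1 M, ∑ x ∈ range (M - d), (W (x + d) x + W x (x + d)) := by
  induction M with
  | zero => simp
  | succ M ih =>
    have h1 : ∑ d ∈ Ico 1 (M + 1), ∑ x ∈ range (M + 1 - d), (W (x + d) x + W x (x + d)) =
        ∑ d ∈ Ico 1 M, ∑ x ∈ range (M - d), (W (x + d) x + W x (x + d)) +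
        ∑ d ∈ Ico 1 (M + 1), (W M (M - d) + W (M - d) M) := by
      have h2 : ∑ d ∈ Ico 1 (M + 1), ∑ x ∈ range (M + 1 - d), (W (x + d) x + W x (x + d)) =
          ∑ d ∈ Ico 1 (M + 1), (∑ x ∈ range (M - d), (W (x + d) x + W x (x + d)) +
            (W M (M - d) + W (M - d) M)) := by
        refine Finset.sum_congr rfl fun d hd => ?_
        rw [Finset.mem_Ico] at hd
        rw [show M + 1 - d = (M - d) + 1 by lia, Finset.sum_range_succ,
          show M - d + d = M by lia]
      rw [h2, Finset.sum_add_distrib]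
      congr 1
      rcases Nat.eq_zero_or_pos M with rfl | hM
      · simp
      · rw [Finset.sum_Ico_succ_top (by lia)]; simp
    have h3 : ∑ d ∈ Ico 1 (M + 1), (W M (M - d) + W (M - d) M) =
        ∑ x ∈ range M, W M x + ∑ x ∈ range M, W x M := by
      rw [Finset.sum_Ico_eq_sum_range, ← Finset.sum_add_distrib,
        ← Finset.sum_range_reflect (fun x => W M x + W x M)]
      refine Finset.sum_congr (by simp) fun x _ => ?_
      rw [show M - (1 + x) = M - 1 - x by lia]
    rw [h1, h3]
    simp only [Finset.sum_range_succ, Finset.sum_add_distrib] at ih ⊢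
    rw [ih]
    abel

theorem norm_sq_sum_unitExp {ι : Type*} (s : Finset ι) (ω : ι → ℝ) :
    ((‖∑ i ∈ s, unitExp (ω i)‖ ^ 2 : ℝ) : ℂ) = ∑ i ∈ s, ∑ j ∈ s, unitExp (ω i - ω j) := by
  have := Complex.mul_conj' (∑ i ∈ s, unitExp (ω i))
  push_cast
  rw [← this, map_sum, Finset.sum_mul_sum]
  simp only [conj_unitExp, ← unitExp_add, sub_eq_add_neg]

theorem norm_sq_sum_unitExp_le (M : ℕ) (φ : ℕ → ℝ) :
    ‖∑ x ∈ range M, unitExp (φ x)‖ ^ 2 ≤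
      M + 2 * ∑ d ∈ Ico 1 M, ‖∑ x ∈ range (M - d), unitExp (φ (x + d) - φ x)‖ := by
  have h := norm_sq_sum_unitExp (range M) φ
  rw [sum_range_sum_range_eq] at h
  have h1 : ‖∑ x ∈ range M, unitExp (φ x)‖ ^ 2 =
      ‖((‖∑ x ∈ range M, unitExp (φ x)‖ ^ 2 : ℝ) : ℂ)‖ := by
    rw [Complex.norm_real, Real.norm_of_nonneg (by positivity)]
  rw [h1, h, Finset.mul_sum]
  refine (norm_add_le _ _).trans (add_le_add (by simp) ((norm_sum_le _ _).trans ?_))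
  refine Finset.sum_le_sum fun d _ => ?_
  rw [Finset.sum_add_distrib]
  refine (norm_add_le _ _).trans_eq ?_
  have h2 : ∑ x ∈ range (M - d), unitExp (φ x - φ (x + d)) =
      (starRingEnd ℂ) (∑ x ∈ range (M - d), unitExp (φ (x + d) - φ x)) := by
    rw [map_sum]; simp only [conj_unitExp, neg_sub]
  rw [h2, RCLike.norm_conj, two_mul]

/-- Differencing a quadratic phase. -/
theorem norm_sq_sum_quadratic_le {M M' : ℕ} (hM : M' ≤ M) (b c : ℝ) (φ : ℕ → ℝ)
    (hφ : ∀ x : ℕ, φ x = b * x ^ 2 + c * x + φ 0) :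
    ‖∑ x ∈ range M', unitExp (φ x)‖ ^ 2 ≤
      M + 2 * ∑ e ∈ Ico 1 M, linBound M ((e : ℕ) * (2 * b)) := by
  refine (norm_sq_sum_unitExp_le M' φ).trans ?_
  have h1 : ∑ d ∈ Ico 1 M', ‖∑ x ∈ range (M' - d), unitExp (φ (x + d) - φ x)‖ ≤
      ∑ e ∈ Ico 1 M, linBound M ((e : ℕ) * (2 * b)) := by
    calc _ ≤ ∑ e ∈ Ico 1 M', linBound M ((e : ℕ) * (2 * b)) := by
          refine Finset.sum_le_sum fun d _ => ?_
          have h2 : ∀ x ∈ range (M' - d), unitExp (φ (x + d) - φ x) =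
              unitExp ((d * (2 * b)) * x + (b * d ^ 2 + c * d)) := by
            intro x _; congr 1; rw [hφ (x + d), hφ x]; push_cast; ring
          rw [Finset.sum_congr rfl h2]
          exact norm_sum_unitExp_linear_le_linBound (by lia) _ _
      _ ≤ _ := Finset.sum_le_sum_of_subset_of_nonneg
          (Finset.Ico_subset_Ico_right hM) fun _ _ _ => linBound_nonneg _ _
  have : (M' : ℝ) ≤ M := by exact_mod_cast hM
  linarith

/-- The twice-differenced form of a cubic phase: one step of differencing. -/
theorem norm_sq_sum_cubic_diff_le (M d : ℕ) (a b c : ℝ) (φ : ℕ → ℝ)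
    (hφ : ∀ x : ℕ, φ x = a * x ^ 3 + b * x ^ 2 + c * x + φ 0) :
    ‖∑ x ∈ range (M - d), unitExp (φ (x + d) - φ x)‖ ^ 2 ≤
      M + 2 * ∑ e ∈ Ico 1 M, linBound M ((d * e : ℕ) * (6 * a)) := by
  have := norm_sq_sum_quadratic_le (M' := M - d) (Nat.sub_le M d) (3 * a * d)
    (3 * a * d ^ 2 + 2 * b * d) (fun x => φ (x + d) - φ x) (fun x => by
      rw [hφ (x + d), hφ x, hφ (0 + d)]; push_cast; ring)
  refine this.trans_eq ?_
  congr 2; refine Finset.sum_congr rfl fun e _ => ?_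
  congr 1; push_cast; ring

theorem norm_pow_four_sum_cubic_le (M : ℕ) (a b c : ℝ) (φ : ℕ → ℝ)
    (hφ : ∀ x : ℕ, φ x = a * x ^ 3 + b * x ^ 2 + c * x + φ 0) :
    ‖∑ x ∈ range M, unitExp (φ x)‖ ^ 4 ≤ 10 * M ^ 3 +
      16 * M * ∑ d ∈ Ico 1 M, ∑ e ∈ Ico 1 M, linBound M ((d * e : ℕ) * (6 * a)) := by
  have h1 := norm_sq_sum_unitExp_le M φ
  set S := ‖∑ x ∈ range M, unitExp (φ x)‖
  set U := ∑ d ∈ Ico 1 M, ‖∑ x ∈ range (M - d), unitExp (φ (x + d) - φ x)‖ with hU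
  set V := ∑ d ∈ Ico 1 M, ∑ e ∈ Ico 1 M, linBound M ((d * e : ℕ) * (6 * a)) with hV
  have hU0 : 0 ≤ U := Finset.sum_nonneg fun _ _ => norm_nonneg _
  have hV0 : 0 ≤ V := Finset.sum_nonneg fun _ _ => Finset.sum_nonneg fun _ _ => linBound_nonneg _ _
  have hcard : ((Ico 1 M).card : ℝ) ≤ M := by simp
  have h2 : U ^ 2 ≤ M * (M * M + 2 * V) := by
    calc U ^ 2 ≤ (Ico 1 M).card *
          ∑ d ∈ Ico 1 M, ‖∑ x ∈ range (M - d), unitExp (φ (x + d) - φ x)‖ ^ 2 :=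
          sq_sum_le_card_mul_sum_sq
      _ ≤ M * ∑ d ∈ Ico 1 M, (M + 2 * ∑ e ∈ Ico 1 M, linBound M ((d * e : ℕ) * (6 * a))) := by
          refine mul_le_mul hcard (Finset.sum_le_sum fun d _ =>
            norm_sq_sum_cubic_diff_le M d a b c φ hφ) (Finset.sum_nonneg fun _ _ => by positivity)
            (Nat.cast_nonneg _)
      _ ≤ _ := by
          rw [Finset.sum_add_distrib, ← Finset.mul_sum, Finset.sum_const, nsmul_eq_mul]
          gcongr
  rcases Nat.eq_zero_or_pos M with h0 | h0
  · subst h0; simp [S]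
  have hM1 : (1 : ℝ) ≤ M := by exact_mod_cast h0
  have h3 : S ^ 4 ≤ (M + 2 * U) ^ 2 := by
    calc S ^ 4 = (S ^ 2) ^ 2 := by ring
      _ ≤ _ := by gcongr
  have h4 : (M + 2 * U) ^ 2 ≤ 2 * M ^ 2 + 8 * U ^ 2 := by nlinarith [sq_nonneg ((M : ℝ) - 2 * U)]
  have h5 : (M : ℝ) ^ 2 ≤ M ^ 3 := pow_le_pow_right₀ hM1 (by norm_num)
  nlinarith

/-! ### Reciprocal sums -/

theorem sum_comp_le_card_fiber_mul {α β : Type*} [DecidableEq β] (P : Finset α) (Q : Finset β)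
    (π : α → β) (φ : β → ℝ) (t : ℕ) (hφ : ∀ q ∈ Q, 0 ≤ φ q) (hπ : ∀ p ∈ P, π p ∈ Q)
    (ht : ∀ q ∈ Q, (P.filter fun p => π p = q).card ≤ t) :
    ∑ p ∈ P, φ (π p) ≤ t * ∑ q ∈ Q, φ q := by
  rw [← Finset.sum_fiberwise_of_maps_to hπ, Finset.mul_sum]
  refine Finset.sum_le_sum fun q hq => ?_
  rw [Finset.sum_congr rfl (g := fun _ => φ q)
    (fun p hp => by rw [(Finset.mem_filter.1 hp).2]), Finset.sum_const, nsmul_eq_mul]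
  have : ((P.filter fun p => π p = q).card : ℝ) ≤ t := by exact_mod_cast ht q hq
  exact mul_le_mul_of_nonneg_right this (hφ q hq)

theorem sum_sum_mul_le (M t : ℕ) (φ : ℕ → ℝ) (hφ : ∀ n, 0 ≤ φ n)
    (ht : ∀ n, n ≠ 0 → n ≤ M ^ 2 → n.divisors.card ≤ t) :
    ∑ d ∈ Ico 1 M, ∑ e ∈ Ico 1 M, φ (d * e) ≤ t * ∑ m ∈ range (M ^ 2), φ m := by
  classical
  have h1 : ∑ d ∈ Ico 1 M, ∑ e ∈ Ico 1 M, φ (d * e) =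
      ∑ p ∈ Ico 1 M ×ˢ Ico 1 M, φ (p.1 * p.2) := by rw [Finset.sum_product]
  rw [h1]
  refine sum_comp_le_card_fiber_mul _ _ (fun p : ℕ × ℕ => p.1 * p.2) φ t (fun _ _ => hφ _) ?_ ?_
  · intro p hp
    simp only [Finset.mem_product, Finset.mem_Ico, Finset.mem_range] at hp ⊢
    nlinarith
  · intro n hn
    rw [Finset.mem_range] at hn
    rcases Nat.eq_zero_or_pos n with rfl | hn0
    · refine le_trans (le_of_eq ?_) (Nat.zero_le t)
      rw [Finset.card_eq_zero, Finset.filter_eq_empty_iff]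
      intro p hp h0
      simp only [Finset.mem_product, Finset.mem_Ico] at hp
      rcases Nat.mul_eq_zero.1 h0 with h | h <;> lia
    · refine le_trans ?_ (ht n hn0.ne' hn.le)
      refine Finset.card_le_card_of_injOn Prod.fst ?_ ?_
      · intro p hp
        simp only [Finset.coe_filter, Set.mem_ofPred_eq] at hp
        simpa [hn0.ne'] using ⟨p.2, hp.2.symm⟩
      · intro p hp p' hp' h
        simp only [Finset.coe_filter, Set.mem_ofPred_eq, Finset.mem_product, Finset.mem_Ico] at hp hp'
        refine Prod.ext h ?_
        have h2 := hp.2.trans hp'.2.symm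
        rw [← h] at h2
        exact Nat.eq_of_mul_eq_mul_left (by lia) h2

theorem one_le_two_mul_abs_sub {q : ℕ} {θ : ℝ} {a : ℤ} (hcop : IsCoprime a (q : ℤ))
    (hθ : |q * θ - a| ≤ 1 / q) {k : ℕ} (hk : 0 < k) (hkq : 2 * k ≤ q) (n : ℤ) :
    1 ≤ 2 * q * |k * θ - n| := by
  have hq : 0 < q := by lia
  have hqR : (0 : ℝ) < q := by exact_mod_cast hq
  have h1 : (k : ℤ) * a - q * n ≠ 0 := by
    intro h
    have h2 : (q : ℤ) ∣ a * k := ⟨n, by linarith⟩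
    have h3 : (q : ℤ) ∣ k := hcop.symm.dvd_of_dvd_mul_left h2
    have := Nat.le_of_dvd hk (Int.natCast_dvd_natCast.1 h3)
    lia
  have h2 : (1 : ℝ) ≤ |(k : ℝ) * a - q * n| := by
    have := Int.one_le_abs h1
    exact_mod_cast this
  have h3 : |(k : ℝ) * (q * θ - a)| ≤ 1 / 2 := by
    rw [abs_mul, Nat.abs_cast]
    calc (k : ℝ) * |q * θ - a| ≤ k * (1 / q) := by gcongr
      _ ≤ 1 / 2 := by
        rw [mul_one_div, div_le_div_iff₀ hqR two_pos]
        have : (2 * k : ℝ) ≤ q := by exact_mod_cast hkq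
        linarith
  have h4 : (q : ℝ) * (k * θ - n) = k * (q * θ - a) + (k * a - q * n) := by ring
  have h5 : (q : ℝ) * |k * θ - n| = |(q : ℝ) * (k * θ - n)| := by rw [abs_mul, Nat.abs_cast]
  have h6 := abs_sub_abs_le_abs_add ((k : ℝ) * a - q * n) (k * (q * θ - a))
  rw [mul_assoc, h5, h4, add_comm]
  linarith

theorem sum_linBound_block_le (M q B m₀ : ℕ) (hq : 0 < q) (θ : ℝ) (a : ℤ) (hcop : IsCoprime a (q : ℤ))
    (hθ : |q * θ - a| ≤ 1 / q) (hB : 2 * B ≤ q + 2) :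
    ∑ r ∈ range B, linBound M ((m₀ + r : ℕ) * θ) ≤ 2 * M + 2 * q * (1 + Real.log q) := by
  classical
  have hqR : (0 : ℝ) < q := by exact_mod_cast hq
  set s : ℕ → ℝ := fun r => (m₀ + r : ℕ) * θ - round ((m₀ + r : ℕ) * θ) with hs
  set z : ℕ → ℤ := fun r => ⌊2 * q * s r⌋ with hz
  set w : ℕ → ℕ := fun r => if 0 ≤ z r then (z r).toNat else (-(z r + 1)).toNat with hw
  set ψ : ℕ → ℝ := fun n => if n = 0 then (M : ℝ) else q / n with hψ
  have hinj : ∀ r r' : ℕ, r < r' → r' < B → z r ≠ z r' := by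
    intro r r' hrr hr' h
    have h1 := one_le_two_mul_abs_sub hcop hθ (k := r' - r) (by lia) (by lia)
      (round ((m₀ + r' : ℕ) * θ) - round ((m₀ + r : ℕ) * θ))
    have h2 := Int.abs_sub_lt_one_of_floor_eq_floor h
    rw [abs_sub_comm, ← mul_sub, abs_mul, abs_of_pos (by positivity : (0 : ℝ) < 2 * q)] at h2
    have h3 : ((r' - r : ℕ) : ℝ) * θ -
        ((round ((m₀ + r' : ℕ) * θ) - round ((m₀ + r : ℕ) * θ) : ℤ) : ℝ) = s r' - s r := by
      rw [Nat.cast_sub hrr.le, hs]; push_cast; ring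
    rw [h3] at h1
    linarith
  have hws : ∀ r, (w r : ℝ) ≤ 2 * q * |s r| := by
    intro r
    have h1 : (z r : ℝ) ≤ 2 * q * s r := Int.floor_le _
    have h2 : 2 * q * s r < z r + 1 := Int.lt_floor_add_one _
    by_cases h : 0 ≤ z r
    · have h3 : ((z r).toNat : ℝ) = z r := by exact_mod_cast Int.toNat_of_nonneg h
      simp only [hw, if_pos h, h3]
      exact h1.trans (by gcongr; exact le_abs_self _)
    · have h3 : ((-(z r + 1)).toNat : ℝ) = -(z r + 1) := by
        have : (((-(z r + 1)).toNat : ℤ) : ℝ) = ((-(z r + 1) : ℤ) : ℝ) := by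
          rw [Int.toNat_of_nonneg (by lia)]
        push_cast at this ⊢; exact this
      simp only [hw, if_neg h, h3]
      have : 2 * q * -s r ≤ 2 * q * |s r| := by gcongr; exact neg_le_abs _
      linarith
  have hle : ∀ r, linBound M ((m₀ + r : ℕ) * θ) ≤ ψ (w r) := by
    intro r
    by_cases h : w r = 0
    · simp only [hψ, h, if_true]; exact linBound_le _ _
    · have h0 : (0 : ℝ) < w r := by exact_mod_cast Nat.pos_of_ne_zero h
      simp only [hψ, h, if_false]
      rw [le_div_iff₀ h0]
      have h1 := linBound_mul_distInt_le M ((m₀ + r : ℕ) * θ)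
      have h2 := mul_le_mul_of_nonneg_left (hws r) (linBound_nonneg M ((m₀ + r : ℕ) * θ))
      have h3 : |s r| = distInt ((m₀ + r : ℕ) * θ) := rfl
      rw [h3] at h2
      nlinarith
  have hwq : ∀ r, w r ≤ q := by
    intro r
    have h1 := hws r
    have h2 : |s r| ≤ 1 / 2 := abs_sub_round _
    have : (w r : ℝ) ≤ q := by nlinarith
    exact_mod_cast this
  have hψ0 : ∀ n, 0 ≤ ψ n := fun n => by simp only [hψ]; split_ifs <;> positivity
  have h1 := sum_comp_le_card_fiber_mul (range B) (range (q + 1)) w ψ 2 (fun n _ => hψ0 n)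
    (fun r _ => Finset.mem_range.2 (Nat.lt_succ_of_le (hwq r))) (fun n _ => by
      have h2 : ((range B).filter fun r => w r = n).card ≤ ({(n : ℤ), -(n + 1 : ℤ)} : Finset ℤ).card := by
        refine Finset.card_le_card_of_injOn z ?_ ?_
        · intro r hr
          have h3 := (Finset.mem_filter.1 hr).2
          simp only [hw] at h3
          simp only [Finset.coe_insert, Finset.coe_singleton, Set.mem_insert_iff,
            Set.mem_singleton_iff]
          split_ifs at h3 <;> lia
        · intro r hr r' hr' h
          have h3 := Finset.mem_range.1 (Finset.mem_filter.1 hr).1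
          have h4 := Finset.mem_range.1 (Finset.mem_filter.1 hr').1
          rcases lt_trichotomy r r' with h5 | h5 | h5
          · exact absurd h (hinj r r' h5 h4)
          · exact h5
          · exact absurd h.symm (hinj r' r h5 h3)
      exact h2.trans Finset.card_le_two)
  refine (Finset.sum_le_sum fun r _ => hle r).trans (h1.trans ?_)
  have h2 : ∑ n ∈ range (q + 1), ψ n = M + q * (harmonic q : ℝ) := by
    rw [Finset.sum_range_succ']
    simp only [hψ, Nat.succ_ne_zero, if_false, if_true, harmonic]
    push_cast
    rw [Finset.mul_sum, add_comm]
    rfl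
  rw [h2]
  have h3 := harmonic_le_one_add_log q
  push_cast
  nlinarith

theorem sum_linBound_le (M q L : ℕ) (hq : 0 < q) (θ : ℝ) (a : ℤ) (hcop : IsCoprime a (q : ℤ))
    (hθ : |q * θ - a| ≤ 1 / q) :
    ∑ n ∈ range L, linBound M (n * θ) ≤ (2 * L / q + 1) * (2 * M + 2 * q * (1 + Real.log q)) := by
  have hqR : (0 : ℝ) < q := by exact_mod_cast hq
  set B := q / 2 + 1 with hB
  have hB0 : 0 < B := by lia
  set T := L / B + 1 with hT
  have hL : L ≤ T * B := by
    have := Nat.lt_div_mul_add hB0 (a := L)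
    rw [hT, add_mul, one_mul]; lia
  have hlog : 0 ≤ Real.log q := Real.log_natCast_nonneg q
  have h1 : ∑ n ∈ range (T * B), linBound M (n * θ) ≤ T * (2 * M + 2 * q * (1 + Real.log q)) := by
    generalize T = T
    induction T with
    | zero => simp
    | succ T ih =>
      rw [add_mul, one_mul, Finset.sum_range_add]
      have := sum_linBound_block_le M q B (T * B) hq θ a hcop hθ (by lia)
      push_cast at this ih ⊢
      linarith
  have h2 : (T : ℝ) ≤ 2 * L / q + 1 := by
    rw [hT]; push_cast
    gcongr
    calc ((L / B : ℕ) : ℝ) ≤ (L : ℝ) / B := Nat.cast_div_le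
      _ ≤ L / (q / 2) := by
        have : (q : ℝ) ≤ 2 * B := by exact_mod_cast (by lia : q ≤ 2 * B)
        gcongr; linarith
      _ = _ := by field_simp
  calc _ ≤ ∑ n ∈ range (T * B), linBound M (n * θ) :=
        Finset.sum_le_sum_of_subset_of_nonneg (Finset.range_subset_range.2 hL)
          fun _ _ _ => linBound_nonneg _ _
    _ ≤ _ := h1.trans (by gcongr)

/-! ### Large Weyl sums force rational approximations -/

theorem exists_dirichlet_approx (θ X : ℝ) (hX : 1 ≤ X) :
    ∃ q : ℕ, ∃ a : ℤ, 0 < q ∧ (q : ℝ) ≤ X ∧ IsCoprime a (q : ℤ) ∧ |q * θ - a| ≤ 1 / q ∧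
      |q * θ - a| ≤ 1 / X := by
  have hn : 0 < ⌊X⌋₊ := Nat.floor_pos.2 hX
  obtain ⟨r, h1, h2⟩ := Real.exists_rat_abs_sub_le_and_den_le θ hn
  have hd : (0 : ℝ) < r.den := by exact_mod_cast r.den_pos
  have h3 : |(r.den : ℝ) * θ - r.num| ≤ 1 / (⌊X⌋₊ + 1) := by
    have h4 : (r.den : ℝ) * θ - r.num = r.den * (θ - r) := by
      have : (r : ℝ) * r.den = r.num := by exact_mod_cast Rat.mul_den_eq_num r
      linear_combination this
    rw [h4, abs_mul, Nat.abs_cast]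
    calc (r.den : ℝ) * |θ - r| ≤ r.den * (1 / ((⌊X⌋₊ + 1) * r.den)) := by gcongr
      _ = _ := by field_simp
  have h5 : (r.den : ℝ) ≤ ⌊X⌋₊ := by exact_mod_cast h2
  refine ⟨r.den, r.num, r.den_pos, h5.trans (Nat.floor_le (by linarith)), ?_, h3.trans ?_,
    h3.trans ?_⟩
  · rw [Int.isCoprime_iff_gcd_eq_one, Int.gcd_eq_natAbs, Int.natAbs_natCast]
    exact r.reduced
  · exact one_div_le_one_div_of_le hd (by linarith)
  · exact one_div_le_one_div_of_le (by linarith) (Nat.lt_floor_add_one X).le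

theorem exists_cubic_approx {M t : ℕ} {ℓ A Z a b c : ℝ} (φ : ℕ → ℝ)
    (hφ : ∀ x : ℕ, φ x = a * x ^ 3 + b * x ^ 2 + c * x + φ 0)
    (hM0 : 0 < M)
    (ht : ∀ n, n ≠ 0 → n ≤ M ^ 2 → n.divisors.card ≤ t) (ht1 : 1 ≤ t)
    (hℓ : ∀ q : ℕ, 0 < q → q ≤ M ^ 3 → 1 + Real.log q ≤ ℓ) (hA : 1 ≤ A)
    (hf : M ≤ A * ‖∑ x ∈ range M, unitExp (φ x)‖)
    (hZ : 318 * t * ℓ * A ^ 4 < Z) (hZM : Z ≤ M) :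
    ∃ q : ℕ, 0 < q ∧ (q : ℝ) ≤ Z ∧ distInt (q * (6 * a)) ≤ Z / M ^ 3 := by
  have ht1R : (1 : ℝ) ≤ t := by exact_mod_cast ht1
  have hM1 : (1 : ℝ) ≤ M := by exact_mod_cast hM0
  have hℓ1 : 1 ≤ ℓ := by simpa using hℓ 1 one_pos (Nat.one_le_pow _ _ hM0)
  have hZ0 : 1 ≤ Z := by
    have h1 : (1 : ℝ) ≤ A ^ 4 := one_le_pow₀ hA
    have h2 : 1 ≤ (t : ℝ) * ℓ * A ^ 4 := by
      calc (1 : ℝ) = 1 * 1 * 1 := by ring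
        _ ≤ _ := by gcongr
    nlinarith
  have hX : 1 ≤ (M : ℝ) ^ 3 / Z := by
    rw [one_le_div (by linarith)]
    exact hZM.trans (le_self_pow₀ hM1 (by norm_num))
  obtain ⟨q, n, hq, hqX, hcop, h1, h2⟩ := exists_dirichlet_approx (6 * a) _ hX
  have hqR : (0 : ℝ) < q := by exact_mod_cast hq
  refine ⟨q, hq, ?_, (distInt_le _ n).trans (h2.trans_eq (by rw [one_div_div]))⟩
  by_contra! hqZ
  have hZM3 : (M : ℝ) ^ 3 / Z ≤ M ^ 3 := div_le_self (by positivity) hZ0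
  have hqM : q ≤ M ^ 3 := by exact_mod_cast hqX.trans hZM3
  have hl := hℓ q hq hqM
  have h3 := norm_pow_four_sum_cubic_le M a b c φ hφ
  have h4 := sum_sum_mul_le M t (fun n => linBound M (n * (6 * a)))
    (fun _ => linBound_nonneg _ _) ht
  have h5 := sum_linBound_le M q (M ^ 2) hq (6 * a) n hcop h1
  set S := ‖∑ x ∈ range M, unitExp (φ x)‖
  have h6 : S ^ 4 ≤ 106 * t * ℓ * (M ^ 4 / q + M ^ 3 + q * M) := by
    have h7 : (2 * ((M ^ 2 : ℕ) : ℝ) / q + 1) * (2 * M + 2 * q * (1 + Real.log q)) ≤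
        (2 * M ^ 2 / q + 1) * (2 * M + 2 * q * ℓ) := by push_cast; gcongr
    have h8 : S ^ 4 ≤ 10 * M ^ 3 + 16 * M * (t * ((2 * M ^ 2 / q + 1) * (2 * M + 2 * q * ℓ))) := by
      refine h3.trans ?_
      gcongr
      exact h4.trans (by gcongr; exact h5.trans h7)
    refine h8.trans ?_
    have e1 : (2 * (M : ℝ) ^ 2 / q + 1) * (2 * M + 2 * q * ℓ) =
        4 * (M ^ 3 / q) + 4 * M ^ 2 * ℓ + 2 * M + 2 * q * ℓ := by field_simp; ring
    have htl : 1 ≤ (t : ℝ) * ℓ := by nlinarith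
    have htt : (t : ℝ) ≤ t * ℓ := by nlinarith
    have e2 : (M : ℝ) ^ 4 / q = M * (M ^ 3 / q) := by ring
    have e3 : (M : ℝ) ^ 2 ≤ M ^ 3 := pow_le_pow_right₀ hM1 (by norm_num)
    have e4 : 0 ≤ (M : ℝ) ^ 3 / q := by positivity
    rw [e1, e2]
    have f1 : 10 * (M : ℝ) ^ 3 ≤ 10 * (t * ℓ) * M ^ 3 := by gcongr; linarith
    have f2 : 64 * (t : ℝ) * (M * (M ^ 3 / q)) ≤ 64 * (t * ℓ) * (M * (M ^ 3 / q)) := by gcongr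
    have f3 : 32 * (t : ℝ) * M ^ 2 ≤ 32 * (t * ℓ) * M ^ 3 := by gcongr
    have f4 : 0 ≤ t * ℓ * (M * (M ^ 3 / q)) := by positivity
    have f5 : 0 ≤ t * ℓ * (q * M) := by positivity
    nlinarith
  have h7 : (M : ℝ) ^ 4 ≤ A ^ 4 * S ^ 4 := by
    rw [← mul_pow]; exact pow_le_pow_left₀ (by positivity) hf 4
  have hZ' : (0 : ℝ) < Z := by linarith
  have g1 : (M : ℝ) ^ 4 / q ≤ M ^ 4 / Z := by gcongr
  have g2 : (M : ℝ) ^ 3 ≤ M ^ 4 / Z := by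
    rw [le_div_iff₀ hZ']
    calc (M : ℝ) ^ 3 * Z ≤ M ^ 3 * M := by gcongr
      _ = _ := by ring
  have g3 : (q : ℝ) * M ≤ M ^ 4 / Z := by
    calc (q : ℝ) * M ≤ M ^ 3 / Z * M := by gcongr
      _ = _ := by ring
  have g4 : (M : ℝ) ^ 4 ≤ A ^ 4 * (106 * t * ℓ * (3 * (M ^ 4 / Z))) := by
    refine h7.trans ?_
    gcongr
    refine h6.trans ?_
    gcongr
    linarith
  have g5 : A ^ 4 * (106 * t * ℓ * (3 * ((M : ℝ) ^ 4 / Z))) =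
      (318 * t * ℓ * A ^ 4) * (M ^ 4 / Z) := by ring
  have g6 : (318 * t * ℓ * A ^ 4) * ((M : ℝ) ^ 4 / Z) < Z * (M ^ 4 / Z) := by gcongr
  rw [mul_div_cancel₀ _ hZ'.ne'] at g6
  linarith

theorem exists_quadratic_approx {M : ℕ} {ℓ A Z b c : ℝ} (φ : ℕ → ℝ)
    (hφ : ∀ x : ℕ, φ x = b * x ^ 2 + c * x + φ 0) (hM0 : 0 < M)
    (hℓ : ∀ q : ℕ, 0 < q → q ≤ M ^ 2 → 1 + Real.log q ≤ ℓ) (hA : 1 ≤ A)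
    (hf : M ≤ A * ‖∑ x ∈ range M, unitExp (φ x)‖)
    (hZ : 39 * ℓ * A ^ 2 < Z) (hZM : Z ≤ M) :
    ∃ q : ℕ, 0 < q ∧ (q : ℝ) ≤ Z ∧ distInt (q * (2 * b)) ≤ Z / M ^ 2 := by
  have hM1 : (1 : ℝ) ≤ M := by exact_mod_cast hM0
  have hℓ1 : 1 ≤ ℓ := by simpa using hℓ 1 one_pos (Nat.one_le_pow _ _ hM0)
  have hZ0 : 1 ≤ Z := by
    have h1 : (1 : ℝ) ≤ A ^ 2 := one_le_pow₀ hA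
    nlinarith
  have hX : 1 ≤ (M : ℝ) ^ 2 / Z := by
    rw [one_le_div (by linarith)]
    exact hZM.trans (le_self_pow₀ hM1 (by norm_num))
  obtain ⟨q, n, hq, hqX, hcop, h1, h2⟩ := exists_dirichlet_approx (2 * b) _ hX
  have hqR : (0 : ℝ) < q := by exact_mod_cast hq
  refine ⟨q, hq, ?_, (distInt_le _ n).trans (h2.trans_eq (by rw [one_div_div]))⟩
  by_contra! hqZ
  have hZM3 : (M : ℝ) ^ 2 / Z ≤ M ^ 2 := div_le_self (by positivity) hZ0
  have hqM : q ≤ M ^ 2 := by exact_mod_cast hqX.trans hZM3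
  have hl := hℓ q hq hqM
  have h3 := norm_sq_sum_quadratic_le (le_refl M) b c φ hφ
  have h4 : ∑ e ∈ Ico 1 M, linBound M ((e : ℕ) * (2 * b)) ≤
      ∑ e ∈ range M, linBound M ((e : ℕ) * (2 * b)) := by
    rw [Finset.range_eq_Ico]
    exact Finset.sum_le_sum_of_subset_of_nonneg (Finset.Ico_subset_Ico_left (by lia))
      fun _ _ _ => linBound_nonneg _ _
  have h5 := sum_linBound_le M q M hq (2 * b) n hcop h1
  set S := ‖∑ x ∈ range M, unitExp (φ x)‖
  have h6 : S ^ 2 ≤ 13 * ℓ * (M ^ 2 / q + M + q) := by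
    have h7 : (2 * (M : ℝ) / q + 1) * (2 * M + 2 * q * (1 + Real.log q)) ≤
        (2 * M / q + 1) * (2 * M + 2 * q * ℓ) := by gcongr
    have e1 : (2 * (M : ℝ) / q + 1) * (2 * M + 2 * q * ℓ) =
        4 * (M ^ 2 / q) + 4 * M * ℓ + 2 * M + 2 * q * ℓ := by field_simp; ring
    have f1 : (M : ℝ) ≤ ℓ * M := le_mul_of_one_le_left (by linarith) hℓ1
    have f2 : (M : ℝ) ^ 2 / q ≤ ℓ * (M ^ 2 / q) := le_mul_of_one_le_left (by positivity) hℓ1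
    have f3 : 0 ≤ ℓ * q := by positivity
    nlinarith
  have h7 : (M : ℝ) ^ 2 ≤ A ^ 2 * S ^ 2 := by
    rw [← mul_pow]; exact pow_le_pow_left₀ (by positivity) hf 2
  have hZ' : (0 : ℝ) < Z := by linarith
  have g1 : (M : ℝ) ^ 2 / q ≤ M ^ 2 / Z := by gcongr
  have g2 : (M : ℝ) ≤ M ^ 2 / Z := by
    rw [le_div_iff₀ hZ', sq]; gcongr
  have g4 : (M : ℝ) ^ 2 ≤ A ^ 2 * (13 * ℓ * (3 * (M ^ 2 / Z))) := by
    refine h7.trans ?_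
    gcongr
    refine h6.trans ?_
    gcongr
    linarith
  have g5 : A ^ 2 * (13 * ℓ * (3 * ((M : ℝ) ^ 2 / Z))) = (39 * ℓ * A ^ 2) * (M ^ 2 / Z) := by ring
  have g6 : (39 * ℓ * A ^ 2) * ((M : ℝ) ^ 2 / Z) < Z * (M ^ 2 / Z) := by gcongr
  rw [mul_div_cancel₀ _ hZ'.ne'] at g6
  linarith

/-! ### Passing to progressions -/

theorem norm_sum_range_add_sub_le (M k : ℕ) (g : ℕ → ℂ) (hg : ∀ x, ‖g x‖ ≤ 1) :
    ‖∑ x ∈ range M, g (x + k) - ∑ x ∈ range M, g x‖ ≤ 2 * k := by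
  have h1 := Finset.sum_range_add g k M
  have h2 := Finset.sum_range_add g M k
  rw [add_comm M k, h1] at h2
  have h3 : ∑ x ∈ range M, g (x + k) - ∑ x ∈ range M, g x =
      ∑ x ∈ range k, g (M + x) - ∑ x ∈ range k, g x := by
    simp only [add_comm _ k]
    linear_combination h2
  have h4 : ∀ f : ℕ → ℂ, (∀ x, ‖f x‖ ≤ 1) → ‖∑ x ∈ range k, f x‖ ≤ k := fun f hf =>
    (norm_sum_le_of_le _ fun x _ => hf x).trans (by simp)
  rw [h3]
  refine (norm_sub_le _ _).trans ?_
  linarith [h4 g hg, h4 (fun x => g (M + x)) fun x => hg _]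

theorem exists_progression_of_large {M q L : ℕ} {A : ℝ} (hM : 0 < M) (hA : 0 < A) (ψ p : ℕ → ℝ)
    (hf : M ≤ A * ‖∑ x ∈ range M, unitExp (ψ x + p x)‖) (hL : 8 * A * (q * L) ≤ M)
    (hψ : ∀ x < M, ∀ y < L, 4 * A * ‖unitExp (ψ (x + q * y) - ψ x) - 1‖ ≤ 1) :
    ∃ x < M, (L : ℝ) ≤ 2 * A * ‖∑ y ∈ range L, unitExp (p (x + q * y))‖ := by
  by_contra! hcon
  have hL0 : 0 < L := by
    have h := hcon 0 hM
    have h2 : (0 : ℝ) < L := lt_of_le_of_lt (by positivity) h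
    exact_mod_cast h2
  have hMR : (0 : ℝ) < M := by exact_mod_cast hM
  have hLR : (0 : ℝ) < L := by exact_mod_cast hL0
  set F : ℕ → ℂ := fun x => unitExp (ψ x + p x) with hF
  have h1 : ∀ y ∈ range L, ‖∑ x ∈ range M, F (x + q * y) - ∑ x ∈ range M, F x‖ ≤ 2 * (q * L) := by
    intro y hy
    have := norm_sum_range_add_sub_le M (q * y) F fun x => (norm_unitExp _).le
    refine this.trans ?_
    have : (y : ℝ) ≤ L := by exact_mod_cast (Finset.mem_range.1 hy).le
    push_cast; gcongr
  have h2 : L * ‖∑ x ∈ range M, F x‖ ≤ ∑ x ∈ range M, ‖∑ y ∈ range L, F (x + q * y)‖ +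
      L * (2 * (q * L)) := by
    have e1 : (L : ℂ) * ∑ x ∈ range M, F x = ∑ x ∈ range M, ∑ y ∈ range L, F (x + q * y) -
        ∑ y ∈ range L, (∑ x ∈ range M, F (x + q * y) - ∑ x ∈ range M, F x) := by
      rw [Finset.sum_sub_distrib, Finset.sum_comm]; simp
    have e2 : (L : ℝ) * ‖∑ x ∈ range M, F x‖ = ‖(L : ℂ) * ∑ x ∈ range M, F x‖ := by simp
    rw [e2, e1]
    refine (norm_sub_le _ _).trans (add_le_add (norm_sum_le _ _) ?_)
    exact (norm_sum_le_of_le _ h1).trans (by simp)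
  have h3 : ∀ x ∈ range M, 4 * A * ‖∑ y ∈ range L, F (x + q * y)‖ < 3 * L := by
    intro x hx
    have hxM := Finset.mem_range.1 hx
    have e1 : ∑ y ∈ range L, F (x + q * y) = unitExp (ψ x) * (∑ y ∈ range L, unitExp (p (x + q * y)) +
        ∑ y ∈ range L, (unitExp (ψ (x + q * y) - ψ x) - 1) * unitExp (p (x + q * y))) := by
      rw [← Finset.sum_add_distrib, Finset.mul_sum]
      refine Finset.sum_congr rfl fun y _ => ?_
      change unitExp (ψ (x + q * y) + p (x + q * y)) = _
      rw [show ψ (x + q * y) + p (x + q * y) =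
        ψ x + (ψ (x + q * y) - ψ x) + p (x + q * y) by ring]
      simp only [unitExp_add]; ring
    have e2 : ‖∑ y ∈ range L, F (x + q * y)‖ ≤ ‖∑ y ∈ range L, unitExp (p (x + q * y))‖ +
        ∑ y ∈ range L, ‖unitExp (ψ (x + q * y) - ψ x) - 1‖ := by
      rw [e1, norm_mul, norm_unitExp, one_mul]
      refine (norm_add_le _ _).trans (add_le_add le_rfl ((norm_sum_le _ _).trans_eq ?_))
      simp
    have e3 : 4 * A * ∑ y ∈ range L, ‖unitExp (ψ (x + q * y) - ψ x) - 1‖ ≤ L := by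
      rw [Finset.mul_sum]
      refine (Finset.sum_le_sum fun y hy => hψ x hxM y (Finset.mem_range.1 hy)).trans ?_
      simp
    have e4 := mul_le_mul_of_nonneg_left e2 (by positivity : 0 ≤ 4 * A)
    have := hcon x hxM
    nlinarith
  have h4 : 4 * A * ∑ x ∈ range M, ‖∑ y ∈ range L, F (x + q * y)‖ < M * (3 * L) := by
    rw [Finset.mul_sum]
    refine (Finset.sum_lt_sum_of_nonempty (Finset.nonempty_range_iff.2 hM.ne') h3).trans_eq ?_
    simp
  have h6 := mul_le_mul_of_nonneg_left h2 (by positivity : 0 ≤ 4 * A)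
  have h7 := mul_le_mul_of_nonneg_left hf (by positivity : 0 ≤ 4 * (L : ℝ))
  have h8 := mul_le_mul_of_nonneg_left hL (by positivity : 0 ≤ (L : ℝ))
  nlinarith

theorem distInt_int_mul_le (k : ℤ) (θ : ℝ) : distInt (k * θ) ≤ |(k : ℝ)| * distInt θ := by
  have := distInt_le (k * θ) (k * round θ)
  refine this.trans_eq ?_
  push_cast
  rw [distInt, ← mul_sub, abs_mul]

theorem norm_unitExp_int_mul_sub_one_le (k : ℤ) (θ : ℝ) :
    ‖unitExp (k * θ) - 1‖ ≤ 2 * Real.pi * (|(k : ℝ)| * distInt θ) := by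
  rw [← unitExp_sub_round]
  refine (norm_unitExp_sub_one_le _).trans_eq ?_
  rw [abs_mul, distInt]

set_option maxHeartbeats 1000000 in
/-- If the cubic exponential sum of length `M` is at least `M / m ^ d`, all coefficients of the phase
are simultaneously well approximated, with a common denominator. -/
theorem exists_coeff_approx {m d W M : ℕ} {a b c : ℝ} (φ : ℕ → ℝ)
    (hφ : ∀ x : ℕ, φ x = a * x ^ 3 + b * x ^ 2 + c * x + φ 0)
    (hm : 400 ≤ m) (hW : 0 < W) (hM : M = W * m ^ (8 * d + 7))
    (ht : ∀ n, n ≠ 0 → n ≤ M ^ 2 → n.divisors.card ≤ m)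
    (hℓ : ∀ q : ℕ, 0 < q → q ≤ M ^ 3 → 1 + Real.log q ≤ m)
    (hf : M ≤ (m : ℝ) ^ d * ‖∑ x ∈ range M, unitExp (φ x)‖) :
    ∃ K : ℕ, 0 < K ∧ K ≤ m ^ (13 * d + 11) ∧
      distInt (K * a) ≤ (m : ℝ) ^ (13 * d + 11) / M ^ 3 ∧
      distInt (K * b) ≤ (m : ℝ) ^ (13 * d + 11) / M ^ 2 ∧
      distInt (K * c) ≤ (m : ℝ) ^ (13 * d + 11) / M := by
  have hmR : (400 : ℝ) ≤ m := by exact_mod_cast hm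
  have hm0 : (0 : ℝ) < m := by linarith
  have hm1 : (1 : ℝ) ≤ m := by linarith
  have hm0N : 0 < m := by lia
  have hWR : (1 : ℝ) ≤ W := by exact_mod_cast hW
  have hM0 : 0 < M := by rw [hM]; positivity
  have hMR : (0 : ℝ) < M := by exact_mod_cast hM0
  have hA1 : (1 : ℝ) ≤ (m : ℝ) ^ d := one_le_pow₀ hm1
  have hMc : (M : ℝ) = W * m ^ (8 * d + 7) := by rw [hM]; push_cast; ring
  set A : ℝ := (m : ℝ) ^ d with hA
  have hpi := Real.pi_lt_four
  have hpi0 := Real.pi_pos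

  obtain ⟨q₁, hq₁, hq₁Z, hd₁⟩ := exists_cubic_approx (Z := (m : ℝ) ^ (4 * d + 3)) φ hφ hM0 ht
    (by lia) hℓ hA1 hf (by
      have : (m : ℝ) ^ (4 * d + 3) = m * (m * m * A ^ 4) := by rw [hA]; ring
      rw [this, mul_assoc 318, mul_assoc 318]
      have : 0 < (m : ℝ) * m * A ^ 4 := by positivity
      gcongr; linarith) (by
      rw [hMc]
      calc (m : ℝ) ^ (4 * d + 3) ≤ m ^ (8 * d + 7) := pow_le_pow_right₀ hm1 (by lia)
        _ ≤ _ := le_mul_of_one_le_left (by positivity) hWR)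
  set q := 6 * q₁ with hq
  have hqR : (q : ℝ) ≤ 6 * (m : ℝ) ^ (4 * d + 3) := by rw [hq]; push_cast; linarith
  have hqa : distInt (q * a) ≤ (m : ℝ) ^ (4 * d + 3) / M ^ 3 := by
    convert hd₁ using 2; rw [hq]; push_cast; ring
  set L := W * m ^ (3 * d + 3) with hL
  have hL0 : 0 < L := by rw [hL]; positivity
  have hLR : (0 : ℝ) < L := by exact_mod_cast hL0
  have hML : (M : ℝ) = L * (A * m ^ (4 * d + 3) * m) := by
    rw [hMc, hL, hA]; push_cast; ring
  have hqL : 8 * A * (q * L) ≤ M := by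
    rw [hML]
    calc 8 * A * ((q : ℝ) * L) ≤ 8 * A * (6 * (m : ℝ) ^ (4 * d + 3) * L) := by gcongr
      _ = L * (A * m ^ (4 * d + 3) * 48) := by ring
      _ ≤ _ := by gcongr; linarith
  obtain ⟨x, hx, hf₂⟩ := exists_progression_of_large hM0 (by positivity) (fun x => a * x ^ 3)
    (fun x => b * x ^ 2 + c * x + φ 0) (q := q) (L := L) (A := A) (by
      refine hf.trans_eq ?_
      congr 2; refine Finset.sum_congr rfl fun x _ => ?_
      rw [hφ x]; congr 1; ring) hqL (by
      intro x hx y hy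
      have e1 : a * ((x + q * y : ℕ) : ℝ) ^ 3 - a * (x : ℝ) ^ 3 =
          ((3 * x ^ 2 * y + 3 * x * q * y ^ 2 + q ^ 2 * y ^ 3 : ℕ) : ℤ) * (q * a) := by
        push_cast; ring
      simp only [e1]
      have e2 := norm_unitExp_int_mul_sub_one_le
        ((3 * x ^ 2 * y + 3 * x * q * y ^ 2 + q ^ 2 * y ^ 3 : ℕ) : ℤ) (q * a)
      have hxR : (x : ℝ) ≤ M := by exact_mod_cast hx.le
      have hyR : (y : ℝ) ≤ L := by exact_mod_cast hy.le
      have hqyM : (q : ℝ) * y ≤ M := by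
        have h0 : (q : ℝ) * y ≤ q * L := by gcongr
        have h1 : (q : ℝ) * L ≤ 8 * A * (q * L) := by
          refine le_mul_of_one_le_left (by positivity) (by linarith)
        linarith
      have e3 : |((((3 * x ^ 2 * y + 3 * x * q * y ^ 2 + q ^ 2 * y ^ 3 : ℕ) : ℤ)) : ℝ)| ≤
          7 * M ^ 2 * L := by
        rw [Int.cast_natCast, Nat.abs_cast]; push_cast
        calc 3 * (x : ℝ) ^ 2 * y + 3 * x * q * y ^ 2 + q ^ 2 * y ^ 3
            = (3 * (x : ℝ) ^ 2 + 3 * x * (q * y) + (q * y) ^ 2) * y := by ring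
          _ ≤ (3 * (M : ℝ) ^ 2 + 3 * M * M + M ^ 2) * L := by gcongr
          _ = _ := by ring
      calc _ ≤ 4 * A * (2 * Real.pi * (7 * M ^ 2 * L * ((m : ℝ) ^ (4 * d + 3) / M ^ 3))) := by
            refine mul_le_mul_of_nonneg_left (e2.trans ?_) (by positivity)
            gcongr
            exact distInt_nonneg _
        _ ≤ 4 * A * (2 * 4 * (7 * M ^ 2 * L * ((m : ℝ) ^ (4 * d + 3) / M ^ 3))) := by gcongr
        _ = 224 / m * ((L * (A * m ^ (4 * d + 3) * m)) / M) := by field_simp; norm_num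
        _ = 224 / m := by rw [← hML, div_self hMR.ne', mul_one]
        _ ≤ 1 := by rw [div_le_one hm0]; linarith)

  set B := b * q ^ 2 with hB
  set D := 2 * b * q * x + c * q with hD
  obtain ⟨q₂, hq₂, hq₂Z, hd₂⟩ := exists_quadratic_approx (Z := (m : ℝ) ^ (2 * d + 2)) (b := B)
    (c := D) (fun y => b * ((x + q * y : ℕ) : ℝ) ^ 2 + c * ((x + q * y : ℕ) : ℝ) + φ 0)
    (by intro y; simp only [hB, hD]; push_cast; ring) hL0
    (fun r hr hrL => hℓ r hr (hrL.trans (by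
      calc L ^ 2 ≤ M ^ 2 := by
            gcongr; rw [hL, hM]; gcongr <;> lia
        _ ≤ M ^ 3 := Nat.pow_le_pow_right hM0 (by norm_num))))
    (by linarith : (1 : ℝ) ≤ 2 * A) hf₂ (by
      have : (m : ℝ) ^ (2 * d + 2) = m * (m * A ^ 2) := by rw [hA]; ring
      rw [this, mul_pow]
      have : 0 < (m : ℝ) * A ^ 2 := by positivity
      nlinarith) (by
      rw [hL]; push_cast
      calc (m : ℝ) ^ (2 * d + 2) ≤ m ^ (3 * d + 3) := pow_le_pow_right₀ hm1 (by lia)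
        _ ≤ _ := le_mul_of_one_le_left (by positivity) hWR)
  set r := 2 * q₂ with hr
  have hrR : (r : ℝ) ≤ 2 * (m : ℝ) ^ (2 * d + 2) := by rw [hr]; push_cast; linarith
  have hrB : distInt (r * B) ≤ (m : ℝ) ^ (2 * d + 2) / L ^ 2 := by
    convert hd₂ using 2; rw [hr]; push_cast; ring
  have hLW : (L : ℝ) = W * (A * m ^ (2 * d + 2) * m) := by rw [hL, hA]; push_cast; ring
  have hrW : 8 * (2 * A) * (r * W) ≤ L := by
    rw [hLW]
    calc 8 * (2 * A) * ((r : ℝ) * W) ≤ 8 * (2 * A) * (2 * (m : ℝ) ^ (2 * d + 2) * W) := by gcongr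
      _ = W * (A * m ^ (2 * d + 2) * 32) := by ring
      _ ≤ _ := by gcongr; linarith

  obtain ⟨y, hy, hf₃⟩ := exists_progression_of_large hL0 (by positivity) (fun y => B * y ^ 2)
    (fun y => D * y + (b * x ^ 2 + c * x + φ 0)) (q := r) (L := W) (A := 2 * A) (by
      refine hf₂.trans_eq ?_
      congr 2; refine Finset.sum_congr rfl fun y _ => ?_
      congr 1; simp only [hB, hD]; push_cast; ring) hrW (by
      intro y hy z hz
      have e1 : B * ((y + r * z : ℕ) : ℝ) ^ 2 - B * (y : ℝ) ^ 2 =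
          ((2 * y * z + r * z ^ 2 : ℕ) : ℤ) * (r * B) := by
        push_cast; ring
      simp only [e1]
      have e2 := norm_unitExp_int_mul_sub_one_le ((2 * y * z + r * z ^ 2 : ℕ) : ℤ) (r * B)
      have hyR : (y : ℝ) ≤ L := by exact_mod_cast hy.le
      have hzR : (z : ℝ) ≤ W := by exact_mod_cast hz.le
      have hrzL : (r : ℝ) * z ≤ L := by
        have h0 : (r : ℝ) * z ≤ r * W := by gcongr
        have h1 : (r : ℝ) * W ≤ 8 * (2 * A) * (r * W) := by
          refine le_mul_of_one_le_left (by positivity) (by linarith)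
        linarith
      have e3 : |((((2 * y * z + r * z ^ 2 : ℕ) : ℤ)) : ℝ)| ≤ 3 * L * W := by
        rw [Int.cast_natCast, Nat.abs_cast]; push_cast
        calc 2 * (y : ℝ) * z + r * z ^ 2 = (2 * y + r * z) * z := by ring
          _ ≤ (2 * (L : ℝ) + L) * W := by gcongr
          _ = _ := by ring
      calc _ ≤ 4 * (2 * A) * (2 * Real.pi * (3 * L * W * ((m : ℝ) ^ (2 * d + 2) / L ^ 2))) := by
            refine mul_le_mul_of_nonneg_left (e2.trans ?_) (by positivity)
            gcongr
            exact distInt_nonneg _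
        _ ≤ 4 * (2 * A) * (2 * 4 * (3 * L * W * ((m : ℝ) ^ (2 * d + 2) / L ^ 2))) := by gcongr
        _ = 192 / m * ((W * (A * m ^ (2 * d + 2) * m)) / L) := by field_simp; norm_num
        _ = 192 / m := by rw [← hLW, div_self hLR.ne', mul_one]
        _ ≤ 1 := by rw [div_le_one hm0]; linarith)
  have hDr : distInt (r * D) ≤ 2 * A / W := by
    have h1 := norm_sum_unitExp_linear_mul_distInt_le W (r * D)
      (D * y + (b * x ^ 2 + c * x + φ 0))
    have h2 : ∑ z ∈ range W, unitExp (D * ((y + r * z : ℕ) : ℝ) + (b * x ^ 2 + c * x + φ 0)) =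
        ∑ z ∈ range W, unitExp (r * D * z + (D * y + (b * x ^ 2 + c * x + φ 0))) := by
      refine Finset.sum_congr rfl fun z _ => ?_
      congr 1; push_cast; ring
    rw [h2] at hf₃
    have h3 := mul_le_mul_of_nonneg_right hf₃ (distInt_nonneg (r * D))
    rw [le_div_iff₀ (by linarith)]
    nlinarith
  have hqK : ((q ^ 2 * r : ℕ) : ℝ) ≤ (m : ℝ) ^ (13 * d + 11) := by
    push_cast
    calc (q : ℝ) ^ 2 * r ≤ (6 * (m : ℝ) ^ (4 * d + 3)) ^ 2 * (2 * (m : ℝ) ^ (2 * d + 2)) := by gcongr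
      _ = 72 * (m : ℝ) ^ (10 * d + 8) := by ring
      _ ≤ (m : ℝ) * (m : ℝ) ^ (10 * d + 8) := by gcongr; linarith
      _ = (m : ℝ) ^ (10 * d + 9) := by ring
      _ ≤ _ := pow_le_pow_right₀ hm1 (by lia)
  have hbK : ((m : ℝ) ^ (2 * d + 2) / L ^ 2) = (m : ℝ) ^ (12 * d + 10) / M ^ 2 := by
    rw [hML, hA]; field_simp; ring
  refine ⟨q ^ 2 * r, by positivity, by exact_mod_cast hqK, ?_, ?_, ?_⟩
  · have e1 : ((q ^ 2 * r : ℕ) : ℝ) * a = ((q * r : ℕ) : ℝ) * (q * a) := by push_cast; ring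
    rw [e1]
    refine (distInt_nat_mul_le _ _).trans ?_
    push_cast
    calc (q : ℝ) * r * distInt (q * a) ≤ 6 * (m : ℝ) ^ (4 * d + 3) * (2 * (m : ℝ) ^ (2 * d + 2)) *
          ((m : ℝ) ^ (4 * d + 3) / M ^ 3) := by gcongr; exact distInt_nonneg _
      _ = 12 * (m : ℝ) ^ (10 * d + 8) / M ^ 3 := by ring
      _ ≤ (m : ℝ) * (m : ℝ) ^ (10 * d + 8) / M ^ 3 := by gcongr; linarith
      _ = (m : ℝ) ^ (10 * d + 9) / M ^ 3 := by ring
      _ ≤ _ := by gcongr <;> lia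
  · have e1 : ((q ^ 2 * r : ℕ) : ℝ) * b = r * B := by rw [hB]; push_cast; ring
    rw [e1]
    refine hrB.trans ?_
    rw [hbK]; gcongr <;> lia
  · have e1 : ((q ^ 2 * r : ℕ) : ℝ) * c = (q : ℕ) * (r * D) + (-(2 * x : ℤ) : ℤ) * (r * B) := by
      rw [hB, hD]; push_cast; ring
    rw [e1]
    refine (distInt_add_le _ _).trans ?_
    have e2 : distInt ((q : ℕ) * (r * D)) ≤ 12 * (m : ℝ) ^ (13 * d + 10) / M := by
      refine (distInt_nat_mul_le _ _).trans ?_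
      calc (q : ℝ) * distInt (r * D) ≤ 6 * (m : ℝ) ^ (4 * d + 3) * (2 * A / W) := by
            gcongr; exact distInt_nonneg _
        _ = _ := by rw [hMc, hA]; field_simp; ring
    have e3 : distInt ((-(2 * x : ℤ) : ℤ) * (r * B)) ≤ 2 * (m : ℝ) ^ (13 * d + 10) / M := by
      refine (distInt_int_mul_le _ _).trans ?_
      have hxR : (x : ℝ) ≤ M := by exact_mod_cast hx.le
      have : |((-(2 * x : ℤ) : ℤ) : ℝ)| = 2 * x := by
        push_cast; rw [abs_neg, abs_of_nonneg (by positivity)]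
      rw [this]
      calc 2 * (x : ℝ) * distInt (r * B) ≤ 2 * M * ((m : ℝ) ^ (12 * d + 10) / M ^ 2) := by
            rw [← hbK]; gcongr; exact distInt_nonneg _
        _ = 2 * (m : ℝ) ^ (12 * d + 10) / M := by field_simp
        _ ≤ _ := by gcongr; lia
    calc _ ≤ 12 * (m : ℝ) ^ (13 * d + 10) / M + 2 * (m : ℝ) ^ (13 * d + 10) / M := add_le_add e2 e3
      _ = 14 * (m : ℝ) ^ (13 * d + 10) / M := by ring
      _ ≤ (m : ℝ) * (m : ℝ) ^ (13 * d + 10) / M := by gcongr; linarith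
      _ = _ := by ring

/-! ### Badly approximable scales of an irrational number -/

theorem distInt_pos_of_irrational {μ : ℝ} (hμ : Irrational μ) {n : ℕ} (hn : 0 < n) :
    0 < distInt (n * μ) := by
  refine lt_of_le_of_ne (distInt_nonneg _) fun h => ?_
  have h1 : Irrational (n * μ) := hμ.natCast_mul hn.ne'
  have h2 : (n : ℝ) * μ - round ((n : ℝ) * μ) = 0 := abs_eq_zero.1 h.symm
  exact h1.ne_int (round ((n : ℝ) * μ)) (by linarith)

/-- For an irrational `μ` there are arbitrarily large scales `m` at which no `n ≤ m ^ D` makes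
`n * μ` exceptionally close to an integer. -/
theorem frequently_one_le_mul_distInt {μ : ℝ} (hμ : Irrational μ) {D : ℕ} (hD : 0 < D) :
    ∃ᶠ m : ℕ in atTop, ∀ n : ℕ, 0 < n → n ≤ m ^ D → 1 ≤ (m : ℝ) ^ (D + 2) * distInt (n * μ) := by
  rw [Filter.frequently_atTop]
  intro m₀
  set m₁ := m₀ + 2 ^ (D + 1) with hm₁
  set Q₀ := 2 * m₁ ^ D with hQ₀
  have h21 : 1 ≤ 2 ^ (D + 1) := Nat.one_le_two_pow
  have hQpos : 0 < Q₀ := by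
    have : 0 < m₁ := by lia
    positivity
  obtain ⟨r, hr, hmin⟩ := Finset.exists_min_image (Icc 1 Q₀) (fun n => distInt ((n : ℝ) * μ))
    ⟨1, Finset.mem_Icc.2 ⟨le_rfl, hQpos⟩⟩
  have hδ := distInt_pos_of_irrational hμ (Finset.mem_Icc.1 hr).1
  set δ := distInt ((r : ℝ) * μ)
  obtain ⟨q, a, hq, -, hcop, h1, h2⟩ := exists_dirichlet_approx μ (2 / δ) (by
    rw [one_le_div hδ]; have : δ ≤ 1 / 2 := distInt_le_half _; linarith)
  have hqQ : Q₀ < q := by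
    by_contra! h
    have h3 := hmin q (Finset.mem_Icc.2 ⟨hq, h⟩)
    have h4 := distInt_le (q * μ) a
    rw [one_div_div] at h2
    linarith
  set m := Nat.findGreatest (fun m => 2 * m ^ D ≤ q) q with hm
  have hmP : 2 * m ^ D ≤ q := by
    have := Nat.findGreatest_spec (P := fun m => 2 * m ^ D ≤ q) (m := 0) (Nat.zero_le q)
      (by simp [zero_pow hD.ne'])
    exact this
  have hm₁q : m₁ ≤ q := by
    calc m₁ ≤ m₁ ^ D := Nat.le_self_pow hD.ne' _
      _ ≤ Q₀ := by lia
      _ ≤ q := hqQ.le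
  have hm₁m : m₁ ≤ m := Nat.le_findGreatest hm₁q (by lia)
  have hmq : q < 2 * (m + 1) ^ D := by
    by_contra! h
    have h3 : m + 1 ≤ q := by
      calc m + 1 ≤ (m + 1) ^ D := Nat.le_self_pow hD.ne' _
        _ ≤ q := by lia
    have := Nat.le_findGreatest (P := fun m => 2 * m ^ D ≤ q) h3 h
    lia
  have hqm : q ≤ m ^ (D + 1) := by
    have h3 : (m + 1) ^ D ≤ (2 * m) ^ D := Nat.pow_le_pow_left (by lia) _
    calc q ≤ 2 * (2 * m) ^ D := by lia
      _ = 2 ^ (D + 1) * m ^ D := by ring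
      _ ≤ m * m ^ D := Nat.mul_le_mul_right _ (by lia)
      _ = _ := by ring
  refine ⟨m, by lia, fun n hn hnm => ?_⟩
  have h5 := one_le_two_mul_abs_sub hcop h1 hn (by lia) (round ((n : ℝ) * μ))
  refine h5.trans ?_
  change 2 * (q : ℝ) * distInt (n * μ) ≤ _
  have h6 : (2 * q : ℝ) ≤ (m : ℝ) ^ (D + 2) := by
    have : 2 * q ≤ m ^ (D + 2) := by
      calc 2 * q ≤ m * m ^ (D + 1) := Nat.mul_le_mul (by
            have : 2 ^ 1 ≤ 2 ^ (D + 1) := Nat.pow_le_pow_right (by norm_num) (by lia)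
            lia) hqm
        _ = _ := by ring
    exact_mod_cast this
  exact mul_le_mul_of_nonneg_right h6 (distInt_nonneg _)

/-- Two simultaneous approximations whose ratio is irrational are incompatible at a scale where
the ratio is badly approximable. -/
theorem false_of_two_approx {m e k v : ℕ} {α ρ μ : ℝ} {K₀ K₁ : ℕ} (hm : 2 ≤ m)
    (hρ : |ρ| ≤ m) (hμ : |μ| ≤ m) (hρ' : 1 < m * |ρ|)
    (hirr : ∀ n : ℕ, 0 < n → n ≤ m ^ (2 * e + 4) →
      1 ≤ (m : ℝ) ^ (2 * e + 6) * distInt (n * μ))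
    (hα : |α| ≤ (m : ℝ) ^ 2) (hα' : (m : ℝ) ^ v ≤ |α| * m ^ (3 * k)) (hv : e + 2 ≤ v)
    (hk : 4 * e + 9 ≤ k) (hK₀ : 0 < K₀) (hK₁ : 0 < K₁) (hK₀e : K₀ ≤ m ^ e) (hK₁e : K₁ ≤ m ^ e)
    (h₀ : distInt (K₀ * (α * ρ)) ≤ (m : ℝ) ^ e / m ^ (3 * k))
    (h₁ : distInt (K₁ * (α * (μ * ρ))) ≤ (m : ℝ) ^ e / m ^ k) : False := by
  have hmR : (2 : ℝ) ≤ m := by exact_mod_cast hm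
  have hm1 : (1 : ℝ) ≤ m := by linarith
  have hm0 : (0 : ℝ) < m := by linarith
  have hK₀R : (1 : ℝ) ≤ K₀ := by exact_mod_cast hK₀
  have hK₀eR : (K₀ : ℝ) ≤ (m : ℝ) ^ e := by exact_mod_cast hK₀e
  have hK₁eR : (K₁ : ℝ) ≤ (m : ℝ) ^ e := by exact_mod_cast hK₁e
  set n₀ := round (K₀ * (α * ρ)) with hn₀
  set n₁ := round (K₁ * (α * (μ * ρ))) with hn₁
  rw [distInt, ← hn₀] at h₀
  rw [distInt, ← hn₁] at h₁
  have hn₀0 : n₀ ≠ 0 := by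
    intro h
    rw [h, Int.cast_zero, sub_zero, le_div_iff₀ (by positivity), abs_mul, abs_mul,
      Nat.abs_cast] at h₀
    have e1 : (m : ℝ) ^ v * |ρ| ≤ m ^ e := by
      calc (m : ℝ) ^ v * |ρ| ≤ |α| * m ^ (3 * k) * |ρ| := by gcongr
        _ = 1 * (|α| * |ρ|) * m ^ (3 * k) := by ring
        _ ≤ K₀ * (|α| * |ρ|) * m ^ (3 * k) := by gcongr
        _ ≤ _ := h₀
    have e2 : (m : ℝ) ^ (e + 2) ≤ m ^ v := pow_le_pow_right₀ hm1 hv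
    have e3 : (m : ℝ) ^ e < m ^ (e + 2) * |ρ| := by
      calc (m : ℝ) ^ e = m ^ e * 1 := by ring
        _ < m ^ e * (m * |ρ|) := by gcongr
        _ ≤ m ^ e * (m * (m * |ρ|)) := by
          gcongr; exact le_mul_of_one_le_left (by positivity) hm1
        _ = _ := by ring
    have e4 := mul_le_mul_of_nonneg_right e2 (abs_nonneg ρ)
    linarith
  have hn₀m : |(n₀ : ℝ)| ≤ (m : ℝ) ^ (e + 4) := by
    have e1 : |(K₀ : ℝ) * (α * ρ)| ≤ m ^ e * (m ^ 2 * m) := by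
      rw [abs_mul, abs_mul, Nat.abs_cast]; gcongr
    have e2 : |(K₀ : ℝ) * (α * ρ) - n₀| ≤ 1 / 2 := abs_sub_round _
    have e3 := abs_sub_abs_le_abs_sub (n₀ : ℝ) (K₀ * (α * ρ))
    rw [abs_sub_comm] at e3
    have e4 : (1 : ℝ) ≤ m ^ (e + 3) := one_le_pow₀ hm1
    have e5 : (m : ℝ) ^ e * (m ^ 2 * m) = m ^ (e + 3) := by ring
    have e6 : 2 * (m : ℝ) ^ (e + 3) ≤ m ^ (e + 4) := by
      rw [pow_succ _ (e + 3)]; nlinarith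
    linarith
  set n := K₁ * n₀.natAbs with hn
  have hnpos : 0 < n := Nat.mul_pos hK₁ (Int.natAbs_pos.2 hn₀0)
  have habs : ((n₀.natAbs : ℕ) : ℝ) = |(n₀ : ℝ)| := by rw [Nat.cast_natAbs]; simp
  have hnle : n ≤ m ^ (2 * e + 4) := by
    have : (n : ℝ) ≤ (m : ℝ) ^ (2 * e + 4) := by
      rw [hn]; push_cast; rw [habs]
      calc (K₁ : ℝ) * |(n₀ : ℝ)| ≤ m ^ e * m ^ (e + 4) := by gcongr
        _ = _ := by ring
    exact_mod_cast this
  have h2 := hirr n hnpos hnle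
  have h3 : distInt (n * μ) ≤ (m : ℝ) ^ (2 * e + 2) / m ^ k := by
    have hkey : |(K₁ : ℝ) * n₀ * μ - (K₀ * n₁ : ℤ)| ≤ (m : ℝ) ^ (2 * e + 2) / m ^ k := by
      have e1 : (K₁ : ℝ) * n₀ * μ - (K₀ * n₁ : ℤ) = K₀ * (K₁ * (α * (μ * ρ)) - n₁) -
          K₁ * μ * (K₀ * (α * ρ) - n₀) := by push_cast; ring
      rw [e1]
      refine (abs_sub _ _).trans ?_
      rw [abs_mul, abs_mul, abs_mul, Nat.abs_cast, Nat.abs_cast]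
      have h3k : (m : ℝ) ^ e / m ^ (3 * k) ≤ m ^ e / m ^ k := by
        gcongr; lia
      calc _ ≤ (m : ℝ) ^ e * (m ^ e / m ^ k) + m ^ e * m * (m ^ e / m ^ k) := by
            gcongr; exact h₀.trans h3k
        _ = (1 + m) * (m ^ (2 * e) / m ^ k) := by ring
        _ ≤ (m * m) * (m ^ (2 * e) / m ^ k) := by gcongr; nlinarith
        _ = _ := by ring
    have hnR : (n : ℝ) = K₁ * |(n₀ : ℝ)| := by rw [hn]; push_cast; rw [habs]
    rcases abs_choice (n₀ : ℝ) with h | h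
    · refine (distInt_le _ (K₀ * n₁)).trans (le_trans (le_of_eq ?_) hkey)
      rw [hnR, h]
    · refine (distInt_le _ (-(K₀ * n₁))).trans (le_trans (le_of_eq ?_) hkey)
      rw [hnR, h, ← abs_neg]; push_cast; ring_nf
  have h4 : (m : ℝ) ^ (2 * e + 6) * distInt (n * μ) ≤ m ^ (4 * e + 8) / m ^ k := by
    calc _ ≤ (m : ℝ) ^ (2 * e + 6) * (m ^ (2 * e + 2) / m ^ k) := by gcongr
      _ = _ := by ring
  have h5 : (m : ℝ) ^ (4 * e + 8) / m ^ k < 1 := by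
    rw [div_lt_one (by positivity)]
    exact pow_lt_pow_right₀ (by linarith) (by lia)
  linarith

/-! ### Gaussian averages of exponential sums -/

/-- The centred Gaussian probability measure with density `m⁻¹ * exp (-π α² / m²)`. -/
noncomputable def gaussProb (m : ℝ) : Measure ℝ :=
  ProbabilityTheory.gaussianReal 0 (m ^ 2 / (2 * Real.pi)).toNNReal

instance (m : ℝ) : IsProbabilityMeasure (gaussProb m) := by unfold gaussProb; infer_instance

theorem integral_gaussProb {E : Type*} [NormedAddCommGroup E] [NormedSpace ℝ E] {m : ℝ}
    (hm : 0 < m) (f : ℝ → E) :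
    ∫ α, f α ∂gaussProb m = ∫ α, (m⁻¹ * Real.exp (-Real.pi * α ^ 2 / m ^ 2)) • f α := by
  have hpi := Real.pi_pos
  have hv : (m ^ 2 / (2 * Real.pi)).toNNReal ≠ 0 := by
    rw [Ne, Real.toNNReal_eq_zero, not_le]; positivity
  rw [gaussProb, ProbabilityTheory.integral_gaussianReal_eq_integral_smul hv]
  congr 1; ext α
  rw [ProbabilityTheory.gaussianPDFReal, Real.coe_toNNReal _ (by positivity),
    mul_div_cancel₀ _ (by positivity : 2 * Real.pi ≠ 0), Real.sqrt_sq hm.le]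
  congr 3
  field_simp; ring

theorem integral_unitExp_gaussProb (m ω : ℝ) :
    ∫ α, unitExp (α * ω) ∂gaussProb m = (Real.exp (-Real.pi * m ^ 2 * ω ^ 2) : ℝ) := by
  have hpi := Real.pi_pos
  have h := ProbabilityTheory.charFun_gaussianReal (μ := 0)
    (v := (m ^ 2 / (2 * Real.pi)).toNNReal) (2 * Real.pi * ω)
  rw [charFun_apply_real] at h
  unfold gaussProb unitExp
  have h1 : ∀ α : ℝ, ((2 * Real.pi * (α * ω) : ℝ) : ℂ) * Complex.I =
      ((2 * Real.pi * ω : ℝ) : ℂ) * α * Complex.I := by intro α; push_cast; ring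
  simp only [h1]
  rw [h, Real.coe_toNNReal _ (by positivity), Complex.ofReal_exp]
  congr 1
  push_cast
  have : (Real.pi : ℂ) ≠ 0 := by exact_mod_cast hpi.ne'
  field_simp; ring

theorem integrable_gaussProb {E : Type*} [NormedAddCommGroup E] {m : ℝ} {f : ℝ → E}
    (hf : Continuous f) (C : ℝ) (hC : ∀ α, ‖f α‖ ≤ C) : Integrable f (gaussProb m) :=
  Integrable.of_bound hf.aestronglyMeasurable C (ae_of_all _ hC)

/-- `expSum s ω α = ∑ e(α ω i)`. -/
noncomputable def expSum {ι : Type*} (s : Finset ι) (ω : ι → ℝ) (α : ℝ) : ℂ :=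
  ∑ i ∈ s, unitExp (α * ω i)

@[fun_prop] theorem continuous_expSum {ι : Type*} (s : Finset ι) (ω : ι → ℝ) :
    Continuous (expSum s ω) := by unfold expSum; fun_prop

theorem norm_expSum_le {ι : Type*} (s : Finset ι) (ω : ι → ℝ) (α : ℝ) :
    ‖expSum s ω α‖ ≤ s.card :=
  (norm_sum_le_of_le _ fun _ _ => (norm_unitExp _).le).trans (by simp)

theorem expSum_mul {ι κ : Type*} (s : Finset ι) (t : Finset κ) (ω : ι → ℝ) (ξ : κ → ℝ) (α : ℝ) :
    expSum s ω α * expSum t ξ α = expSum (s ×ˢ t) (fun p => ω p.1 + ξ p.2) α := by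
  simp only [expSum, mul_add, unitExp_add, Finset.sum_mul_sum, Finset.sum_product]

theorem integral_norm_sq_expSum {ι : Type*} (m : ℝ) (s : Finset ι) (ω : ι → ℝ) :
    ∫ α, ‖expSum s ω α‖ ^ 2 ∂gaussProb m =
      ∑ i ∈ s, ∑ j ∈ s, Real.exp (-Real.pi * m ^ 2 * (ω i - ω j) ^ 2) := by
  have h : ((∫ α, ‖expSum s ω α‖ ^ 2 ∂gaussProb m : ℝ) : ℂ) =
      ((∑ i ∈ s, ∑ j ∈ s, Real.exp (-Real.pi * m ^ 2 * (ω i - ω j) ^ 2) : ℝ) : ℂ) := by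
    rw [← integral_complex_ofReal]
    simp only [expSum, norm_sq_sum_unitExp, ← mul_sub]
    rw [integral_finsetSum]
    · push_cast
      refine Finset.sum_congr rfl fun i _ => ?_
      rw [integral_finsetSum]
      · refine Finset.sum_congr rfl fun j _ => ?_
        rw [integral_unitExp_gaussProb]; push_cast; rfl
      · exact fun j _ => integrable_gaussProb (by fun_prop) 1 fun α => (norm_unitExp _).le
    · exact fun i _ => integrable_gaussProb (by fun_prop) s.card fun α =>
        (norm_sum_le_of_le _ fun _ _ => (norm_unitExp _).le).trans (by simp)
  exact_mod_cast h

theorem integrable_norm_sq_expSum {ι : Type*} (m : ℝ) (s : Finset ι) (ω : ι → ℝ) :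
    Integrable (fun α => ‖expSum s ω α‖ ^ 2) (gaussProb m) :=
  integrable_gaussProb (by fun_prop) ((s.card : ℝ) ^ 2) fun α => by
    rw [Real.norm_of_nonneg (by positivity)]
    exact pow_le_pow_left₀ (norm_nonneg _) (norm_expSum_le s ω α) 2

theorem exists_sum_exp_le {c : ℝ} (hc : c ≠ 0) : ∃ C : ℝ, 1 ≤ C ∧ ∀ (s : Finset ℤ) (t : ℝ),
    ∑ n ∈ s, Real.exp (-Real.pi * (c * n - t) ^ 2) ≤ C := by
  set g : ℤ → ℝ := fun n => (if n = 0 then 1 else 0) + 4 / c ^ 2 * (1 / (n : ℝ) ^ 2) with hg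
  have hg0 : ∀ n, 0 ≤ g n := fun n => by simp only [hg]; split_ifs <;> positivity
  have hsum : Summable g := by
    refine Summable.add ?_ ((Real.summable_one_div_int_pow.2 (by norm_num)).mul_left _)
    exact summable_of_ne_finset_zero (s := {0}) fun b hb => if_neg (by simpa using hb)
  refine ⟨1 + ∑' n, g n, by
    have : 0 ≤ ∑' n, g n := tsum_nonneg hg0
    linarith, fun s t => ?_⟩
  set n₀ := round (t / c) with hn₀
  have h1 : ∀ n ∈ s, Real.exp (-Real.pi * (c * n - t) ^ 2) ≤ g (n - n₀) := by
    intro n _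
    by_cases h : n - n₀ = 0
    · simp only [hg, h, if_true]
      have : Real.exp (-Real.pi * (c * n - t) ^ 2) ≤ 1 := by
        rw [Real.exp_le_one_iff]; have := Real.pi_pos; nlinarith [sq_nonneg (c * n - t)]
      simpa using this
    · simp only [hg, h, if_false, zero_add]
      have h2 : (1 : ℝ) ≤ |((n - n₀ : ℤ) : ℝ)| := by exact_mod_cast Int.one_le_abs h
      have h3 : |t / c - n₀| ≤ 1 / 2 := abs_sub_round _
      have h4 : |((n - n₀ : ℤ) : ℝ)| ≤ 2 * |(n : ℝ) - t / c| := by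
        have := abs_sub_abs_le_abs_sub ((n - n₀ : ℤ) : ℝ) (t / c - n₀)
        rw [show ((n - n₀ : ℤ) : ℝ) - (t / c - n₀) = n - t / c by push_cast; ring] at this
        linarith
      have h5 : ((n - n₀ : ℤ) : ℝ) ^ 2 ≤ 4 * ((n : ℝ) - t / c) ^ 2 := by
        rw [← sq_abs, ← sq_abs ((n : ℝ) - t / c)]
        nlinarith [abs_nonneg ((n - n₀ : ℤ) : ℝ)]
      have h6 : (c * n - t) ^ 2 = c ^ 2 * ((n : ℝ) - t / c) ^ 2 := by field_simp
      have hpos : 0 < ((n - n₀ : ℤ) : ℝ) ^ 2 := by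
        rw [← sq_abs]; positivity
      have hc2 : 0 < c ^ 2 := by positivity
      have h7 : c ^ 2 * ((n - n₀ : ℤ) : ℝ) ^ 2 / 4 ≤ Real.exp (Real.pi * (c * n - t) ^ 2) := by
        have h8 := Real.add_one_le_exp (Real.pi * (c * n - t) ^ 2)
        have h9 := Real.pi_gt_three
        have h10 : c ^ 2 * ((n - n₀ : ℤ) : ℝ) ^ 2 / 4 ≤ (c * n - t) ^ 2 := by
          rw [h6]; nlinarith
        nlinarith [sq_nonneg (c * n - t)]
      rw [neg_mul, Real.exp_neg, div_mul_div_comm, mul_one, inv_le_comm₀ (Real.exp_pos _)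
        (by positivity), inv_div]
      exact h7
  refine (Finset.sum_le_sum h1).trans ?_
  have h2 : ∑ n ∈ s, g (n - n₀) ≤ ∑' n, g (n - n₀) :=
    Summable.sum_le_tsum s (fun _ _ => hg0 _) ((Equiv.subRight n₀).summable_iff.2 hsum)
  have h3 : ∑' n, g (n - n₀) = ∑' n, g n := (Equiv.subRight n₀).tsum_eq g
  linarith

/-! ### Mean values against Dirichlet kernels -/

theorem sum_exp_mul_le {κ : Type*} {m ρ C : ℝ} (hm : 1 ≤ m)
    (hC : ∀ (s : Finset ℤ) (t : ℝ), ∑ n ∈ s, Real.exp (-Real.pi * (ρ * n - t) ^ 2) ≤ C)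
    (P : Finset κ) (n : κ → ℕ) (T : ℕ) (hT : ∀ r, (P.filter fun p => n p = r).card ≤ T) (t : ℝ) :
    ∑ p ∈ P, Real.exp (-Real.pi * m ^ 2 * (ρ * n p - t) ^ 2) ≤ T * C := by
  classical
  refine (sum_comp_le_card_fiber_mul P (P.image n) n
    (fun r : ℕ => Real.exp (-Real.pi * m ^ 2 * (ρ * r - t) ^ 2)) T
    (fun _ _ => (Real.exp_pos _).le) (fun p hp => Finset.mem_image_of_mem _ hp)
    (fun r _ => hT r)).trans ?_
  gcongr
  have h1 := hC ((P.image n).map Nat.castEmbedding) t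
  rw [Finset.sum_map] at h1
  refine le_trans (Finset.sum_le_sum fun r _ => ?_) h1
  simp only [Nat.castEmbedding_apply, Int.cast_natCast]
  gcongr
  have hpi := Real.pi_pos
  have h2 : (1 : ℝ) ≤ m ^ 2 := one_le_pow₀ hm
  nlinarith

theorem sum_integral_dirichlet_mul_le {ι κ : Type*} {m ρ C : ℝ} (hm : 1 ≤ m)
    (hC : ∀ (s : Finset ℤ) (t : ℝ), ∑ n ∈ s, Real.exp (-Real.pi * (ρ * n - t) ^ 2) ≤ C)
    (I : Finset κ) (n : κ → ℕ) (H T : ℕ)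
    (hT : ∀ r, ((I ×ˢ Ico 1 H).filter fun p => n p.1 * p.2 = r).card ≤ T)
    (s : Finset ι) (ω : ι → ℝ) :
    ∑ i ∈ I, ∫ α, ‖∑ a ∈ range H, unitExp (a * (n i * (ρ * α)))‖ ^ 2 * ‖expSum s ω α‖ ^ 2
      ∂gaussProb m ≤
    H * (I.card * ∫ α, ‖expSum s ω α‖ ^ 2 ∂gaussProb m + 2 * T * C * s.card ^ 2) := by
  have hpi := Real.pi_pos
  set E : ℝ → ℝ := fun x => Real.exp (-Real.pi * m ^ 2 * x ^ 2) with hE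
  have hE0 : ∀ x, 0 ≤ E x := fun x => (Real.exp_pos _).le
  have h1 : ∀ i, ∫ α, ‖∑ a ∈ range H, unitExp (a * (n i * (ρ * α)))‖ ^ 2 * ‖expSum s ω α‖ ^ 2
      ∂gaussProb m = ∑ j ∈ s, ∑ j' ∈ s, ∑ a ∈ range H, ∑ a' ∈ range H,
        E ((ω j - ω j') + (a - a' : ℝ) * (n i * ρ)) := by
    intro i
    have h2 : ∀ α, ‖∑ a ∈ range H, unitExp (a * (n i * (ρ * α)))‖ ^ 2 * ‖expSum s ω α‖ ^ 2 =
        ‖expSum (s ×ˢ range H) (fun p => ω p.1 + p.2 * (n i * ρ)) α‖ ^ 2 := by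
      intro α
      rw [← expSum_mul s (range H) ω (fun a => a * (n i * ρ)), norm_mul, mul_pow, mul_comm]
      congr 3
      refine Finset.sum_congr rfl fun a _ => ?_
      congr 1; ring
    simp only [h2]
    rw [integral_norm_sq_expSum, Finset.sum_product]
    refine Finset.sum_congr rfl fun j _ => ?_
    simp only [Finset.sum_product]
    rw [Finset.sum_comm]
    refine Finset.sum_congr rfl fun j' _ => Finset.sum_congr rfl fun a _ =>
      Finset.sum_congr rfl fun a' _ => ?_
    simp only [hE]
    ring_nf
  have h3 : ∀ i ∈ I, ∀ δ : ℝ, ∑ a ∈ range H, ∑ a' ∈ range H, E (δ + (a - a' : ℝ) * (n i * ρ)) ≤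
      H * (E δ + ∑ l ∈ Ico 1 H, (E (ρ * (n i * l : ℕ) - -δ) + E (ρ * (n i * l : ℕ) - δ))) := by
    intro i _ δ
    rw [sum_range_sum_range_eq H (fun a a' : ℕ => E (δ + (a - a' : ℝ) * (n i * ρ))), mul_add,
      Finset.mul_sum]
    refine add_le_add (by simp) (Finset.sum_le_sum fun l hl => ?_)
    have e1 : ∀ x : ℕ, E (δ + ((x + l : ℕ) - x : ℝ) * (n i * ρ)) +
        E (δ + (x - (x + l : ℕ) : ℝ) * (n i * ρ)) =
        E (ρ * (n i * l : ℕ) - -δ) + E (ρ * (n i * l : ℕ) - δ) := by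
      intro x
      congr 1 <;> simp only [hE] <;> push_cast <;> ring_nf
    rw [Finset.sum_congr rfl fun x _ => e1 x, Finset.sum_const, nsmul_eq_mul, Finset.card_range]
    have : ((H - l : ℕ) : ℝ) ≤ H := by exact_mod_cast Nat.sub_le _ _
    exact mul_le_mul_of_nonneg_right this (add_nonneg (hE0 _) (hE0 _))
  have h4 : ∀ t : ℝ, ∑ i ∈ I, ∑ l ∈ Ico 1 H, E (ρ * (n i * l : ℕ) - t) ≤ T * C := by
    intro t
    have := sum_exp_mul_le hm hC (I ×ˢ Ico 1 H) (fun p => n p.1 * p.2) T hT t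
    rwa [Finset.sum_product] at this
  have h5 : ∀ δ : ℝ, ∑ i ∈ I, ∑ a ∈ range H, ∑ a' ∈ range H, E (δ + (a - a' : ℝ) * (n i * ρ)) ≤
      H * (I.card * E δ + 2 * T * C) := by
    intro δ
    refine (Finset.sum_le_sum fun i hi => h3 i hi δ).trans ?_
    rw [← Finset.mul_sum, Finset.sum_add_distrib, Finset.sum_const, nsmul_eq_mul]
    simp only [Finset.sum_add_distrib]
    have := h4 δ
    have := h4 (-δ)
    gcongr
    linarith
  simp only [h1]
  rw [Finset.sum_comm]
  rw [Finset.sum_congr rfl fun j _ => Finset.sum_comm, integral_norm_sq_expSum]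
  calc _ ≤ ∑ j ∈ s, ∑ j' ∈ s, H * (I.card * E (ω j - ω j') + 2 * T * C) :=
        Finset.sum_le_sum fun j _ => Finset.sum_le_sum fun j' _ => h5 _
    _ = _ := by
        simp only [← Finset.mul_sum, Finset.sum_add_distrib, Finset.sum_const, nsmul_eq_mul, hE]
        ring

theorem card_filter_mul_eq_le {Z H B T : ℕ} (hB : Z * H ≤ B)
    (hT : ∀ n, n ≠ 0 → n ≤ B → n.divisors.card ^ 2 ≤ T) (r : ℕ) :
    ((Ico 1 Z ×ˢ Ico 1 H).filter fun p => p.1 * p.2 = r).card ≤ T := by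
  rcases Finset.eq_empty_or_nonempty ((Ico 1 Z ×ˢ Ico 1 H).filter fun p => p.1 * p.2 = r) with h | h
  · simp [h]
  obtain ⟨p, hp⟩ := h
  simp only [Finset.mem_filter, Finset.mem_product, Finset.mem_Ico] at hp
  have hr0 : r ≠ 0 := by
    rw [← hp.2]; exact Nat.mul_ne_zero (by lia) (by lia)
  have hr : r ≤ B := by
    rw [← hp.2]; exact (Nat.mul_le_mul hp.1.1.2.le hp.1.2.2.le).trans hB
  refine le_trans ?_ ((Nat.le_self_pow two_ne_zero _).trans (hT r hr0 hr))
  refine Finset.card_le_card_of_injOn Prod.fst ?_ ?_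
  · intro p hp
    simp only [Finset.coe_filter, Set.mem_ofPred_eq] at hp
    simpa [hr0] using ⟨p.2, hp.2.symm⟩
  · intro p hp p' hp' h
    simp only [Finset.coe_filter, Set.mem_ofPred_eq, Finset.mem_product, Finset.mem_Ico] at hp hp'
    refine Prod.ext h ?_
    have h2 := hp.2.trans hp'.2.symm
    rw [← h] at h2
    exact Nat.eq_of_mul_eq_mul_left (by lia) h2

theorem card_filter_mul_mul_eq_le {D M H B T : ℕ} (hB : D * M * H ≤ B)
    (hT : ∀ n, n ≠ 0 → n ≤ B → n.divisors.card ^ 2 ≤ T) (r : ℕ) :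
    (((Ico 1 D ×ˢ Ico 1 M) ×ˢ Ico 1 H).filter fun p => p.1.1 * p.1.2 * p.2 = r).card ≤ T := by
  rcases Finset.eq_empty_or_nonempty
    (((Ico 1 D ×ˢ Ico 1 M) ×ˢ Ico 1 H).filter fun p => p.1.1 * p.1.2 * p.2 = r) with h | h
  · simp [h]
  obtain ⟨p, hp⟩ := h
  simp only [Finset.mem_filter, Finset.mem_product, Finset.mem_Ico] at hp
  have hr0 : r ≠ 0 := by
    rw [← hp.2]; exact Nat.mul_ne_zero (Nat.mul_ne_zero (by lia) (by lia)) (by lia)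
  have hr : r ≤ B := by
    rw [← hp.2]
    exact (Nat.mul_le_mul (Nat.mul_le_mul hp.1.1.1.2.le hp.1.1.2.2.le) hp.1.2.2.le).trans hB
  refine le_trans ?_ (hT r hr0 hr)
  rw [sq, ← Finset.card_product]
  refine Finset.card_le_card_of_injOn Prod.fst ?_ ?_
  · intro p hp
    simp only [Finset.coe_filter, Set.mem_ofPred_eq] at hp
    simp only [Finset.coe_product, Set.mem_prod, Finset.mem_coe, Nat.mem_divisors]
    exact ⟨⟨⟨p.1.2 * p.2, by rw [← hp.2]; ring⟩, hr0⟩, ⟨⟨p.1.1 * p.2, by rw [← hp.2]; ring⟩, hr0⟩⟩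
  · intro p hp p' hp' h
    simp only [Finset.coe_filter, Set.mem_ofPred_eq, Finset.mem_product, Finset.mem_Ico] at hp hp'
    refine Prod.ext h ?_
    have h2 := hp.2.trans hp'.2.symm
    rw [← h] at h2
    exact Nat.eq_of_mul_eq_mul_left (Nat.mul_pos (by lia) (by lia)) h2

/-- A nonnegative function that is at least one wherever `θ` has a rational approximation with
denominator at most `Z`. -/
noncomputable def rationalMajorant (Z H : ℕ) (θ : ℝ) : ℝ :=
  ∑ q ∈ Ico 1 (Z + 1), 4 / (H : ℝ) ^ 2 * ‖∑ a ∈ range H, unitExp (a * (q * θ))‖ ^ 2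

theorem rationalMajorant_nonneg (Z H : ℕ) (θ : ℝ) : 0 ≤ rationalMajorant Z H θ := by
  unfold rationalMajorant; positivity

@[fun_prop] theorem continuous_rationalMajorant (Z H : ℕ) : Continuous (rationalMajorant Z H) := by
  unfold rationalMajorant; fun_prop

theorem one_le_rationalMajorant {Z H q : ℕ} {θ : ℝ} (hH : 0 < H) (hq : 0 < q) (hqZ : q ≤ Z)
    (h : 8 * H * distInt (q * θ) ≤ 1) : 1 ≤ rationalMajorant Z H θ :=
  (one_le_dirichlet_sq hH h).trans <| Finset.single_le_sum
    (f := fun q : ℕ => 4 / (H : ℝ) ^ 2 * ‖∑ a ∈ range H, unitExp (a * (q * θ))‖ ^ 2)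
    (fun _ _ => by positivity) (Finset.mem_Ico.2 ⟨hq, by lia⟩)

theorem integrable_dirichlet_mul {ι : Type*} (m : ℝ) (H : ℕ) (θ : ℝ) (s : Finset ι) (ω : ι → ℝ) :
    Integrable (fun α => ‖∑ a ∈ range H, unitExp (a * (θ * α))‖ ^ 2 * ‖expSum s ω α‖ ^ 2)
      (gaussProb m) := by
  refine integrable_gaussProb (by fun_prop) ((H : ℝ) ^ 2 * (s.card : ℝ) ^ 2) fun α => ?_
  rw [Real.norm_of_nonneg (by positivity)]
  gcongr
  · exact (norm_sum_le_of_le _ fun _ _ => (norm_unitExp _).le).trans (by simp)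
  · exact norm_expSum_le _ _ _

theorem integral_rationalMajorant_mul_le {ι : Type*} {m ρ C : ℝ} (hm : 1 ≤ m)
    (hC : ∀ (s : Finset ℤ) (t : ℝ), ∑ n ∈ s, Real.exp (-Real.pi * (ρ * n - t) ^ 2) ≤ C)
    {Z H B T : ℕ} (hH : 0 < H) (hB : (Z + 1) * H ≤ B)
    (hT : ∀ n, n ≠ 0 → n ≤ B → n.divisors.card ^ 2 ≤ T) (s : Finset ι) (ω : ι → ℝ) :
    ∫ α, rationalMajorant Z H (ρ * α) * ‖expSum s ω α‖ ^ 2 ∂gaussProb m ≤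
      4 / H * (Z * ∫ α, ‖expSum s ω α‖ ^ 2 ∂gaussProb m + 2 * T * C * s.card ^ 2) := by
  have h := sum_integral_dirichlet_mul_le hm hC (Ico 1 (Z + 1)) (fun q => q) H T
    (card_filter_mul_eq_le hB hT) s ω
  have hHR : (0 : ℝ) < H := by exact_mod_cast hH
  have h1 : ∫ α, rationalMajorant Z H (ρ * α) * ‖expSum s ω α‖ ^ 2 ∂gaussProb m =
      4 / (H : ℝ) ^ 2 * ∑ q ∈ Ico 1 (Z + 1),
        ∫ α, ‖∑ a ∈ range H, unitExp (a * (q * (ρ * α)))‖ ^ 2 * ‖expSum s ω α‖ ^ 2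
          ∂gaussProb m := by
    simp only [rationalMajorant, ← Finset.mul_sum, Finset.sum_mul, mul_assoc]
    rw [integral_const_mul, integral_finsetSum]
    intro q _
    have := integrable_dirichlet_mul m H (q * ρ) s ω
    simpa only [mul_assoc] using this
  rw [h1]
  calc _ ≤ 4 / (H : ℝ) ^ 2 * (H * ((Ico 1 (Z + 1)).card *
        ∫ α, ‖expSum s ω α‖ ^ 2 ∂gaussProb m + 2 * T * C * s.card ^ 2)) := by gcongr
    _ = _ := by
      simp only [Nat.card_Ico, Nat.add_sub_cancel]
      field_simp

theorem sum_integral_fejerMajorant_mul_le {ι κ : Type*} {m ρ C : ℝ} (hm : 1 ≤ m)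
    (hC : ∀ (s : Finset ℤ) (t : ℝ), ∑ n ∈ s, Real.exp (-Real.pi * (ρ * n - t) ^ 2) ≤ C)
    (I : Finset κ) (n : κ → ℕ) (J T : ℕ)
    (hT : ∀ j ≤ J, ∀ r, ((I ×ˢ Ico 1 (2 ^ j)).filter fun p => n p.1 * p.2 = r).card ≤ T)
    (s : Finset ι) (ω : ι → ℝ) :
    ∑ i ∈ I, ∫ α, fejerMajorant J (n i * (ρ * α)) * ‖expSum s ω α‖ ^ 2 ∂gaussProb m ≤
      64 * ((J + 1 : ℕ) *
        (I.card * ∫ α, ‖expSum s ω α‖ ^ 2 ∂gaussProb m + 2 * T * C * s.card ^ 2)) := by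
  set R := I.card * ∫ α, ‖expSum s ω α‖ ^ 2 ∂gaussProb m + 2 * T * C * s.card ^ 2 with hR
  have h1 : ∀ i, ∫ α, fejerMajorant J (n i * (ρ * α)) * ‖expSum s ω α‖ ^ 2 ∂gaussProb m =
      64 * ∑ j ∈ range (J + 1), ((2 : ℝ) ^ j)⁻¹ *
        ∫ α, ‖∑ a ∈ range (2 ^ j), unitExp (a * (n i * (ρ * α)))‖ ^ 2 * ‖expSum s ω α‖ ^ 2
          ∂gaussProb m := by
    intro i
    simp only [fejerMajorant, Finset.sum_mul, mul_assoc]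
    rw [integral_const_mul, integral_finsetSum]
    · simp only [integral_const_mul]
    · intro j _
      have := (integrable_dirichlet_mul m (2 ^ j) (n i * ρ) s ω).const_mul ((2 : ℝ) ^ j)⁻¹
      simpa only [mul_assoc] using this
  simp only [h1, ← Finset.mul_sum]
  gcongr
  rw [Finset.sum_comm]
  calc _ ≤ ∑ j ∈ range (J + 1), R := Finset.sum_le_sum fun j hj => by
        rw [← Finset.mul_sum]
        have h2 := sum_integral_dirichlet_mul_le hm hC I n (2 ^ j) T
          (hT j (by rw [Finset.mem_range] at hj; lia)) s ω
        rw [← hR] at h2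
        push_cast at h2
        rw [inv_mul_le_iff₀ (by positivity)]
        exact h2
    _ = _ := by simp

theorem integrable_fejerMajorant_mul {ι : Type*} (m : ℝ) (J : ℕ) (θ : ℝ) (s : Finset ι)
    (ω : ι → ℝ) :
    Integrable (fun α => fejerMajorant J (θ * α) * ‖expSum s ω α‖ ^ 2) (gaussProb m) := by
  simp only [fejerMajorant, mul_assoc, Finset.sum_mul]
  refine (integrable_finsetSum _ fun j _ => ?_).const_mul _
  have := (integrable_dirichlet_mul m (2 ^ j) θ s ω).const_mul ((2 : ℝ) ^ j)⁻¹
  simpa only [mul_assoc] using this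

theorem norm_sq_expSum_range (N : ℕ) (p : ℕ → ℝ) (α : ℝ) :
    ‖expSum (range N) p α‖ ^ 2 =
      N + ∑ d ∈ Ico 1 N, 2 * (expSum (range (N - d)) (fun x => p (x + d) - p x) α).re := by
  have h := congrArg Complex.re (norm_sq_sum_unitExp (range N) fun x => α * p x)
  rw [sum_range_sum_range_eq N (fun i j => unitExp (α * p i - α * p j)), Complex.ofReal_re] at h
  unfold expSum
  rw [h, Complex.add_re, Complex.re_sum, Complex.re_sum]
  congr 1
  · simp
  · refine Finset.sum_congr rfl fun d _ => ?_
    rw [Complex.re_sum, Complex.re_sum, Finset.mul_sum]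
    refine Finset.sum_congr rfl fun x _ => ?_
    have h1 : 2 * Real.pi * (α * p (x + d) - α * p x) =
        2 * Real.pi * (α * (p (x + d) - p x)) := by ring
    have h2 : 2 * Real.pi * (α * p x - α * p (x + d)) =
        -(2 * Real.pi * (α * (p (x + d) - p x))) := by ring
    rw [Complex.add_re, unitExp_re, unitExp_re, unitExp_re, h1, h2, Real.cos_neg, ← two_mul]

theorem integral_re_expSum_mul_norm_sq {ι κ : Type*} (m : ℝ) (s : Finset ι) (ω : ι → ℝ)
    (t : Finset κ) (ξ : κ → ℝ) :
    ∫ α, (expSum s ω α).re * ‖expSum t ξ α‖ ^ 2 ∂gaussProb m =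
      ∑ x ∈ s, ∑ y ∈ t, ∑ y' ∈ t,
        Real.exp (-Real.pi * m ^ 2 * (ω x + (ξ y - ξ y')) ^ 2) := by
  have h1 : ∀ α, (expSum s ω α).re * ‖expSum t ξ α‖ ^ 2 =
      (∑ x ∈ s, ∑ y ∈ t, ∑ y' ∈ t, unitExp (α * (ω x + (ξ y - ξ y')))).re := by
    intro α
    have h2 := norm_sq_sum_unitExp t fun y => α * ξ y
    have h3 : ∑ x ∈ s, ∑ y ∈ t, ∑ y' ∈ t, unitExp (α * (ω x + (ξ y - ξ y'))) =
        expSum s ω α * ((‖expSum t ξ α‖ ^ 2 : ℝ) : ℂ) := by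
      unfold expSum
      rw [h2, Finset.sum_mul]
      refine Finset.sum_congr rfl fun x _ => ?_
      simp only [mul_add, mul_sub, unitExp_add, Finset.mul_sum]
    rw [h3, Complex.re_mul_ofReal]
  have hint : ∀ x y y', Integrable (fun α => unitExp (α * (ω x + (ξ y - ξ y')))) (gaussProb m) :=
    fun x y y' => integrable_gaussProb (by fun_prop) 1 fun α => (norm_unitExp _).le
  have hint' : Integrable (fun α => ∑ x ∈ s, ∑ y ∈ t, ∑ y' ∈ t,
      unitExp (α * (ω x + (ξ y - ξ y')))) (gaussProb m) :=
    integrable_finsetSum _ fun x _ => integrable_finsetSum _ fun y _ =>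
      integrable_finsetSum _ fun y' _ => hint x y y'
  have h4 : ∫ α, (∑ x ∈ s, ∑ y ∈ t, ∑ y' ∈ t, unitExp (α * (ω x + (ξ y - ξ y')))).re
      ∂gaussProb m = (∫ α, ∑ x ∈ s, ∑ y ∈ t, ∑ y' ∈ t, unitExp (α * (ω x + (ξ y - ξ y')))
      ∂gaussProb m).re := integral_re hint'
  simp only [h1]
  rw [h4, integral_finsetSum _ fun x _ => integrable_finsetSum _ fun y _ =>
    integrable_finsetSum _ fun y' _ => hint x y y', Complex.re_sum]
  refine Finset.sum_congr rfl fun x _ => ?_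
  rw [integral_finsetSum _ fun y _ => integrable_finsetSum _ fun y' _ => hint x y y',
    Complex.re_sum]
  refine Finset.sum_congr rfl fun y _ => ?_
  rw [integral_finsetSum _ fun y' _ => hint x y y', Complex.re_sum]
  refine Finset.sum_congr rfl fun y' _ => ?_
  rw [integral_unitExp_gaussProb, Complex.ofReal_re]

theorem exp_neg_le_of_le_abs {m B x : ℝ} (hm : 1 ≤ m) (hB : 0 < B) (h : B ≤ |x|) :
    Real.exp (-Real.pi * m ^ 2 * x ^ 2) ≤ 1 / B ^ 2 := by
  have h1 : B ^ 2 ≤ x ^ 2 := by rw [← sq_abs x]; gcongr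
  have h2 := Real.add_one_le_exp (Real.pi * m ^ 2 * x ^ 2)
  have h3 : (1 : ℝ) ≤ m ^ 2 := one_le_pow₀ hm
  have h4 := Real.pi_gt_three
  have h5 : 1 ≤ Real.pi * m ^ 2 := by nlinarith
  have h6 : B ^ 2 ≤ Real.exp (Real.pi * m ^ 2 * x ^ 2) := by nlinarith [sq_nonneg x]
  rw [neg_mul, neg_mul, Real.exp_neg, one_div]
  gcongr

/-- Mean value estimate for the product of a cubic exponential sum and a second exponential sum
whose differences are shorter than the long differences of the cubic. -/
theorem integral_norm_sq_mul_norm_sq_le {κ : Type*} {m lam b c C : ℝ} (hm : 1 ≤ m)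
    (hC : ∀ (s : Finset ℤ) (t : ℝ), ∑ n ∈ s, Real.exp (-Real.pi * (6 * lam * n - t) ^ 2) ≤ C)
    (p : ℕ → ℝ) (hp : ∀ x : ℕ, p x = lam * x ^ 3 + b * x ^ 2 + c * x + p 0)
    {N D J T B : ℕ} {Y R : ℝ} (hJ : N ≤ 2 ^ J) (hB : D * N * 2 ^ J ≤ B)
    (hT : ∀ n, n ≠ 0 → n ≤ B → n.divisors.card ^ 2 ≤ T) (hY : 0 < Y) (hR : 0 < R)
    (t : Finset κ) (ξ : κ → ℝ)
    (hsep : ∀ x d, D ≤ d → x + d < N → ∀ y ∈ t, ∀ y' ∈ t, R ≤ |p (x + d) - p x + (ξ y - ξ y')|) :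
    ∫ α, ‖expSum (range N) p α‖ ^ 2 * ‖expSum t ξ α‖ ^ 2 ∂gaussProb m ≤
      N * (∫ α, ‖expSum t ξ α‖ ^ 2 ∂gaussProb m) +
      2 * (D * (Y + N / Y) * (∫ α, ‖expSum t ξ α‖ ^ 2 ∂gaussProb m) +
        128 / Y * ((J + 1 : ℕ) * (D * N * (∫ α, ‖expSum t ξ α‖ ^ 2 ∂gaussProb m) +
          2 * T * C * t.card ^ 2))) +
      2 * (N ^ 2 * t.card ^ 2 / R ^ 2) := by
  classical
  set g : ℝ → ℝ := fun α => ‖expSum t ξ α‖ ^ 2 with hg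
  set G := ∫ α, g α ∂gaussProb m with hG
  have hg0 : ∀ α, 0 ≤ g α := fun α => by positivity
  have hG0 : 0 ≤ G := integral_nonneg hg0
  have hgi : Integrable g (gaussProb m) := integrable_norm_sq_expSum m t ξ
  set S : ℕ → ℝ → ℂ := fun d => expSum (range (N - d)) fun x => p (x + d) - p x with hS
  set F : ℕ → ℝ → ℝ := fun n α => fejerMajorant J (n * (6 * lam * α)) with hF
  have hFi : ∀ n, Integrable (fun α => F n α * g α) (gaussProb m) := fun n => by
    have := integrable_fejerMajorant_mul m J (n * (6 * lam)) t ξ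
    simpa only [hF, mul_assoc] using this
  have hSi : ∀ d, Integrable (fun α => (S d α).re * g α) (gaussProb m) := fun d => by
    refine integrable_gaussProb (by fun_prop) ((N : ℝ) * (t.card : ℝ) ^ 2) fun α => ?_
    rw [norm_mul, Real.norm_of_nonneg (hg0 α), Real.norm_eq_abs]
    have h1 : |(S d α).re| ≤ N := (Complex.abs_re_le_norm _).trans <|
      (norm_expSum_le _ _ _).trans (by simp)
    have h2 := norm_expSum_le t ξ α
    simp only [hg]
    gcongr
  have hshort : ∀ d α, (S d α).re ≤ Y + N / Y + 2 / Y * ∑ e ∈ Ico 1 N, F (d * e) α := by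
    intro d α
    have h1 : ‖S d α‖ ^ 2 ≤ N + 2 * ∑ e ∈ Ico 1 N, F (d * e) α := by
      have h2 := norm_sq_sum_cubic_diff_le N d (α * lam) (α * b) (α * c) (fun x => α * p x)
        (fun x => by rw [hp x]; ring)
      simp only [hS, expSum, mul_sub]
      refine h2.trans ?_
      gcongr with e _
      refine (linBound_le_fejerMajorant hJ _).trans_eq ?_
      simp only [hF]
      congr 1; ring
    have h3 : (S d α).re ≤ ‖S d α‖ := (le_abs_self _).trans (Complex.abs_re_le_norm _)
    have h4 : ‖S d α‖ ≤ Y + ‖S d α‖ ^ 2 / Y := by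
      rw [← sub_nonneg]
      have : Y + ‖S d α‖ ^ 2 / Y - ‖S d α‖ =
          ((‖S d α‖ - Y / 2) ^ 2 + 3 / 4 * Y ^ 2) / Y := by field_simp; ring
      rw [this]; positivity
    calc (S d α).re ≤ Y + ‖S d α‖ ^ 2 / Y := h3.trans h4
      _ ≤ Y + (N + 2 * ∑ e ∈ Ico 1 N, F (d * e) α) / Y := by gcongr
      _ = _ := by ring
  have hshort0 : ∀ d α, 0 ≤ Y + N / Y + 2 / Y * ∑ e ∈ Ico 1 N, F (d * e) α := fun d α => by
    have : 0 ≤ ∑ e ∈ Ico 1 N, F (d * e) α := Finset.sum_nonneg fun _ _ => fejerMajorant_nonneg _ _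
    positivity
  have hpt : ∀ α, ‖expSum (range N) p α‖ ^ 2 * g α ≤ N * g α +
      (2 * (∑ d ∈ Ico 1 D, ((Y + N / Y) * g α + 2 / Y * ∑ e ∈ Ico 1 N, F (d * e) α * g α)) +
      2 * ∑ d ∈ (Ico 1 N).filter (fun d => ¬ d < D), (S d α).re * g α) := by
    intro α
    rw [norm_sq_expSum_range, add_mul]
    gcongr
    rw [← Finset.sum_filter_add_sum_filter_not (Ico 1 N) (fun d => d < D), add_mul,
      ← Finset.mul_sum, ← Finset.mul_sum, mul_assoc, mul_assoc, Finset.sum_mul, Finset.sum_mul]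
    gcongr
    calc _ ≤ ∑ d ∈ (Ico 1 N).filter (fun d => d < D),
          (Y + N / Y + 2 / Y * ∑ e ∈ Ico 1 N, F (d * e) α) * g α :=
          Finset.sum_le_sum fun d _ => mul_le_mul_of_nonneg_right (hshort d α) (hg0 α)
      _ ≤ ∑ d ∈ Ico 1 D, (Y + N / Y + 2 / Y * ∑ e ∈ Ico 1 N, F (d * e) α) * g α := by
          refine Finset.sum_le_sum_of_subset_of_nonneg ?_ fun d _ _ =>
            mul_nonneg (hshort0 d α) (hg0 α)
          intro d hd
          simp only [Finset.mem_filter, Finset.mem_Ico] at hd ⊢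
          lia
      _ = _ := by
          refine Finset.sum_congr rfl fun d _ => ?_
          rw [← Finset.sum_mul]; ring
  have hi1 : ∀ d, Integrable (fun α => (Y + N / Y) * g α + 2 / Y * ∑ e ∈ Ico 1 N, F (d * e) α * g α)
      (gaussProb m) := fun d => (hgi.const_mul _).add
        ((integrable_finsetSum _ fun e _ => hFi _).const_mul _)
  have hi2 : Integrable (fun α => 2 * ∑ d ∈ Ico 1 D, ((Y + N / Y) * g α +
      2 / Y * ∑ e ∈ Ico 1 N, F (d * e) α * g α)) (gaussProb m) :=
    (integrable_finsetSum _ fun d _ => hi1 d).const_mul _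
  have hi3 : Integrable (fun α => 2 * ∑ d ∈ (Ico 1 N).filter (fun d => ¬ d < D),
      (S d α).re * g α) (gaussProb m) := (integrable_finsetSum _ fun d _ => hSi d).const_mul _
  have hlong : ∑ d ∈ (Ico 1 N).filter (fun d => ¬ d < D), ∫ α, (S d α).re * g α ∂gaussProb m ≤
      N ^ 2 * t.card ^ 2 / R ^ 2 := by
    have hR2 : 0 ≤ 1 / R ^ 2 := by positivity
    have h1 : ∀ d ∈ (Ico 1 N).filter (fun d => ¬ d < D),
        ∫ α, (S d α).re * g α ∂gaussProb m ≤ N * (t.card ^ 2 * (1 / R ^ 2)) := by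
      intro d hd
      simp only [Finset.mem_filter, Finset.mem_Ico, not_lt] at hd
      rw [integral_re_expSum_mul_norm_sq]
      calc _ ≤ ∑ x ∈ range (N - d), ∑ y ∈ t, ∑ y' ∈ t, 1 / R ^ 2 := by
            gcongr with x hx y hy y' hy'
            rw [Finset.mem_range] at hx
            exact exp_neg_le_of_le_abs hm hR (hsep x d hd.2 (by lia) y hy y' hy')
        _ = (N - d : ℕ) * (t.card ^ 2 * (1 / R ^ 2)) := by
            simp only [Finset.sum_const, nsmul_eq_mul, Finset.card_range]; ring
        _ ≤ _ := mul_le_mul_of_nonneg_right (by exact_mod_cast Nat.sub_le _ _)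
            (mul_nonneg (sq_nonneg _) hR2)
    calc _ ≤ ∑ d ∈ (Ico 1 N).filter (fun d => ¬ d < D), N * (t.card ^ 2 * (1 / R ^ 2)) :=
          Finset.sum_le_sum h1
      _ ≤ N * (N * (t.card ^ 2 * (1 / R ^ 2))) := by
          rw [Finset.sum_const, nsmul_eq_mul]
          refine mul_le_mul_of_nonneg_right ?_
            (mul_nonneg (Nat.cast_nonneg _) (mul_nonneg (sq_nonneg _) hR2))
          exact_mod_cast (Finset.card_filter_le _ _).trans (by simp)
      _ = _ := by ring
  have hfej : ∑ d ∈ Ico 1 D, ∑ e ∈ Ico 1 N, ∫ α, F (d * e) α * g α ∂gaussProb m ≤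
      64 * ((J + 1 : ℕ) * (D * N * G + 2 * T * C * t.card ^ 2)) := by
    have h1 := sum_integral_fejerMajorant_mul_le hm hC (Ico 1 D ×ˢ Ico 1 N) (fun p => p.1 * p.2)
      J T (fun j hj => card_filter_mul_mul_eq_le (B := B)
        ((Nat.mul_le_mul_left _ (Nat.pow_le_pow_right two_pos hj)).trans hB) hT) t ξ
    rw [Finset.sum_product] at h1
    refine h1.trans ?_
    rw [← hG, Finset.card_product]
    push_cast
    simp only [Nat.card_Ico]
    gcongr <;> exact Nat.sub_le _ _
  calc _ ≤ ∫ α, (N * g α +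
      (2 * (∑ d ∈ Ico 1 D, ((Y + N / Y) * g α + 2 / Y * ∑ e ∈ Ico 1 N, F (d * e) α * g α)) +
      2 * ∑ d ∈ (Ico 1 N).filter (fun d => ¬ d < D), (S d α).re * g α)) ∂gaussProb m := by
        refine integral_mono_of_nonneg (ae_of_all _ fun α => by positivity)
          ((hgi.const_mul _).add (hi2.add hi3)) (ae_of_all _ hpt)
    _ = N * G + (2 * (∑ d ∈ Ico 1 D, ((Y + N / Y) * G +
          2 / Y * ∑ e ∈ Ico 1 N, ∫ α, F (d * e) α * g α ∂gaussProb m)) +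
        2 * ∑ d ∈ (Ico 1 N).filter (fun d => ¬ d < D), ∫ α, (S d α).re * g α ∂gaussProb m) := by
        have e1 := integral_add (hgi.const_mul N) (hi2.add hi3)
        have e2 := integral_add hi2 hi3
        simp only [Pi.add_apply] at e1 e2
        rw [e1, e2, integral_const_mul, integral_const_mul, integral_const_mul,
          integral_finsetSum _ fun d _ => hi1 d, integral_finsetSum _ fun d _ => hSi d]
        congr 4
        ext d
        rw [integral_add (hgi.const_mul _) ((integrable_finsetSum _ fun e _ => hFi _).const_mul _),
          integral_const_mul, integral_const_mul, integral_finsetSum _ fun e _ => hFi _]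
    _ ≤ _ := by
        rw [Finset.sum_add_distrib, ← Finset.mul_sum (f := fun d => ∑ e ∈ Ico 1 N,
          ∫ α, F (d * e) α * g α ∂gaussProb m), Finset.sum_const, nsmul_eq_mul, ← add_assoc]
        have hD : ((Ico 1 D).card : ℝ) ≤ D := by simp
        have h1 : (Ico 1 D).card * ((Y + N / Y) * G) ≤ D * ((Y + N / Y) * G) := by
          gcongr
        have h2 : 2 / Y * ∑ d ∈ Ico 1 D, ∑ e ∈ Ico 1 N, ∫ α, F (d * e) α * g α ∂gaussProb m ≤
            2 / Y * (64 * ((J + 1 : ℕ) * (D * N * G + 2 * T * C * t.card ^ 2))) := by gcongr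
        have h3 : 2 / Y * (64 * ((J + 1 : ℕ) * (D * N * G + 2 * T * C * t.card ^ 2))) =
            128 / Y * ((J + 1 : ℕ) * (D * N * G + 2 * T * C * t.card ^ 2)) := by ring
        have h4 : (D : ℝ) * ((Y + N / Y) * G) = D * (Y + N / Y) * G := by ring
        rw [h3] at h2
        rw [h4] at h1
        linarith

theorem integral_norm_sq_expSum_le {m r C : ℝ} (hm : 1 ≤ m) (hr : 0 ≤ r)
    (hC : ∀ (s : Finset ℤ) (t : ℝ), ∑ n ∈ s, Real.exp (-Real.pi * (r * n - t) ^ 2) ≤ C)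
    (t : Finset ℕ) (ξ : ℕ → ℝ)
    (hξ : ∀ y ∈ t, ∀ y' ∈ t, r * |(y : ℝ) - y'| ≤ |ξ y - ξ y'|) :
    ∫ α, ‖expSum t ξ α‖ ^ 2 ∂gaussProb m ≤ t.card * C := by
  rw [integral_norm_sq_expSum, ← nsmul_eq_mul, ← Finset.sum_const]
  refine Finset.sum_le_sum fun y hy => ?_
  have h1 := sum_exp_mul_le hm hC t (fun y => y) 1 (fun n => by
    refine (Finset.card_le_one).2 fun a ha b hb => ?_
    rw [Finset.mem_filter] at ha hb
    exact ha.2.trans hb.2.symm) (r * y)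
  rw [Nat.cast_one, one_mul] at h1
  refine le_trans (Finset.sum_le_sum fun y' hy' => ?_) h1
  have h2 := hξ y hy y' hy'
  have h3 : (r * y' - r * y) ^ 2 ≤ (ξ y - ξ y') ^ 2 := by
    rw [← sq_abs (ξ y - ξ y'), ← mul_sub, mul_pow, ← sq_abs ((y' : ℝ) - y), abs_sub_comm,
      ← mul_pow]
    gcongr
  refine Real.exp_le_exp.2 ?_
  have hpi := Real.pi_pos
  have h4 : 0 ≤ Real.pi * m ^ 2 := by positivity
  nlinarith

/-- The cubic `a x³ + b x² + c x`. -/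
def cubic (a b c x : ℝ) : ℝ := a * x ^ 3 + b * x ^ 2 + c * x

@[fun_prop] theorem continuous_cubic (a b c : ℝ) : Continuous (cubic a b c) := by
  unfold cubic; fun_prop

theorem cubic_shift (a b c N : ℝ) (x : ℝ) : cubic a b c (N + x) =
    a * x ^ 3 + (3 * a * N + b) * x ^ 2 + (3 * a * N ^ 2 + 2 * b * N + c) * x + cubic a b c N := by
  unfold cubic; ring

theorem eventually_cubic_spacing {a : ℝ} (ha : a ≠ 0) (b c : ℝ) : ∀ᶠ N : ℝ in atTop,
    ∀ x x', N ≤ x → x ≤ 2 * N → N ≤ x' → x' ≤ 2 * N →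
      |a| * N ^ 2 * |x - x'| ≤ |cubic a b c x - cubic a b c x'| ∧
      |cubic a b c x - cubic a b c x'| ≤ 14 * |a| * N ^ 2 * |x - x'| := by
  have ha' : 0 < |a| := abs_pos.2 ha
  filter_upwards [eventually_ge_atTop 1, eventually_ge_atTop ((4 * |b| + |c|) / (2 * |a|))]
    with N h1 h2 x x' hx hx2 hx' hx2'
  rw [div_le_iff₀ (by positivity)] at h2
  have h3 : 4 * |b| * N + |c| ≤ 2 * |a| * N ^ 2 := by
    have h4 : |c| ≤ |c| * N := le_mul_of_one_le_right (abs_nonneg _) h1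
    nlinarith
  have h5 : cubic a b c x - cubic a b c x' =
      (a * (x ^ 2 + x * x' + x' ^ 2) + (b * (x + x') + c)) * (x - x') := by unfold cubic; ring
  have hlo : 3 * N ^ 2 ≤ x ^ 2 + x * x' + x' ^ 2 := by nlinarith
  have hhi : x ^ 2 + x * x' + x' ^ 2 ≤ 12 * N ^ 2 := by nlinarith
  have h6 : |b * (x + x') + c| ≤ 2 * |a| * N ^ 2 := by
    refine (abs_add_le _ _).trans (le_trans ?_ h3)
    rw [abs_mul, abs_of_nonneg (by linarith : 0 ≤ x + x')]
    nlinarith [abs_nonneg b]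
  have h7 : |a * (x ^ 2 + x * x' + x' ^ 2)| = |a| * (x ^ 2 + x * x' + x' ^ 2) := by
    rw [abs_mul, abs_of_nonneg (by nlinarith : 0 ≤ x ^ 2 + x * x' + x' ^ 2)]
  rw [h5, abs_mul]
  constructor
  · gcongr
    have := abs_sub_abs_le_abs_add (a * (x ^ 2 + x * x' + x' ^ 2)) (b * (x + x') + c)
    nlinarith
  · gcongr
    refine (abs_add_le _ _).trans ?_
    nlinarith

theorem eventually_pow_le_two_pow (j : ℕ) : ∀ᶠ m : ℕ in atTop, m ^ j ≤ 2 ^ (m - 1) := by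
  obtain ⟨K, hK1, hK⟩ := exists_succ_pow_le_mul_two_pow (j + 1)
  filter_upwards [eventually_ge_atTop K] with m hm
  have h := hK (m - 1)
  rw [Nat.sub_add_cancel (by lia), pow_succ] at h
  have h2 : m ^ j * K ≤ 2 ^ (m - 1) * K := by
    calc m ^ j * K ≤ m ^ j * m := Nat.mul_le_mul_left _ hm
      _ ≤ K * 2 ^ (m - 1) := h
      _ = _ := mul_comm _ _
  exact Nat.le_of_mul_le_mul_right h2 (by lia)

theorem eventually_natCast_pow {P : ℝ → Prop} (hP : ∀ᶠ x in atTop, P x) {j : ℕ} (hj : j ≠ 0) :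
    ∀ᶠ m : ℕ in atTop, P ((m ^ j : ℕ) : ℝ) :=
  (tendsto_natCast_atTop_atTop.comp (tendsto_pow_atTop hj)).eventually hP

/-- Mean value of a long and a short cubic sum in their natural proportions. -/
theorem eventually_integral_norm_sq_mul_le {a a' : ℝ} (ha : a ≠ 0) (ha' : a' ≠ 0)
    (b c b' c' : ℝ) {k : ℕ} (hk : 2 ≤ k) : ∀ᶠ m : ℕ in atTop,
    ∫ α, ‖expSum (range (m ^ (16 * k)) ×ˢ range (m ^ (13 * k)))
      (fun p => cubic a b c ((m ^ (16 * k) : ℕ) + p.1) +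
        cubic a' b' c' ((m ^ (13 * k) : ℕ) + p.2)) α‖ ^ 2 ∂gaussProb m ≤ (m : ℝ) ^ (29 * k + 1) := by
  obtain ⟨C, hC1, hC⟩ := exists_sum_exp_le (mul_ne_zero (by norm_num : (6 : ℝ) ≠ 0) ha)
  obtain ⟨C', hC1', hC'⟩ := exists_sum_exp_le (abs_ne_zero.2 ha')
  filter_upwards [eventually_natCast_pow (eventually_cubic_spacing ha b c)
      (by lia : 16 * k ≠ 0),
    eventually_natCast_pow (eventually_cubic_spacing ha' b' c') (by lia : 13 * k ≠ 0),
    eventually_pow_le_two_pow (16 * k), eventually_card_divisors_sq_le (39 * k + 2),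
    tendsto_natCast_atTop_atTop.eventually_ge_atTop ((1 + 14 * |a'|) / |a|),
    tendsto_natCast_atTop_atTop.eventually_ge_atTop (5 * C' + 256 * (C' + 2 * C) + 2),
    eventually_ge_atTop 2] with m hsp hsp' h2m hdiv hma hmC hm2
  have hm1 : 1 ≤ m := by lia
  have hmR1 : (1 : ℝ) ≤ m := by exact_mod_cast hm1
  have hm0 : (0 : ℝ) < m := by linarith
  set N := m ^ (16 * k) with hN
  set Q := m ^ (13 * k) with hQ
  have hNR : (N : ℝ) = (m : ℝ) ^ (16 * k) := by rw [hN]; push_cast; rfl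
  have hQR : (Q : ℝ) = (m : ℝ) ^ (13 * k) := by rw [hQ]; push_cast; rfl
  have hQ1 : (1 : ℝ) ≤ Q := by rw [hQR]; exact one_le_pow₀ hmR1
  have haa : 0 < |a| := abs_pos.2 ha
  set J := Nat.clog 2 N with hJ
  have hJ1 : N ≤ 2 ^ J := Nat.le_pow_clog (by norm_num) N
  have hJm : J + 1 ≤ m := by
    have : J ≤ m - 1 := Nat.clog_le_of_le_pow h2m
    lia
  have hJ2 : 2 ^ J ≤ 2 * N := by
    rcases Nat.eq_zero_or_pos J with h | h
    · rw [h, pow_zero]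
      have : 1 ≤ N := Nat.one_le_pow _ _ hm1
      lia
    · have h3 : 2 ^ (J - 1) < N := by
        have : 1 < N := by
          by_contra hcon
          rw [hJ, Nat.clog_of_right_le_one (by lia)] at h
          lia
        exact Nat.pow_pred_clog_lt_self (by norm_num) this
      have h4 : 2 ^ J = 2 * 2 ^ (J - 1) := by rw [← pow_succ']; congr 1; lia
      lia
  have hp : ∀ x : ℕ, cubic a b c (N + x) = a * x ^ 3 + (3 * a * N + b) * x ^ 2 +
      (3 * a * N ^ 2 + 2 * b * N + c) * x + cubic a b c (N + (0 : ℕ)) := by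
    intro x; rw [cubic_shift]; simp
  have hG := integral_norm_sq_expSum_le hmR1 (abs_nonneg a') hC' (range Q)
    (fun y => cubic a' b' c' (Q + y)) (by
      intro y hy y' hy'
      rw [Finset.mem_range] at hy hy'
      have hy1 : (y : ℝ) ≤ Q := by exact_mod_cast hy.le
      have hy2 : (y' : ℝ) ≤ Q := by exact_mod_cast hy'.le
      have hy3 : (0 : ℝ) ≤ y := Nat.cast_nonneg _
      have hy4 : (0 : ℝ) ≤ y' := Nat.cast_nonneg _
      have := (hsp' (Q + y) (Q + y') (by linarith) (by linarith) (by linarith) (by linarith)).1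
      rw [add_sub_add_left_eq_sub] at this
      refine le_trans ?_ this
      gcongr
      exact le_mul_of_one_le_right (abs_nonneg _) (one_le_pow₀ hQ1))
  have hsep : ∀ x d : ℕ, m ^ (7 * k + 1) ≤ d → x + d < N → ∀ y ∈ range Q, ∀ y' ∈ range Q,
      (m : ℝ) ^ (39 * k) ≤ |cubic a b c (N + (x + d : ℕ)) - cubic a b c (N + x) +
        (cubic a' b' c' (Q + y) - cubic a' b' c' (Q + y'))| := by
    intro x d hd hxd y hy y' hy'
    rw [Finset.mem_range] at hy hy'
    have hy1 : (y : ℝ) ≤ Q := by exact_mod_cast hy.le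
    have hy2 : (y' : ℝ) ≤ Q := by exact_mod_cast hy'.le
    have hy3 : (0 : ℝ) ≤ y := Nat.cast_nonneg _
    have hy4 : (0 : ℝ) ≤ y' := Nat.cast_nonneg _
    have hx1 : ((x + d : ℕ) : ℝ) ≤ N := by exact_mod_cast hxd.le
    have hx2 : (x : ℝ) ≤ N := by exact_mod_cast (by lia : x ≤ N)
    have hx3 : (0 : ℝ) ≤ x := Nat.cast_nonneg _
    have hx4 : (0 : ℝ) ≤ (x + d : ℕ) := Nat.cast_nonneg _
    have h1 := (hsp (N + (x + d : ℕ)) (N + x) (by linarith) (by linarith) (by linarith)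
      (by linarith)).1
    have h2 := (hsp' (Q + y) (Q + y') (by linarith) (by linarith) (by linarith) (by linarith)).2
    rw [add_sub_add_left_eq_sub] at h1 h2
    have h3 : |((x + d : ℕ) : ℝ) - x| = d := by
      push_cast; rw [add_sub_cancel_left, Nat.abs_cast]
    rw [h3] at h1
    have h4 : |(y : ℝ) - y'| ≤ Q := by rw [abs_le]; constructor <;> linarith
    have hdR : (m : ℝ) ^ (7 * k + 1) ≤ d := by exact_mod_cast hd
    have h5 : |a| * m * (m : ℝ) ^ (39 * k) ≤
        |cubic a b c (N + (x + d : ℕ)) - cubic a b c (N + x)| := by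
      refine le_trans ?_ h1
      rw [hNR]
      calc |a| * m * (m : ℝ) ^ (39 * k) = |a| * ((m : ℝ) ^ (16 * k)) ^ 2 * m ^ (7 * k + 1) := by
            ring
        _ ≤ _ := by gcongr
    have h6 : |cubic a' b' c' (Q + y) - cubic a' b' c' (Q + y')| ≤ 14 * |a'| * (m : ℝ) ^ (39 * k) := by
      refine h2.trans ?_
      calc 14 * |a'| * (Q : ℝ) ^ 2 * |(y : ℝ) - y'| ≤ 14 * |a'| * (Q : ℝ) ^ 2 * Q := by gcongr
        _ = _ := by rw [hQR]; ring
    rw [div_le_iff₀ haa] at hma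
    have h7 := abs_sub_abs_le_abs_add (cubic a b c (N + (x + d : ℕ)) - cubic a b c (N + x))
      (cubic a' b' c' (Q + y) - cubic a' b' c' (Q + y'))
    have h8 := mul_le_mul_of_nonneg_right hma (by positivity : (0 : ℝ) ≤ (m : ℝ) ^ (39 * k))
    linarith
  have hBle : m ^ (7 * k + 1) * N * 2 ^ J ≤ m ^ (39 * k + 2) := by
    calc _ ≤ m ^ (7 * k + 1) * N * (m * N) := by
          gcongr; exact hJ2.trans (Nat.mul_le_mul_right _ hm2)
      _ = _ := by rw [hN]; ring
  have hY : (0 : ℝ) < (m : ℝ) ^ (8 * k) := by positivity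
  have hR : (0 : ℝ) < (m : ℝ) ^ (39 * k) := by positivity
  have key := integral_norm_sq_mul_norm_sq_le hmR1 hC (fun x : ℕ => cubic a b c (N + x)) hp
    hJ1 hBle hdiv hY hR (range Q) (fun y => cubic a' b' c' (Q + y)) hsep
  set G := ∫ α, ‖expSum (range Q) (fun y => cubic a' b' c' (Q + y)) α‖ ^ 2 ∂gaussProb m
  rw [Finset.card_range, hQR] at hG
  simp only [Finset.card_range] at key
  have hmul : ∀ α, ‖expSum (range N ×ˢ range Q)
      (fun p => cubic a b c (N + p.1) + cubic a' b' c' (Q + p.2)) α‖ ^ 2 =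
      ‖expSum (range N) (fun x : ℕ => cubic a b c (N + x)) α‖ ^ 2 *
        ‖expSum (range Q) (fun y => cubic a' b' c' (Q + y)) α‖ ^ 2 := by
    intro α
    rw [← mul_pow, ← norm_mul, expSum_mul]
  simp only [hmul]
  refine key.trans ?_
  have hJR : ((J + 1 : ℕ) : ℝ) ≤ m := by exact_mod_cast hJm
  have hDR : ((m ^ (7 * k + 1) : ℕ) : ℝ) = (m : ℝ) ^ (7 * k + 1) := by push_cast; rfl
  have e1 : (N : ℝ) / (m : ℝ) ^ (8 * k) = (m : ℝ) ^ (8 * k) := by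
    rw [div_eq_iff hY.ne', hNR]; ring
  rw [e1, hDR, hNR, hQR]
  have t1 : (m : ℝ) ^ (16 * k) * G ≤ C' * (m : ℝ) ^ (29 * k) := by
    calc _ ≤ (m : ℝ) ^ (16 * k) * (m ^ (13 * k) * C') := by gcongr
      _ = _ := by ring
  have t2 : (m : ℝ) ^ (7 * k + 1) * ((m : ℝ) ^ (8 * k) + (m : ℝ) ^ (8 * k)) * G ≤
      2 * C' * (m : ℝ) ^ (29 * k) := by
    calc _ ≤ (m : ℝ) ^ (7 * k + 1) * ((m : ℝ) ^ (8 * k) + (m : ℝ) ^ (8 * k)) *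
          (m ^ (13 * k) * C') := by gcongr
      _ = 2 * C' * (m : ℝ) ^ (28 * k + 1) := by ring
      _ ≤ _ := by gcongr; lia
  have t3 : 128 / (m : ℝ) ^ (8 * k) * ((J + 1 : ℕ) * ((m : ℝ) ^ (7 * k + 1) * (m : ℝ) ^ (16 * k) * G +
      2 * m * C * ((m : ℝ) ^ (13 * k)) ^ 2)) ≤ 128 * (C' + 2 * C) * (m : ℝ) ^ (29 * k) := by
    rw [div_mul_eq_mul_div, div_le_iff₀ hY]
    calc _ ≤ 128 * (m * ((m : ℝ) ^ (7 * k + 1) * (m : ℝ) ^ (16 * k) * (m ^ (13 * k) * C') +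
          2 * m * C * ((m : ℝ) ^ (13 * k)) ^ 2)) := by gcongr
      _ = 128 * (C' * (m : ℝ) ^ (36 * k + 2) + 2 * C * (m : ℝ) ^ (26 * k + 2)) := by ring
      _ ≤ 128 * (C' * (m : ℝ) ^ (37 * k) + 2 * C * (m : ℝ) ^ (37 * k)) := by
          gcongr <;> lia
      _ = _ := by ring
  have t4 : ((m : ℝ) ^ (16 * k)) ^ 2 * ((m : ℝ) ^ (13 * k)) ^ 2 / ((m : ℝ) ^ (39 * k)) ^ 2 ≤
      (m : ℝ) ^ (29 * k) := by
    rw [div_le_iff₀ (by positivity), ← pow_mul, ← pow_mul, ← pow_mul, ← pow_add, ← pow_add]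
    exact pow_le_pow_right₀ hmR1 (by lia)
  rw [pow_succ (m : ℝ) (29 * k), mul_comm ((m : ℝ) ^ (29 * k)) (m : ℝ)]
  have t5 := mul_le_mul_of_nonneg_right hmC (by positivity : (0 : ℝ) ≤ (m : ℝ) ^ (29 * k))
  linarith

theorem eventually_one_add_log_le (B : ℕ) :
    ∀ᶠ m : ℕ in atTop, ∀ q : ℕ, 0 < q → q ≤ m ^ B → 1 + Real.log q ≤ m := by
  filter_upwards [eventually_pow_le_two_pow B, eventually_ge_atTop 1] with m hm hm1 q hq hqm
  have hq0 : (0 : ℝ) < q := by exact_mod_cast hq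
  have h1 : (q : ℝ) ≤ 2 ^ (m - 1) := by exact_mod_cast hqm.trans hm
  have h2 := Real.log_le_log hq0 h1
  rw [Real.log_pow, Nat.cast_sub hm1, Nat.cast_one] at h2
  have h3 : (1 : ℝ) ≤ m := by exact_mod_cast hm1
  have h4 := Real.log_two_lt_d9
  nlinarith

/-- The large values of a cubic sum are captured by a majorant with small mean value against the
square of another exponential sum. -/
theorem eventually_exists_level_majorant {a : ℝ} (ha : a ≠ 0) (b c : ℝ) {W : ℕ} (hW : 0 < W)
    {k : ℕ} (hk : 2 ≤ k) : ∀ᶠ m : ℕ in atTop, ∀ u j : ℕ, j + 2 ≤ 4 * k →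
    ∃ V : ℝ → ℝ, Continuous V ∧ (∀ α, 0 ≤ V α) ∧ (∃ K, ∀ α, V α ≤ K) ∧
      (∀ α, ((W * m ^ (16 * k) : ℕ) : ℝ) ≤ (m : ℝ) ^ (j + 1) *
        ‖expSum (range (W * m ^ (16 * k))) (fun x : ℕ => cubic a b c (u + x)) α‖ → 1 ≤ V α) ∧
      ∀ (t : Finset (ℕ × ℕ)) (ω : ℕ × ℕ → ℝ), t.card = m ^ (29 * k) →
        ∫ α, ‖expSum t ω α‖ ^ 2 ∂gaussProb m ≤ (m : ℝ) ^ (29 * k + 1) →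
        ∫ α, V α * ‖expSum t ω α‖ ^ 2 ∂gaussProb m ≤ (m : ℝ) ^ (10 * k + 4 * j + 11) := by
  obtain ⟨C, hC1, hC⟩ := exists_sum_exp_le (mul_ne_zero (by norm_num : (6 : ℝ) ≠ 0) ha)
  filter_upwards [eventually_card_divisors_sq_le (48 * k + 3),
    eventually_one_add_log_le (48 * k + 3), eventually_ge_atTop 318, eventually_ge_atTop W,
    tendsto_natCast_atTop_atTop.eventually_ge_atTop (4 * (1 + 2 * C))] with
    m hdiv hlog hm hmW hmC u j hj
  set M := W * m ^ (16 * k) with hM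
  have hmR : (318 : ℝ) ≤ m := by exact_mod_cast hm
  have hm1 : (1 : ℝ) ≤ m := by linarith
  have hm0 : (0 : ℝ) < m := by linarith
  have hmN : 1 ≤ m := by lia
  have hM0 : 0 < M := by positivity
  have hMm : M ≤ m ^ (16 * k + 1) := by
    rw [hM, pow_succ, mul_comm]; exact Nat.mul_le_mul_left _ hmW
  have hmM : m ^ (16 * k) ≤ M := Nat.le_mul_of_pos_left _ hW
  have hmMR : (m : ℝ) ^ (16 * k) ≤ M := by exact_mod_cast hmM
  have hH0 : 0 < m ^ (48 * k - 4 * j - 9) := by positivity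
  have hZH : m ^ (4 * j + 8) * m ^ (48 * k - 4 * j - 9) * m = m ^ (48 * k) := by
    rw [← pow_add, ← pow_succ]; congr 1; lia
  have hZHR : (m : ℝ) ^ (4 * j + 8) * (m : ℝ) ^ (48 * k - 4 * j - 9) * m = (m : ℝ) ^ (48 * k) := by
    exact_mod_cast hZH
  refine ⟨fun α => rationalMajorant (m ^ (4 * j + 8)) (m ^ (48 * k - 4 * j - 9)) (6 * a * α),
    by fun_prop, fun α => rationalMajorant_nonneg _ _ _,
    ⟨∑ q ∈ Ico 1 (m ^ (4 * j + 8) + 1), 4 / ((m ^ (48 * k - 4 * j - 9) : ℕ) : ℝ) ^ 2 *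
      ((m ^ (48 * k - 4 * j - 9) : ℕ) : ℝ) ^ 2, fun α => ?_⟩, fun α hα => ?_, fun t ω ht hint => ?_⟩
  · refine Finset.sum_le_sum fun q _ => mul_le_mul_of_nonneg_left (pow_le_pow_left₀ (norm_nonneg _) ?_ 2)
      (by positivity)
    exact (norm_sum_le_of_le _ fun _ _ => (norm_unitExp _).le).trans (by simp)
  · have hφ : ∀ x : ℕ, α * cubic a b c (u + x) = (α * a) * x ^ 3 + (α * (3 * a * u + b)) * x ^ 2 +
        (α * (3 * a * u ^ 2 + 2 * b * u + c)) * x + α * cubic a b c (u + (0 : ℕ)) := by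
      intro x; rw [cubic_shift]; simp only [Nat.cast_zero, add_zero]; ring
    obtain ⟨q, hq0, hqZ, hqa⟩ := exists_cubic_approx (M := M) (t := m) (ℓ := m)
      (A := (m : ℝ) ^ (j + 1)) (Z := (m : ℝ) ^ (4 * j + 8)) (fun x : ℕ => α * cubic a b c (u + x)) hφ hM0
      (fun n hn hnM => (Nat.le_self_pow two_ne_zero _).trans (hdiv n hn (hnM.trans (by
        calc M ^ 2 ≤ (m ^ (16 * k + 1)) ^ 2 := by gcongr
          _ = m ^ (32 * k + 2) := by ring
          _ ≤ _ := by gcongr <;> lia))))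
      hmN (fun q hq hqM => hlog q hq (hqM.trans (by
        calc M ^ 3 ≤ (m ^ (16 * k + 1)) ^ 3 := by gcongr
          _ = m ^ (48 * k + 3) := by ring)))
      (one_le_pow₀ hm1) hα (by
        calc 318 * (m : ℝ) * m * ((m : ℝ) ^ (j + 1)) ^ 4 = 318 * (m : ℝ) ^ (4 * j + 6) := by ring
          _ < (m : ℝ) ^ 2 * (m : ℝ) ^ (4 * j + 6) := by gcongr; nlinarith
          _ = _ := by ring)
      (le_trans (pow_le_pow_right₀ hm1 (by lia)) hmMR)
    refine one_le_rationalMajorant hH0 hq0 (by exact_mod_cast hqZ) ?_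
    rw [show (q : ℝ) * (6 * a * α) = q * (6 * (α * a)) by ring]
    push_cast
    calc 8 * (m : ℝ) ^ (48 * k - 4 * j - 9) * distInt (q * (6 * (α * a))) ≤
        8 * (m : ℝ) ^ (48 * k - 4 * j - 9) * ((m : ℝ) ^ (4 * j + 8) / M ^ 3) := by gcongr
      _ ≤ 8 * (m : ℝ) ^ (48 * k - 4 * j - 9) * ((m : ℝ) ^ (4 * j + 8) / ((m : ℝ) ^ (16 * k)) ^ 3) := by
          gcongr
      _ = 8 * ((m : ℝ) ^ (4 * j + 8) * (m : ℝ) ^ (48 * k - 4 * j - 9)) / (m : ℝ) ^ (48 * k) := by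
          rw [← pow_mul]; ring_nf
      _ ≤ 1 := by
          rw [div_le_one (by positivity), ← hZHR]
          nlinarith [mul_pos (pow_pos hm0 (4 * j + 8)) (pow_pos hm0 (48 * k - 4 * j - 9))]
  · have h := integral_rationalMajorant_mul_le hm1 hC hH0 (Z := m ^ (4 * j + 8)) (B := m ^ (48 * k))
      (by
        rw [← hZH]
        have : 1 ≤ m ^ (4 * j + 8) := Nat.one_le_pow _ _ hmN
        nlinarith [Nat.zero_le (m ^ (4 * j + 8) * m ^ (48 * k - 4 * j - 9))])
      (fun n hn hnB => hdiv n hn (hnB.trans (pow_le_pow_right₀ hmN (by lia)))) t ω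
    refine h.trans ?_
    rw [ht]
    push_cast
    rw [div_mul_eq_mul_div, div_le_iff₀ (by positivity)]
    calc 4 * ((m : ℝ) ^ (4 * j + 8) * ∫ α, ‖expSum t ω α‖ ^ 2 ∂gaussProb m +
          2 * m * C * ((m : ℝ) ^ (29 * k)) ^ 2) ≤
        4 * ((m : ℝ) ^ (4 * j + 8) * (m : ℝ) ^ (29 * k + 1) +
          2 * m * C * ((m : ℝ) ^ (29 * k)) ^ 2) := by gcongr
      _ = 4 * ((m : ℝ) ^ (4 * j + 8 + 29 * k + 1) + 2 * C * (m : ℝ) ^ (58 * k + 1)) := by ring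
      _ ≤ 4 * ((m : ℝ) ^ (58 * k + 1) + 2 * C * (m : ℝ) ^ (58 * k + 1)) := by
          gcongr
          · lia
      _ = 4 * (1 + 2 * C) * (m : ℝ) ^ (58 * k + 1) := by ring
      _ ≤ m * (m : ℝ) ^ (58 * k + 1) := by gcongr
      _ = _ := by rw [← pow_succ', ← pow_add]; congr 1; lia

/-- Pigeonholing a product of five numbers in `[0, 1]` by the size of the largest. -/
theorem prod_le_level_sum {m : ℝ} (hm : 1 ≤ m) {L d : ℕ} {ι : Type*} [Fintype ι]
    (hι : Fintype.card ι = 5) (x : ι → ℝ)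
    (hx0 : ∀ i, 0 ≤ x i) (hx1 : ∀ i, x i ≤ 1) {i₀ : ι} (hi₀ : m ^ d * x i₀ ≤ 1)
    (V : ι → ℕ → ℝ) (hV0 : ∀ i j, 0 ≤ V i j) (hV : ∀ i j, j < L → 1 ≤ m ^ (j + 1) * x i → 1 ≤ V i j) :
    ∏ i, x i ≤ 1 / m ^ (5 * L) + ∑ i, ∑ j ∈ range L, 1 / m ^ (d + 4 * j) * V i j := by
  classical
  have hm0 : 0 < m := by linarith
  have hsum0 : 0 ≤ ∑ i, ∑ j ∈ range L, 1 / m ^ (d + 4 * j) * V i j :=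
    Finset.sum_nonneg fun i _ => Finset.sum_nonneg fun j _ => mul_nonneg (by positivity) (hV0 i j)
  have hL0 : 0 ≤ 1 / m ^ (5 * L) := by positivity
  by_cases hsmall : ∀ i, m ^ L * x i ≤ 1
  · have : ∏ i, x i ≤ ∏ _i : ι, 1 / m ^ L := Finset.prod_le_prod (fun i _ => hx0 i) fun i _ => by
      rw [le_div_iff₀ (by positivity), mul_comm]; exact hsmall i
    rw [Finset.prod_const, Finset.card_univ, hι, one_div, ← inv_pow, ← pow_mul, mul_comm L 5, inv_pow,
      ← one_div] at this
    linarith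
  push Not at hsmall
  have hex : ∃ n, ∃ i, 1 ≤ m ^ n * x i := ⟨L, hsmall.imp fun i h => h.le⟩
  set n := Nat.find hex with hn
  obtain ⟨i, hi⟩ := Nat.find_spec hex
  have hnL : n ≤ L := Nat.find_min' hex (hsmall.imp fun i h => h.le)
  obtain ⟨j, hjL, hij, hj⟩ : ∃ j < L, 1 ≤ m ^ (j + 1) * x i ∧ ∀ i', m ^ j * x i' ≤ 1 := by
    rcases Nat.eq_zero_or_pos n with h0 | hpos
    · rw [← hn, h0, pow_zero, one_mul] at hi
      refine ⟨0, ?_, ?_, fun i' => by rw [pow_zero, one_mul]; exact hx1 i'⟩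
      · rcases Nat.eq_zero_or_pos L with hL | hL
        · obtain ⟨i', hi'⟩ := hsmall
          rw [hL, pow_zero, one_mul] at hi'
          exact absurd (hx1 i') (not_le.2 hi')
        · exact hL
      · rw [zero_add, pow_one]; nlinarith
    · refine ⟨n - 1, by lia, by rw [Nat.sub_add_cancel hpos]; exact hi, fun i' => ?_⟩
      have := Nat.find_min hex (m := n - 1) (by lia)
      push Not at this
      exact (this i').le
  have h1 : ∏ i, x i ≤ 1 / m ^ (d + 4 * j) := by
    rw [← Finset.mul_prod_erase _ _ (Finset.mem_univ i₀)]
    have h2 : ∏ i ∈ Finset.univ.erase i₀, x i ≤ ∏ _i ∈ Finset.univ.erase i₀, 1 / m ^ j :=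
      Finset.prod_le_prod (fun i _ => hx0 i) fun i _ => by
        rw [le_div_iff₀ (by positivity), mul_comm]; exact hj i
    rw [Finset.prod_const, Finset.card_erase_of_mem (Finset.mem_univ i₀), Finset.card_univ, hι] at h2
    calc _ ≤ 1 / m ^ d * (1 / m ^ j) ^ (5 - 1) := by
          refine mul_le_mul ?_ h2 (Finset.prod_nonneg fun i _ => hx0 i) (by positivity)
          rw [le_div_iff₀ (by positivity), mul_comm]; exact hi₀
      _ = _ := by rw [pow_add, div_pow, one_pow, ← pow_mul, mul_comm j]; ring
  have h2 : 1 / m ^ (d + 4 * j) * V i j ≤ ∑ i, ∑ j ∈ range L, 1 / m ^ (d + 4 * j) * V i j :=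
    (Finset.single_le_sum (f := fun j => 1 / m ^ (d + 4 * j) * V i j)
      (fun j _ => mul_nonneg (by positivity) (hV0 i j)) (Finset.mem_range.2 hjL)).trans
    (Finset.single_le_sum (f := fun i => ∑ j ∈ range L, 1 / m ^ (d + 4 * j) * V i j)
      (fun i _ => Finset.sum_nonneg fun j _ => mul_nonneg (by positivity) (hV0 i j))
      (Finset.mem_univ i))
  have h3 : 1 / m ^ (d + 4 * j) * 1 ≤ 1 / m ^ (d + 4 * j) * V i j := by
    gcongr; exact hV i j hjL hij
  linarith

theorem eventually_exists_coeff_approx (a b c : ℝ) {W : ℕ} (hW : 0 < W) {k d : ℕ}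
    (hk : 8 * d + 7 ≤ 16 * k) : ∀ᶠ m : ℕ in atTop, ∀ α,
    ((W * m ^ (16 * k) : ℕ) : ℝ) ≤ (m : ℝ) ^ d *
      ‖expSum (range (W * m ^ (16 * k))) (fun x : ℕ => cubic a b c x) α‖ →
    ∃ K : ℕ, 0 < K ∧ K ≤ m ^ (13 * d + 11) ∧
      distInt (K * (α * a)) ≤ (m : ℝ) ^ (13 * d + 11) / m ^ (3 * (16 * k)) ∧
      ∀ β, β = a ∨ β = b ∨ β = c →
        distInt (K * (α * β)) ≤ (m : ℝ) ^ (13 * d + 11) / m ^ (16 * k) := by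
  filter_upwards [eventually_card_divisors_sq_le (48 * k + 3),
    eventually_one_add_log_le (48 * k + 3), eventually_ge_atTop 400, eventually_ge_atTop W] with
    m hdiv hlog hm hmW α hα
  set M := W * m ^ (16 * k) with hM
  have hm1 : (1 : ℝ) ≤ m := by exact_mod_cast (by lia : 1 ≤ m)
  have hmN : 1 ≤ m := by lia
  have hm0 : (0 : ℝ) < m := by linarith
  have hMm : M ≤ m ^ (16 * k + 1) := by
    rw [hM, pow_succ, mul_comm]; exact Nat.mul_le_mul_left _ hmW
  have hmM : (m : ℝ) ^ (16 * k) ≤ M := by exact_mod_cast Nat.le_mul_of_pos_left _ hW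
  have hM' : M = W * m ^ (16 * k - (8 * d + 7)) * m ^ (8 * d + 7) := by
    rw [mul_assoc, ← pow_add, Nat.sub_add_cancel hk]
  obtain ⟨K, hK0, hK, h1, h2, h3⟩ := exists_coeff_approx (d := d)
    (W := W * m ^ (16 * k - (8 * d + 7))) (fun x : ℕ => α * cubic a b c x)
    (a := α * a) (b := α * b) (c := α * c) (fun x => by simp only [cubic, Nat.cast_zero]; ring)
    hm (by positivity) hM'
    (fun n hn hnM => (Nat.le_self_pow two_ne_zero _).trans (hdiv n hn (hnM.trans (by
      calc M ^ 2 ≤ (m ^ (16 * k + 1)) ^ 2 := by gcongr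
        _ = m ^ (32 * k + 2) := by ring
        _ ≤ _ := by gcongr <;> lia))))
    (fun q hq hqM => hlog q hq (hqM.trans (by
      calc M ^ 3 ≤ (m ^ (16 * k + 1)) ^ 3 := by gcongr
        _ = m ^ (48 * k + 3) := by ring))) hα
  have hN1 : (1 : ℝ) ≤ (m : ℝ) ^ (16 * k) := one_le_pow₀ hm1
  have hcube : (m : ℝ) ^ (3 * (16 * k)) ≤ (M : ℝ) ^ 3 := by
    rw [mul_comm, pow_mul]; gcongr
  have hpow : ∀ j : ℕ, 1 ≤ j → (m : ℝ) ^ (16 * k) ≤ (M : ℝ) ^ j := fun j hj =>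
    hmM.trans (le_self_pow₀ (hN1.trans hmM) (by lia))
  refine ⟨K, hK0, hK, h1.trans (by gcongr), ?_⟩
  rintro β (rfl | rfl | rfl)
  · exact h1.trans (div_le_div_of_nonneg_left (by positivity) (by positivity) (hpow 3 (by lia)))
  · exact h2.trans (div_le_div_of_nonneg_left (by positivity) (by positivity) (hpow 2 (by lia)))
  · exact h3.trans (div_le_div_of_nonneg_left (by positivity) (by positivity) hmM)

/-- Two cubic sums whose coefficients have an irrational ratio are not simultaneously large. -/
theorem frequently_norm_expSum_small {a b c a' b' c' μ : ℝ} (ha : a ≠ 0) (hμ : Irrational μ)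
    (hmem : μ * a = b ∨ μ * a = c ∨ μ * a = a' ∨ μ * a = b' ∨ μ * a = c')
    {W W' : ℕ} (hW : 0 < W) (hW' : 0 < W') {k d : ℕ} (hk : 4 * (13 * d + 11) + 9 ≤ 16 * k) :
    ∃ᶠ m : ℕ in atTop, ∀ α, (m : ℝ) ^ (13 * d + 13) ≤ |α| * m ^ (3 * (16 * k)) →
      |α| ≤ (m : ℝ) ^ 2 →
      (m : ℝ) ^ d * ‖expSum (range (W * m ^ (16 * k))) (fun x : ℕ => cubic a b c x) α‖ ≤
        (W * m ^ (16 * k) : ℕ) ∨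
      (m : ℝ) ^ d * ‖expSum (range (W' * m ^ (16 * k))) (fun x : ℕ => cubic a' b' c' x) α‖ ≤
        (W' * m ^ (16 * k) : ℕ) := by
  refine ((frequently_one_le_mul_distInt hμ (D := 2 * (13 * d + 11) + 4) (by lia)).and_eventually
    ((eventually_exists_coeff_approx a b c hW (by lia : 8 * d + 7 ≤ 16 * k)).and
    ((eventually_exists_coeff_approx a' b' c' hW' (by lia : 8 * d + 7 ≤ 16 * k)).and
    ((eventually_ge_atTop 2).and
    ((tendsto_natCast_atTop_atTop.eventually_ge_atTop (|a|)).and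
    ((tendsto_natCast_atTop_atTop.eventually_ge_atTop (|μ|)).and
    (tendsto_natCast_atTop_atTop.eventually_gt_atTop (1 / |a|)))))))).mono ?_
  rintro m ⟨hirr, h0, h1, hm2, hma, hmμ, hma'⟩ α hα hα'
  by_contra hcon
  push Not at hcon
  obtain ⟨K₀, hK₀, hK₀e, hd₀, hd₀'⟩ := h0 α hcon.1.le
  obtain ⟨K₁, hK₁, hK₁e, hd₁, hd₁'⟩ := h1 α hcon.2.le
  have ha0 : 0 < |a| := abs_pos.2 ha
  rw [div_lt_iff₀ ha0] at hma'
  have hfin := fun K (hK : 0 < K) (hKe : K ≤ m ^ (13 * d + 11))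
      (hd : distInt (K * (α * (μ * a))) ≤ (m : ℝ) ^ (13 * d + 11) / m ^ (16 * k)) =>
    false_of_two_approx (v := 13 * d + 13) hm2 hma hmμ hma' hirr hα' hα le_rfl hk hK₀ hK hK₀e hKe hd₀ hd
  rcases hmem with h | h | h | h | h
  · exact hfin K₀ hK₀ hK₀e (hd₀' _ (Or.inr (Or.inl h)))
  · exact hfin K₀ hK₀ hK₀e (hd₀' _ (Or.inr (Or.inr h)))
  · exact hfin K₁ hK₁ hK₁e (hd₁' _ (Or.inl h))
  · exact hfin K₁ hK₁ hK₁e (hd₁' _ (Or.inr (Or.inl h)))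
  · exact hfin K₁ hK₁ hK₁e (hd₁' _ (Or.inr (Or.inr h)))

/-- A majorant on the minor arcs for the product of five cubic sums and two further sums, with
small mean value. -/
theorem frequently_exists_minor_majorant {ι : Type*} [Fintype ι] (hι : Fintype.card ι = 5)
    {a b c : ι → ℝ} (ha : ∀ i, a i ≠ 0) {W : ι → ℕ} (hW : ∀ i, 0 < W i)
    {k : ℕ} (hk : 100 ≤ k) {μ : ℝ} (hμ : Irrational μ) {i₀ i₁ : ι}
    (hmem : μ * a i₀ = b i₀ ∨ μ * a i₀ = c i₀ ∨ μ * a i₀ = a i₁ ∨ μ * a i₀ = b i₁ ∨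
      μ * a i₀ = c i₁)
    (t : ℕ → Finset (ℕ × ℕ)) (ht : ∀ m, (t m).card = m ^ (29 * k))
    (ω ω' : ℕ → ℕ × ℕ → ℝ)
    (hω : ∀ᶠ m : ℕ in atTop, ∫ α, ‖expSum (t m) (ω m) α‖ ^ 2 ∂gaussProb m ≤
      (m : ℝ) ^ (29 * k + 1))
    (hω' : ∀ᶠ m : ℕ in atTop, ∫ α, ‖expSum (t m) (ω' m) α‖ ^ 2 ∂gaussProb m ≤
      (m : ℝ) ^ (29 * k + 1)) :
    ∃ᶠ m : ℕ in atTop, ∃ F : ℝ → ℝ, Continuous F ∧ (∀ α, 0 ≤ F α) ∧ (∃ K, ∀ α, F α ≤ K) ∧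
      (∀ α, (m : ℝ) ^ 273 ≤ |α| * m ^ (48 * k) → |α| ≤ (m : ℝ) ^ 2 →
        (∏ i, ‖expSum (range (W i * m ^ (16 * k))) (fun x : ℕ => cubic (a i) (b i) (c i) x) α‖) *
          (‖expSum (t m) (ω m) α‖ * ‖expSum (t m) (ω' m) α‖) ≤ F α) ∧
      ∫ α, F α ∂gaussProb m ≤ (m : ℝ) ^ (90 * k - 8) := by
  have hlev : ∀ᶠ m : ℕ in atTop, ∀ i, _ := eventually_all.2 fun i =>
    eventually_exists_level_majorant (ha i) (b i) (c i) (hW i) (by lia : 2 ≤ k)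
  refine ((frequently_norm_expSum_small (ha i₀) hμ hmem (hW i₀) (hW i₁)
    (by lia : 4 * (13 * 20 + 11) + 9 ≤ 16 * k)).and_eventually (hlev.and (hω.and (hω'.and
    ((eventually_ge_atTop 1).and (tendsto_natCast_atTop_atTop.eventually_ge_atTop
      (2 * (∏ i, (W i : ℝ)) * (1 + 20 * k)))))))).mono ?_
  rintro m ⟨hsmall, hlev, hω, hω', hm1, hmW⟩
  have hmR : (1 : ℝ) ≤ m := by exact_mod_cast hm1
  have hm0 : (0 : ℝ) < m := by linarith
  have hlev' : ∀ i, ∀ j : ℕ, ∃ V : ℝ → ℝ, Continuous V ∧ (∀ α, 0 ≤ V α) ∧ (∃ K, ∀ α, V α ≤ K) ∧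
      (j < 4 * k - 1 → (∀ α, ((W i * m ^ (16 * k) : ℕ) : ℝ) ≤ (m : ℝ) ^ (j + 1) *
        ‖expSum (range (W i * m ^ (16 * k))) (fun x : ℕ => cubic (a i) (b i) (c i) x) α‖ →
          1 ≤ V α) ∧
      ∀ (t : Finset (ℕ × ℕ)) (ω : ℕ × ℕ → ℝ), t.card = m ^ (29 * k) →
        ∫ α, ‖expSum t ω α‖ ^ 2 ∂gaussProb m ≤ (m : ℝ) ^ (29 * k + 1) →
        ∫ α, V α * ‖expSum t ω α‖ ^ 2 ∂gaussProb m ≤ (m : ℝ) ^ (10 * k + 4 * j + 11)) := by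
    intro i j
    by_cases hj : j < 4 * k - 1
    · obtain ⟨V, h1, h2, h3, h4, h5⟩ := hlev i 0 j (by lia)
      simp only [Nat.cast_zero, zero_add] at h4
      exact ⟨V, h1, h2, h3, fun _ => ⟨h4, h5⟩⟩
    · exact ⟨fun _ => 0, continuous_const, fun _ => le_rfl, ⟨0, fun _ => le_rfl⟩,
        fun h => absurd h hj⟩
  choose V hVc hV0 hVK hV using hlev'
  choose K hK using hVK
  set G : ℝ → ℝ := fun α => ‖expSum (t m) (ω m) α‖ ^ 2 + ‖expSum (t m) (ω' m) α‖ ^ 2 with hG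
  have hGK : ∀ α, G α ≤ 2 * ((m ^ (29 * k) : ℕ) : ℝ) ^ 2 := by
    intro α
    have h1 := pow_le_pow_left₀ (norm_nonneg _) (norm_expSum_le (t m) (ω m) α) 2
    have h2 := pow_le_pow_left₀ (norm_nonneg _) (norm_expSum_le (t m) (ω' m) α) 2
    rw [ht] at h1 h2
    simp only [hG]; linarith
  have hG0 : ∀ α, 0 ≤ G α := fun α => by positivity
  set P : ℝ := ∏ i, (W i : ℝ) with hP
  have hP0 : 0 < P := Finset.prod_pos fun i _ => by exact_mod_cast hW i
  have hGi := (integrable_norm_sq_expSum m (t m) (ω m)).add (integrable_norm_sq_expSum m (t m) (ω' m))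
  have hint : ∀ ξ : ℕ × ℕ → ℝ, ∀ i j,
      Integrable (fun α => V i j α * ‖expSum (t m) ξ α‖ ^ 2) (gaussProb m) := by
    intro ξ i j
    refine integrable_gaussProb (by have := hVc i j; fun_prop)
      (K i j * ((m ^ (29 * k) : ℕ) : ℝ) ^ 2) fun α => ?_
    rw [Real.norm_of_nonneg (mul_nonneg (hV0 i j α) (by positivity)), ← ht]
    exact mul_le_mul (hK i j α) (pow_le_pow_left₀ (norm_nonneg _) (norm_expSum_le _ _ _) 2)
      (by positivity) ((hV0 i j α).trans (hK i j α))
  have hVG : ∀ i j, Integrable (fun α => V i j α * G α) (gaussProb m) := by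
    intro i j
    have := (hint (ω m) i j).add (hint (ω' m) i j)
    refine this.congr (Eventually.of_forall fun α => ?_)
    simp only [hG, Pi.add_apply, mul_add]
  have hVGint : ∀ i j, j < 4 * k - 1 →
      ∫ α, V i j α * G α ∂gaussProb m ≤ 2 * (m : ℝ) ^ (10 * k + 4 * j + 11) := by
    intro i j hj
    have e1 := integral_add (hint (ω m) i j) (hint (ω' m) i j)
    simp only [hG, mul_add]
    rw [e1]
    have h1 := (hV i j hj).2 (t m) (ω m) (ht m) hω
    have h2 := (hV i j hj).2 (t m) (ω' m) (ht m) hω'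
    linarith
  have hGint : ∫ α, G α ∂gaussProb m ≤ 2 * (m : ℝ) ^ (29 * k + 1) := by
    have e1 := integral_add (integrable_norm_sq_expSum m (t m) (ω m))
      (integrable_norm_sq_expSum m (t m) (ω' m))
    simp only [hG]
    rw [e1]
    linarith
  set L := 4 * k - 1 with hL
  set F : ℝ → ℝ := fun α => P * (m : ℝ) ^ (80 * k) * (1 / (m : ℝ) ^ (5 * L) * G α +
    ∑ i, ∑ j ∈ range L, 1 / (m : ℝ) ^ (20 + 4 * j) * (V i j α * G α)) with hF
  refine ⟨F, ?_, fun α => ?_, ?_, fun α hα hα' => ?_, ?_⟩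
  · have : Continuous G := by simp only [hG]; fun_prop
    fun_prop
  · refine mul_nonneg (by positivity) (add_nonneg (mul_nonneg (by positivity) (hG0 α))
      (Finset.sum_nonneg fun i _ => Finset.sum_nonneg fun j _ => mul_nonneg (by positivity)
        (mul_nonneg (hV0 i j α) (hG0 α))))
  · refine ⟨P * (m : ℝ) ^ (80 * k) * (1 / (m : ℝ) ^ (5 * L) * (2 * ((m ^ (29 * k) : ℕ) : ℝ) ^ 2) +
      ∑ i, ∑ j ∈ range L, 1 / (m : ℝ) ^ (20 + 4 * j) * (K i j * (2 * ((m ^ (29 * k) : ℕ) : ℝ) ^ 2))),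
      fun α => mul_le_mul_of_nonneg_left (add_le_add
        (mul_le_mul_of_nonneg_left (hGK α) (by positivity))
        (Finset.sum_le_sum fun i _ => Finset.sum_le_sum fun j _ =>
          mul_le_mul_of_nonneg_left (mul_le_mul (hK i j α) (hGK α) (hG0 α)
            ((hV0 i j α).trans (hK i j α))) (by positivity))) (by positivity)⟩
  · have hM0 : ∀ i, (0 : ℝ) < (W i * m ^ (16 * k) : ℕ) := fun i => by
      have := hW i
      exact_mod_cast (by positivity : 0 < W i * m ^ (16 * k))
    set f : ι → ℝ := fun i =>
      ‖expSum (range (W i * m ^ (16 * k))) (fun x : ℕ => cubic (a i) (b i) (c i) x) α‖ with hf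
    have hf0 : ∀ i, 0 ≤ f i := fun i => norm_nonneg _
    have hf1 : ∀ i, f i ≤ (W i * m ^ (16 * k) : ℕ) := fun i => by
      have := norm_expSum_le (range (W i * m ^ (16 * k))) (fun x : ℕ => cubic (a i) (b i) (c i) x) α
      rwa [Finset.card_range] at this
    obtain ⟨i₂, hi₂⟩ : ∃ i₂, (m : ℝ) ^ 20 * f i₂ ≤ (W i₂ * m ^ (16 * k) : ℕ) := by
      have := hsmall α (by rw [show 3 * (16 * k) = 48 * k by ring]; exact hα) hα'
      exact this.elim (fun h => ⟨i₀, h⟩) fun h => ⟨i₁, h⟩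
    have key := prod_le_level_sum hmR hι (fun i => f i / (W i * m ^ (16 * k) : ℕ))
      (fun i => div_nonneg (hf0 i) (hM0 i).le) (fun i => by rw [div_le_one (hM0 i)]; exact hf1 i)
      (i₀ := i₂) (d := 20) (L := L)
      (by rw [← mul_div_assoc, div_le_one (hM0 i₂)]; exact hi₂)
      (fun i j => V i j α) (fun i j => hV0 i j α)
      (fun i j hj h => by
        rw [← mul_div_assoc, one_le_div (hM0 i)] at h
        exact (hV i j hj).1 α h)
    have hprod : ∏ i, f i = P * (m : ℝ) ^ (80 * k) * ∏ i, f i / (W i * m ^ (16 * k) : ℕ) := by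
      rw [Finset.prod_div_distrib]
      have : ∏ i, ((W i * m ^ (16 * k) : ℕ) : ℝ) = P * (m : ℝ) ^ (80 * k) := by
        push_cast
        rw [Finset.prod_mul_distrib, Finset.prod_const, Finset.card_univ, hι, ← pow_mul]
        congr 2; ring
      rw [this, mul_div_cancel₀]
      positivity
    rw [hprod]
    have hg : ‖expSum (t m) (ω m) α‖ * ‖expSum (t m) (ω' m) α‖ ≤ G α := by
      simp only [hG]
      nlinarith [sq_nonneg (‖expSum (t m) (ω m) α‖ - ‖expSum (t m) (ω' m) α‖),
        sq_nonneg (‖expSum (t m) (ω m) α‖), sq_nonneg (‖expSum (t m) (ω' m) α‖)]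
    have hpr0 : 0 ≤ ∏ i, f i / (W i * m ^ (16 * k) : ℕ) :=
      Finset.prod_nonneg fun i _ => div_nonneg (hf0 i) (hM0 i).le
    simp only [hF]
    rw [mul_assoc]
    refine mul_le_mul_of_nonneg_left ?_ (by positivity)
    refine (mul_le_mul key hg (by positivity) (hpr0.trans key)).trans (le_of_eq ?_)
    simp only [add_mul, Finset.sum_mul, mul_assoc]
  · have e0 : Integrable (fun α => 1 / (m : ℝ) ^ (5 * L) * G α) (gaussProb m) := hGi.const_mul _
    have e1 := integral_add e0 (integrable_finsetSum univ
      (fun i _ => integrable_finsetSum (range L) fun j _ =>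
        (hVG i j).const_mul (1 / (m : ℝ) ^ (20 + 4 * j))))
    simp only [hF]
    rw [integral_const_mul, e1, integral_const_mul, integral_finsetSum _ (fun i _ =>
      integrable_finsetSum (range L) fun j _ => (hVG i j).const_mul (1 / (m : ℝ) ^ (20 + 4 * j)))]
    have e2 : ∀ i, ∫ α, ∑ j ∈ range L, 1 / (m : ℝ) ^ (20 + 4 * j) * (V i j α * G α) ∂gaussProb m ≤
        4 * k * (2 * (m : ℝ) ^ (10 * k - 9)) := by
      intro i
      rw [integral_finsetSum _ fun j _ => (hVG i j).const_mul (1 / (m : ℝ) ^ (20 + 4 * j))]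
      calc _ ≤ ∑ j ∈ range L, 2 * (m : ℝ) ^ (10 * k - 9) := by
            refine Finset.sum_le_sum fun j hj => ?_
            rw [integral_const_mul, one_div, inv_mul_le_iff₀ (by positivity)]
            refine (hVGint i j (Finset.mem_range.1 hj)).trans (le_of_eq ?_)
            rw [mul_left_comm, ← pow_add]
            congr 2; lia
        _ = L * (2 * (m : ℝ) ^ (10 * k - 9)) := by simp
        _ ≤ _ := by
            gcongr
            rw [hL]; exact_mod_cast Nat.sub_le _ _
    have e3 : 1 / (m : ℝ) ^ (5 * L) * ∫ α, G α ∂gaussProb m ≤ 2 * (m : ℝ) ^ (10 * k - 9) := by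
      rw [one_div, inv_mul_le_iff₀ (by positivity)]
      refine hGint.trans ?_
      rw [mul_left_comm, ← pow_add]
      exact mul_le_mul_of_nonneg_left (pow_le_pow_right₀ hmR (by lia)) zero_le_two
    calc _ ≤ P * (m : ℝ) ^ (80 * k) * (2 * (m : ℝ) ^ (10 * k - 9) +
          ∑ _i : ι, 4 * k * (2 * (m : ℝ) ^ (10 * k - 9))) := by
          gcongr with i
          exact e2 i
      _ = 2 * P * (1 + 20 * k) * ((m : ℝ) ^ (80 * k) * (m : ℝ) ^ (10 * k - 9)) := by
          rw [Finset.sum_const, Finset.card_univ, hι]; ring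
      _ ≤ m * ((m : ℝ) ^ (80 * k) * (m : ℝ) ^ (10 * k - 9)) := by gcongr
      _ = _ := by rw [← pow_add, ← pow_succ']; congr 1; lia

theorem integrable_exp_neg_sq_div {m : ℝ} (hm : 0 < m) :
    Integrable (fun α : ℝ => Real.exp (-Real.pi * α ^ 2 / m ^ 2)) := by
  have := integrable_exp_neg_mul_sq (show 0 < Real.pi / m ^ 2 by positivity)
  refine this.congr (Eventually.of_forall fun α => ?_)
  simp only; congr 1; ring

theorem integrable_exp_neg_sq_div_smul {ι : Type*} {m : ℝ} (hm : 0 < m) (s : Finset ι)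
    (ω : ι → ℝ) :
    Integrable (fun α : ℝ => Real.exp (-Real.pi * α ^ 2 / m ^ 2) • expSum s ω α) := by
  refine ((integrable_exp_neg_sq_div hm).mul_const (s.card : ℝ)).mono' (by fun_prop)
    (Eventually.of_forall fun α => ?_)
  rw [norm_smul, Real.norm_of_nonneg (Real.exp_pos _).le]
  exact mul_le_mul_of_nonneg_left (norm_expSum_le s ω α) (Real.exp_pos _).le

theorem integral_exp_neg_sq_div_smul_expSum {ι : Type*} {m : ℝ} (hm : 0 < m) (s : Finset ι)
    (ω : ι → ℝ) :
    ∫ α : ℝ, Real.exp (-Real.pi * α ^ 2 / m ^ 2) • expSum s ω α =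
      ((m * ∑ i ∈ s, Real.exp (-Real.pi * m ^ 2 * ω i ^ 2) : ℝ) : ℂ) := by
  have h1 : ∫ α, expSum s ω α ∂gaussProb m =
      ((∑ i ∈ s, Real.exp (-Real.pi * m ^ 2 * ω i ^ 2) : ℝ) : ℂ) := by
    simp only [expSum]
    rw [integral_finsetSum _ fun i _ => integrable_gaussProb (by fun_prop) 1 fun α =>
      (norm_unitExp _).le]
    simp only [integral_unitExp_gaussProb]
    push_cast; rfl
  rw [integral_gaussProb hm] at h1
  simp only [mul_smul] at h1
  rw [integral_smul, inv_smul_eq_iff₀ hm.ne'] at h1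
  rw [h1, Complex.real_smul]
  push_cast; rfl

theorem integral_exp_neg_sq_div_mul {m : ℝ} (hm : 0 < m) (F : ℝ → ℝ) :
    ∫ α : ℝ, Real.exp (-Real.pi * α ^ 2 / m ^ 2) * F α = m * ∫ α, F α ∂gaussProb m := by
  rw [integral_gaussProb hm]
  simp only [smul_eq_mul, mul_assoc]
  rw [integral_const_mul, ← mul_assoc, mul_inv_cancel₀ hm.ne', one_mul]

/-- Comparison of a smoothed count at a coarse scale with the count at a fine scale. -/
theorem mul_sum_exp_le {ι : Type*} {m δ σ : ℝ} (hm : 0 < m) (hδ : 0 < δ) (hσ : 0 < σ)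
    (hσm : σ ≤ m) (s : Finset ι) (ω : ι → ℝ) {F : ℝ → ℝ} (hFc : Continuous F)
    (hF0 : ∀ α, 0 ≤ F α) {K : ℝ} (hFK : ∀ α, F α ≤ K)
    (hF : ∀ α, δ ≤ |α| → |α| ≤ m ^ 2 → ‖expSum s ω α‖ ≤ F α) :
    σ * ∑ i ∈ s, Real.exp (-Real.pi * σ ^ 2 * ω i ^ 2) ≤
      m * ∑ i ∈ s, Real.exp (-Real.pi * m ^ 2 * ω i ^ 2) +
      (s.card * (Real.pi * δ ^ 2 / σ ^ 2) * (2 * δ) + m * ∫ α, F α ∂gaussProb m +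
        s.card * Real.exp (-Real.pi * m ^ 2 / 2) * (2 * m)) := by
  have hpi := Real.pi_pos
  have h1 := integral_exp_neg_sq_div_smul_expSum hσ s ω
  have h2 := integral_exp_neg_sq_div_smul_expSum hm s ω
  have h3 := integral_sub (integrable_exp_neg_sq_div_smul hσ s ω)
    (integrable_exp_neg_sq_div_smul hm s ω)
  rw [h1, h2, ← Complex.ofReal_sub] at h3
  have hb : Integrable (fun α : ℝ => Real.exp (-(Real.pi / (2 * m ^ 2)) * α ^ 2)) :=
    integrable_exp_neg_mul_sq (by positivity)
  have hFi : Integrable (fun α : ℝ => Real.exp (-Real.pi * α ^ 2 / m ^ 2) * F α) := by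
    refine ((integrable_exp_neg_sq_div hm).mul_const K).mono' (by fun_prop)
      (Eventually.of_forall fun α => ?_)
    rw [Real.norm_of_nonneg (mul_nonneg (Real.exp_pos _).le (hF0 α))]
    exact mul_le_mul_of_nonneg_left (hFK α) (Real.exp_pos _).le
  set c₁ : ℝ := s.card * (Real.pi * δ ^ 2 / σ ^ 2) with hc₁
  set c₂ : ℝ := s.card * Real.exp (-Real.pi * m ^ 2 / 2) with hc₂
  have hc₁0 : 0 ≤ c₁ := by positivity
  have hc₂0 : 0 ≤ c₂ := by positivity
  have hi1 : Integrable ((Set.Icc (-δ) δ).indicator fun _ : ℝ => c₁) :=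
    (integrable_indicator_iff measurableSet_Icc).2 (integrableOn_const (by simp))
  have hB : ∀ α, ‖Real.exp (-Real.pi * α ^ 2 / σ ^ 2) • expSum s ω α -
      Real.exp (-Real.pi * α ^ 2 / m ^ 2) • expSum s ω α‖ ≤
      (Set.Icc (-δ) δ).indicator (fun _ => c₁) α + Real.exp (-Real.pi * α ^ 2 / m ^ 2) * F α +
        c₂ * Real.exp (-(Real.pi / (2 * m ^ 2)) * α ^ 2) := by
    intro α
    have hw : Real.exp (-Real.pi * α ^ 2 / σ ^ 2) ≤ Real.exp (-Real.pi * α ^ 2 / m ^ 2) := by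
      refine Real.exp_le_exp.2 ?_
      rw [neg_mul, neg_div, neg_div, neg_le_neg_iff]
      gcongr
    have hw0 := Real.exp_pos (-Real.pi * α ^ 2 / σ ^ 2)
    have hsc := norm_expSum_le s ω α
    rw [← sub_smul, norm_smul, Real.norm_eq_abs, abs_sub_comm, abs_of_nonneg (by linarith)]
    have hn1 : 0 ≤ (Set.Icc (-δ) δ).indicator (fun _ => c₁) α :=
      Set.indicator_nonneg (fun _ _ => hc₁0) α
    have hn2 : 0 ≤ Real.exp (-Real.pi * α ^ 2 / m ^ 2) * F α :=
      mul_nonneg (Real.exp_pos _).le (hF0 α)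
    have hn3 : 0 ≤ c₂ * Real.exp (-(Real.pi / (2 * m ^ 2)) * α ^ 2) := by positivity
    by_cases hα : δ ≤ |α|
    · by_cases hα' : |α| ≤ m ^ 2
      · have : (Real.exp (-Real.pi * α ^ 2 / m ^ 2) - Real.exp (-Real.pi * α ^ 2 / σ ^ 2)) *
            ‖expSum s ω α‖ ≤ Real.exp (-Real.pi * α ^ 2 / m ^ 2) * F α :=
          mul_le_mul (by linarith) (hF α hα hα') (norm_nonneg _) (Real.exp_pos _).le
        linarith
      · push Not at hα'
        have h5 : (m ^ 2) ^ 2 ≤ α ^ 2 := by rw [← sq_abs α]; gcongr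
        have h6 : Real.exp (-Real.pi * α ^ 2 / m ^ 2) ≤ Real.exp (-Real.pi * m ^ 2 / 2) *
            Real.exp (-(Real.pi / (2 * m ^ 2)) * α ^ 2) := by
          rw [← Real.exp_add]
          refine Real.exp_le_exp.2 ?_
          have h7 : Real.pi * m ^ 2 / 2 ≤ Real.pi / (2 * m ^ 2) * α ^ 2 := by
            calc Real.pi * m ^ 2 / 2 = Real.pi / (2 * m ^ 2) * (m ^ 2) ^ 2 := by field_simp
              _ ≤ _ := by gcongr
          have h8 : -Real.pi * α ^ 2 / m ^ 2 = -(2 * (Real.pi / (2 * m ^ 2) * α ^ 2)) := by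
            field_simp
          rw [h8]; linarith
        have : (Real.exp (-Real.pi * α ^ 2 / m ^ 2) - Real.exp (-Real.pi * α ^ 2 / σ ^ 2)) *
            ‖expSum s ω α‖ ≤ Real.exp (-Real.pi * m ^ 2 / 2) *
            Real.exp (-(Real.pi / (2 * m ^ 2)) * α ^ 2) * s.card :=
          mul_le_mul (by linarith) hsc (norm_nonneg _) (by positivity)
        rw [hc₂] at hn3 ⊢
        linarith
    · push Not at hα
      have hmem : α ∈ Set.Icc (-δ) δ := ⟨by linarith [neg_abs_le α], by linarith [le_abs_self α]⟩
      rw [Set.indicator_of_mem hmem] at hn1 ⊢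
      have h5 : Real.exp (-Real.pi * α ^ 2 / m ^ 2) ≤ 1 := by
        rw [Real.exp_le_one_iff, neg_mul, neg_div, neg_nonpos]; positivity
      have h6 := Real.add_one_le_exp (-Real.pi * α ^ 2 / σ ^ 2)
      have h7 : Real.pi * α ^ 2 / σ ^ 2 ≤ Real.pi * δ ^ 2 / σ ^ 2 := by
        rw [← sq_abs α]; gcongr
      have h8 : -Real.pi * α ^ 2 / σ ^ 2 = -(Real.pi * α ^ 2 / σ ^ 2) := by ring
      have : (Real.exp (-Real.pi * α ^ 2 / m ^ 2) - Real.exp (-Real.pi * α ^ 2 / σ ^ 2)) *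
          ‖expSum s ω α‖ ≤ Real.pi * δ ^ 2 / σ ^ 2 * s.card :=
        mul_le_mul (by linarith) hsc (norm_nonneg _)
          (by positivity)
      rw [hc₁] at hn1 ⊢
      linarith
  have h4 := norm_integral_le_of_norm_le ((hi1.add hFi).add (hb.const_mul c₂))
    (Eventually.of_forall hB)
  have e1 := integral_add (hi1.add hFi) (hb.const_mul c₂)
  have e2 := integral_add hi1 hFi
  simp only [Pi.add_apply] at e1 e2 h4
  rw [e1, e2, h3, Complex.norm_real, Real.norm_eq_abs, integral_const_mul, integral_gaussian,
    integral_exp_neg_sq_div_mul hm, integral_indicator measurableSet_Icc, setIntegral_const,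
    Measure.real, Real.volume_Icc, sub_neg_eq_add, ENNReal.toReal_ofReal (by linarith),
    smul_eq_mul] at h4
  have h5 : Real.sqrt (Real.pi / (Real.pi / (2 * m ^ 2))) ≤ 2 * m := by
    rw [div_div_cancel₀ hpi.ne', Real.sqrt_le_left (by positivity)]
    nlinarith [sq_nonneg m]
  have h6 := mul_le_mul_of_nonneg_left h5 hc₂0
  have h7 := le_abs_self (σ * ∑ i ∈ s, Real.exp (-Real.pi * σ ^ 2 * ω i ^ 2) -
    m * ∑ i ∈ s, Real.exp (-Real.pi * m ^ 2 * ω i ^ 2))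
  linarith

theorem abs_cubic_sub_le (a b c : ℝ) {M x x' : ℝ} (hM : 1 ≤ M) (hx : |x| ≤ M) (hx' : |x'| ≤ M) :
    |cubic a b c x - cubic a b c x'| ≤ (3 * |a| + 2 * |b| + |c|) * M ^ 2 * |x - x'| := by
  have h1 : cubic a b c x - cubic a b c x' =
      (a * (x ^ 2 + x * x' + x' ^ 2) + b * (x + x') + c) * (x - x') := by unfold cubic; ring
  rw [h1, abs_mul]
  gcongr
  have h2 : |x ^ 2 + x * x' + x' ^ 2| ≤ 3 * M ^ 2 := by
    rw [abs_le] at hx hx' ⊢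
    constructor <;> nlinarith
  have h3 : |x + x'| ≤ 2 * M := (abs_add_le _ _).trans (by linarith)
  calc _ ≤ |a| * |x ^ 2 + x * x' + x' ^ 2| + |b| * |x + x'| + |c| := by
        rw [← abs_mul, ← abs_mul]
        exact (abs_add_le _ _).trans (add_le_add_left (abs_add_le _ _) _)
    _ ≤ |a| * (3 * M ^ 2) + |b| * (2 * M) + |c| * 1 := by rw [mul_one]; gcongr
    _ ≤ |a| * (3 * M ^ 2) + |b| * (2 * M ^ 2) + |c| * M ^ 2 := by
        gcongr
        · nlinarith
        · nlinarith
    _ = _ := by ring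

/-- A Lipschitz function takes many integer values' worth of points near an attained level. -/
theorem le_card_filter_near {p : ℝ → ℝ} (hp : Continuous p) (hp0 : p 0 = 0) {D S y : ℝ} {M : ℕ}
    (hD : 0 < D) (hlip : ∀ x x' : ℝ, |x| ≤ M → |x'| ≤ M → |p x - p x'| ≤ D * |x - x'|)
    (hS : D ≤ S) (hy : S ≤ y) (hyM : y ≤ p M) :
    S / (2 * D) ≤ #{x ∈ range M | |p (x : ℕ) - y| ≤ S} := by
  have hM : (0 : ℝ) ≤ M := Nat.cast_nonneg _
  obtain ⟨r, ⟨hr0, hrM⟩, hr⟩ := intermediate_value_Icc hM hp.continuousOn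
    (show y ∈ Set.Icc (p 0) (p M) from ⟨by rw [hp0]; linarith, hyM⟩)
  have hrabs : |r| ≤ M := by rw [abs_of_nonneg hr0]; exact hrM
  set L := S / D with hL
  have hL1 : 1 ≤ L := (one_le_div hD).2 hS
  have hLS : D * L = S := by rw [hL]; field_simp
  have hLr : L ≤ r := by
    have := hlip r 0 hrabs (by simp)
    rw [hr, hp0, sub_zero, sub_zero, abs_of_nonneg hr0, abs_of_nonneg (by linarith)] at this
    rw [hL, div_le_iff₀ hD]; linarith
  set n := ⌊L⌋₊ with hn
  have hn1 : 1 ≤ n := (Nat.one_le_floor_iff _).2 hL1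
  have hnL : (n : ℝ) ≤ L := Nat.floor_le (by linarith)
  have hnL' : L < n + 1 := Nat.lt_floor_add_one _
  have hc1 : (⌈r⌉₊ : ℝ) < r + 1 := Nat.ceil_lt_add_one hr0
  have hc2 : r ≤ ⌈r⌉₊ := Nat.le_ceil r
  have hnc : n ≤ ⌈r⌉₊ := by exact_mod_cast (hnL.trans hLr).trans hc2
  have hcM : ⌈r⌉₊ ≤ M := Nat.ceil_le.2 hrM
  have hcard : n ≤ #{x ∈ range M | |p (x : ℕ) - y| ≤ S} := by
    rw [← Finset.card_range n]
    refine Finset.card_le_card_of_injOn (fun i => ⌈r⌉₊ - 1 - i) (fun i hi => ?_)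
      (fun i hi j hj hij => ?_)
    · have hi : i < n := by simpa using hi
      have hiR : (i : ℝ) + 1 ≤ n := by exact_mod_cast hi
      have hcast : ((⌈r⌉₊ - 1 - i : ℕ) : ℝ) = ⌈r⌉₊ - 1 - i := by
        rw [Nat.sub_sub, Nat.cast_sub (by lia)]; push_cast; ring
      simp only [Finset.coe_filter, Finset.mem_range, Set.mem_ofPred_eq]
      refine ⟨by lia, ?_⟩
      rw [← hr]
      refine (hlip _ _ ?_ hrabs).trans ?_
      · rw [Nat.abs_cast]; exact_mod_cast (by lia : ⌈r⌉₊ - 1 - i ≤ M)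
      · rw [← hLS, hcast]
        gcongr
        rw [abs_le]; constructor <;> linarith
    · have hi : i < n := by simpa using hi
      have hj : j < n := by simpa using hj
      simp only at hij
      lia
  have hcardR : (n : ℝ) ≤ #{x ∈ range M | |p (x : ℕ) - y| ≤ S} := by exact_mod_cast hcard
  refine le_trans ?_ hcardR
  have hn1R : (1 : ℝ) ≤ n := by exact_mod_cast hn1
  rw [show S / (2 * D) = L / 2 by rw [hL]; field_simp]
  linarith

theorem le_sum_exp_of_near {κ : Type*} {p : ℝ → ℝ} (hp : Continuous p) (hp0 : p 0 = 0) {D S : ℝ}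
    {M : ℕ} (hD : 0 < D)
    (hlip : ∀ x x' : ℝ, |x| ≤ M → |x'| ≤ M → |p x - p x'| ≤ D * |x - x'|) (hS : D ≤ S)
    (t : Finset κ) (ξ : κ → ℝ) (hξ : ∀ y ∈ t, S ≤ -ξ y ∧ -ξ y ≤ p M) :
    t.card * (S / (2 * D) * Real.exp (-Real.pi)) ≤
      ∑ q ∈ range M ×ˢ t, Real.exp (-Real.pi * S⁻¹ ^ 2 * (p (q.1 : ℕ) + ξ q.2) ^ 2) := by
  have hS0 : 0 < S := hD.trans_le hS
  rw [Finset.sum_product_right, ← nsmul_eq_mul, ← Finset.sum_const]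
  refine Finset.sum_le_sum fun y hy => ?_
  have h1 := le_card_filter_near hp hp0 hD hlip hS (hξ y hy).1 (hξ y hy).2
  calc _ ≤ (#{x ∈ range M | |p (x : ℕ) - -ξ y| ≤ S} : ℝ) * Real.exp (-Real.pi) := by gcongr
    _ = ∑ _x ∈ range M with |p (_x : ℕ) - -ξ y| ≤ S, Real.exp (-Real.pi) := by
        rw [Finset.sum_const, nsmul_eq_mul]
    _ ≤ ∑ x ∈ range M with |p (x : ℕ) - -ξ y| ≤ S,
          Real.exp (-Real.pi * S⁻¹ ^ 2 * (p (x : ℕ) + ξ y) ^ 2) := by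
        refine Finset.sum_le_sum fun x hx => Real.exp_le_exp.2 ?_
        have h2 := (Finset.mem_filter.1 hx).2
        rw [sub_neg_eq_add] at h2
        have h3 : (p (x : ℕ) + ξ y) ^ 2 ≤ S ^ 2 := sq_le_sq' (abs_le.1 h2).1 (abs_le.1 h2).2
        have h4 : S⁻¹ ^ 2 * (p (x : ℕ) + ξ y) ^ 2 ≤ 1 := by
          rw [inv_pow, inv_mul_le_iff₀ (by positivity), mul_one]; exact h3
        nlinarith [Real.pi_pos]
    _ ≤ _ := Finset.sum_le_sum_of_subset_of_nonneg (Finset.filter_subset _ _)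
        fun _ _ _ => (Real.exp_pos _).le

theorem eventually_abs_cubic_sub_le (a b c : ℝ) {ε : ℝ} (hε : 0 < ε) : ∀ᶠ N : ℝ in atTop,
    ∀ x, 0 ≤ x → x ≤ 2 * N → |cubic a b c x - a * x ^ 3| ≤ ε * N ^ 3 := by
  filter_upwards [eventually_ge_atTop 1, eventually_ge_atTop ((4 * |b| + 2 * |c|) / ε)]
    with N h1 h2 x hx hx2
  rw [div_le_iff₀ hε] at h2
  have h3 : cubic a b c x - a * x ^ 3 = b * x ^ 2 + c * x := by unfold cubic; ring
  rw [h3]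
  calc |b * x ^ 2 + c * x| ≤ |b| * x ^ 2 + |c| * x := by
        refine (abs_add_le _ _).trans (le_of_eq ?_)
        rw [abs_mul, abs_mul, abs_of_nonneg hx, abs_of_nonneg (by positivity : 0 ≤ x ^ 2)]
    _ ≤ |b| * (2 * N) ^ 2 + |c| * (2 * N) := by gcongr
    _ ≤ (4 * |b| + 2 * |c|) * N ^ 2 := by
        have : |c| * N ≤ |c| * N ^ 2 := by gcongr; nlinarith
        nlinarith
    _ ≤ N * ε * N ^ 2 := by gcongr
    _ = _ := by ring

theorem eventually_natCast_pow_mul_exp_le {c : ℝ} (hc : 0 < c) (B : ℕ) :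
    ∀ᶠ m : ℕ in atTop, (m : ℝ) ^ B * Real.exp (-(c * m ^ 2)) ≤ 1 := by
  have h := tendsto_natCast_atTop_atTop.eventually
    ((Real.tendsto_pow_mul_exp_neg_atTop_nhds_zero B).eventually (Iic_mem_nhds zero_lt_one))
  filter_upwards [h, tendsto_natCast_atTop_atTop.eventually_ge_atTop (1 / c)] with m hm hmc
  rw [div_le_iff₀ hc] at hmc
  refine le_trans ?_ hm
  gcongr
  nlinarith [(Nat.cast_nonneg m : (0 : ℝ) ≤ m)]

theorem prod_expSum {ι κ : Type*} [Fintype ι] [DecidableEq ι] (s : ι → Finset κ) (ω : ι → κ → ℝ)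
    (α : ℝ) : ∏ i, expSum (s i) (ω i) α =
      expSum (Fintype.piFinset s) (fun x => ∑ i, ω i (x i)) α := by
  simp only [expSum, Finset.mul_sum, unitExp_sum, Finset.prod_univ_sum]

/-- Two-sided bounds for a sum of cubics with negative leading coefficients. -/
theorem eventually_sum_cubic_bounds {ι : Type*} [Fintype ι] (a b c : ι → ℝ) (ha : ∀ i, a i < 0)
    (i₀ : ι) (τ : ℝ) : ∃ κ C : ℝ, 0 < κ ∧ 0 < C ∧ ∀ᶠ N : ℝ in atTop, ∀ x : ι → ℝ,
      (∀ i, 0 ≤ x i) → (∀ i, x i ≤ 2 * N) → N ≤ x i₀ →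
      κ * N ^ 3 ≤ -(∑ i, cubic (a i) (b i) (c i) (x i) - τ) ∧
      -(∑ i, cubic (a i) (b i) (c i) (x i) - τ) ≤ C * N ^ 3 := by
  classical
  set ε : ℝ := -a i₀ / (2 * (Fintype.card ι + 1)) with hε
  have hε0 : 0 < ε := div_pos (by linarith [ha i₀]) (by positivity)
  have hεa : (Fintype.card ι + 1) * ε = -a i₀ / 2 := by rw [hε]; field_simp
  refine ⟨-a i₀ / 2, ∑ i, -(8 * a i) + -a i₀ / 2, by linarith [ha i₀],
    add_pos_of_nonneg_of_pos (Finset.sum_nonneg fun i _ => by linarith [ha i])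
      (by linarith [ha i₀]), ?_⟩
  have hev : ∀ᶠ N : ℝ in atTop, ∀ i, _ := eventually_all.2 fun i =>
    eventually_abs_cubic_sub_le (a i) (b i) (c i) hε0
  filter_upwards [hev, eventually_ge_atTop 1, eventually_ge_atTop (|τ| / ε)] with N hN hN1 hNτ
    x hx0 hx2 hxi
  rw [div_le_iff₀ hε0] at hNτ
  have hN3 : N ≤ N ^ 3 := le_self_pow₀ hN1 (by norm_num)
  have hτ : |τ| ≤ ε * N ^ 3 := by nlinarith
  rw [abs_le] at hτ
  have hsum : |∑ i, cubic (a i) (b i) (c i) (x i) - ∑ i, a i * x i ^ 3| ≤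
      Fintype.card ι * (ε * N ^ 3) := by
    rw [← Finset.sum_sub_distrib]
    refine (Finset.abs_sum_le_sum_abs _ _).trans ?_
    refine (Finset.sum_le_sum fun i _ => hN i (x i) (hx0 i) (hx2 i)).trans ?_
    rw [Finset.sum_const, nsmul_eq_mul, Finset.card_univ]
  rw [abs_le] at hsum
  have hup : ∑ i, a i * x i ^ 3 ≤ a i₀ * N ^ 3 := by
    rw [← Finset.add_sum_erase _ _ (Finset.mem_univ i₀)]
    have h1 : ∑ i ∈ univ.erase i₀, a i * x i ^ 3 ≤ 0 := Finset.sum_nonpos fun i _ =>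
      mul_nonpos_of_nonpos_of_nonneg (ha i).le (pow_nonneg (hx0 i) 3)
    have h2 : a i₀ * x i₀ ^ 3 ≤ a i₀ * N ^ 3 :=
      mul_le_mul_of_nonpos_left (by gcongr) (ha i₀).le
    linarith
  have hlo : -(∑ i, -(8 * a i)) * N ^ 3 ≤ ∑ i, a i * x i ^ 3 := by
    rw [Finset.sum_neg_distrib, neg_neg, Finset.sum_mul]
    refine Finset.sum_le_sum fun i _ => ?_
    have : x i ^ 3 ≤ 8 * N ^ 3 := by
      calc x i ^ 3 ≤ (2 * N) ^ 3 := by gcongr; exacts [hx0 i, hx2 i]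
        _ = _ := by ring
    nlinarith [ha i]
  have h3 : Fintype.card ι * (ε * N ^ 3) + ε * N ^ 3 = -a i₀ / 2 * N ^ 3 := by
    rw [← hεa]; ring
  constructor <;> linarith

theorem norm_expSum_sub_const {ι : Type*} (s : Finset ι) (ω : ι → ℝ) (τ α : ℝ) :
    ‖expSum s (fun i => ω i - τ) α‖ = ‖expSum s ω α‖ := by
  have : expSum s (fun i => ω i - τ) α = expSum s ω α * unitExp (-(α * τ)) := by
    simp only [expSum, Finset.sum_mul, ← unitExp_add]
    refine Finset.sum_congr rfl fun i _ => ?_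
    congr 1; ring
  rw [this, norm_mul, norm_unitExp, mul_one]

set_option maxHeartbeats 1000000 in
theorem exists_abs_sum_cubic_sub_lt {a b c : Fin 5 → ℝ} {a' b' c' : Fin 4 → ℝ} (ha0 : 0 < a 0)
    (ha : ∀ i : Fin 4, a i.succ < 0) (ha' : ∀ i, a' i < 0) {μ : ℝ} (hμ : Irrational μ) {i₁ : Fin 5}
    (hmem : μ * a 0 = b 0 ∨ μ * a 0 = c 0 ∨ μ * a 0 = a i₁ ∨ μ * a 0 = b i₁ ∨ μ * a 0 = c i₁)
    (τ : ℝ) {η : ℝ} (hη : 0 < η) : ∃ (x : Fin 5 → ℕ) (y : Fin 4 → ℕ),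
      |∑ i, cubic (a i) (b i) (c i) (x i) + ∑ i, cubic (a' i) (b' i) (c' i) (y i) - τ| < η := by
  by_contra hcon
  push Not at hcon
  obtain ⟨k, hk⟩ : ∃ k : ℕ, 100 ≤ k := ⟨100, le_rfl⟩
  have hane : ∀ i, a i ≠ 0 := Fin.cases ha0.ne' fun i => (ha i).ne
  obtain ⟨κ, C, hκ, hC, hbd⟩ := eventually_sum_cubic_bounds
    (Sum.elim (fun i : Fin 4 => a i.succ) a') (Sum.elim (fun i : Fin 4 => b i.succ) b')
    (Sum.elim (fun i : Fin 4 => c i.succ) c') (by rintro (i | i); exacts [ha i, ha' i]) (Sum.inr 0) τ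
  obtain ⟨C₁, hC₁⟩ := exists_nat_ge (max 1 (2 * C / a 0))
  have hC₁R : (1 : ℝ) ≤ C₁ := (le_max_left _ _).trans hC₁
  have hC₁0 : 0 < C₁ := by exact_mod_cast (zero_lt_one.trans_le hC₁R)
  have hC₁C : 2 * C ≤ C₁ * a 0 := (div_le_iff₀ ha0).1 ((le_max_right _ _).trans hC₁)
  set D₀ : ℝ := 3 * |a 0| + 2 * |b 0| + |c 0| with hD₀
  have hD₀0 : 0 < D₀ := by have := abs_pos.2 ha0.ne'; positivity
  set D₁ : ℝ := D₀ * C₁ ^ 2 with hD₁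
  have hD₁0 : 0 < D₁ := by positivity
  set W : Fin 5 → ℕ := Fin.cons C₁ fun _ => 1 with hW
  have hW0 : ∀ i, 0 < W i := Fin.cases hC₁0 fun i => one_pos
  set T : ℕ → Finset (ℕ × ℕ) := fun m => range (m ^ (16 * k)) ×ˢ range (m ^ (13 * k)) with hT
  have hTc : ∀ m, (T m).card = m ^ (29 * k) := fun m => by
    simp only [hT, Finset.card_product, Finset.card_range, ← pow_add]; congr 1; ring
  have hfreq := frequently_exists_minor_majorant (by simp) hane hW0 hk hμ hmem T hTc
    (fun m p => cubic (a' 0) (b' 0) (c' 0) ((m ^ (16 * k) : ℕ) + p.1) +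
        cubic (a' 2) (b' 2) (c' 2) ((m ^ (13 * k) : ℕ) + p.2))
    (fun m p => cubic (a' 1) (b' 1) (c' 1) ((m ^ (16 * k) : ℕ) + p.1) +
        cubic (a' 3) (b' 3) (c' 3) ((m ^ (13 * k) : ℕ) + p.2))
    (eventually_integral_norm_sq_mul_le (ha' 0).ne (ha' 2).ne _ _ _ _ (by lia))
    (eventually_integral_norm_sq_mul_le (ha' 1).ne (ha' 3).ne _ _ _ _ (by lia))
  have hpi := Real.pi_pos
  obtain ⟨m, ⟨F, hFc, hF0, ⟨K, hFK⟩, hF, hFint⟩, hm, hmb, hmc, hmD, hmκ, hme, hme', hmfin⟩ :=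
    (hfreq.and_eventually
    ((eventually_ge_atTop 2).and ((eventually_natCast_pow hbd (by lia : 16 * k ≠ 0)).and
    ((eventually_natCast_pow ((tendsto_id.const_mul_atTop (zero_lt_one.trans_le hC₁R)).eventually
      (eventually_abs_cubic_sub_le (a 0) (b 0) (c 0) (half_pos ha0))) (by lia : 16 * k ≠ 0)).and
    ((tendsto_natCast_atTop_atTop.eventually_ge_atTop D₁).and
    ((tendsto_natCast_atTop_atTop.eventually_ge_atTop (1 / κ)).and
    ((eventually_natCast_pow_mul_exp_le (by positivity : 0 < Real.pi * η ^ 2) (48 * k + 2)).and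
    ((eventually_natCast_pow_mul_exp_le (by positivity : 0 < Real.pi / 2) (48 * k + 2)).and
    (tendsto_natCast_atTop_atTop.eventually_gt_atTop
      ((1 + (3 + 2 * Real.pi) * C₁) / (Real.exp (-Real.pi) / (2 * D₁)))))))))))).exists
  simp only [id] at hmc
  obtain ⟨B, hB⟩ : ∃ B, B = 273 := ⟨_, rfl⟩
  rw [← hB] at hF
  have hm0 : (0 : ℝ) < m := by positivity
  have hm1 : (1 : ℝ) ≤ m := by exact_mod_cast (by lia : 1 ≤ m)
  set ω : ℕ × ℕ → ℝ := fun p => cubic (a' 0) (b' 0) (c' 0) ((m ^ (16 * k) : ℕ) + p.1) +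
    cubic (a' 2) (b' 2) (c' 2) ((m ^ (13 * k) : ℕ) + p.2) with hω
  set ω' : ℕ × ℕ → ℝ := fun p => cubic (a' 1) (b' 1) (c' 1) ((m ^ (16 * k) : ℕ) + p.1) +
    cubic (a' 3) (b' 3) (c' 3) ((m ^ (13 * k) : ℕ) + p.2) with hω'
  set t : Finset ((Fin 4 → ℕ) × ((ℕ × ℕ) × (ℕ × ℕ))) :=
    Fintype.piFinset (fun _ : Fin 4 => range (m ^ (16 * k))) ×ˢ (T m ×ˢ T m) with ht
  set ζ : (Fin 4 → ℕ) → ℝ :=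
    fun z => ∑ i, cubic (a i.succ) (b i.succ) (c i.succ) (z i) with hζ
  set ξ : (Fin 4 → ℕ) × ((ℕ × ℕ) × (ℕ × ℕ)) → ℝ :=
    fun q => ζ q.1 + (ω q.2.1 + ω' q.2.2) - τ with hξ
  have htc : t.card = m ^ (122 * k) := by
    simp only [ht, Finset.card_product, hTc, Fintype.card_piFinset, Finset.card_range,
      Finset.prod_const, Finset.card_univ, Fintype.card_fin, ← pow_mul, ← pow_add]
    congr 1; ring
  have hN3 : ((m ^ (16 * k) : ℕ) : ℝ) ^ 3 = (m : ℝ) ^ (48 * k) := by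
    push_cast; rw [← pow_mul]; congr 1; ring
  have hbound : ∀ q ∈ t, κ * (m : ℝ) ^ (48 * k) ≤ -ξ q ∧ -ξ q ≤ C * (m : ℝ) ^ (48 * k) := by
    rintro ⟨z, p, p'⟩ hq
    simp only [ht, hT, Finset.mem_product, Fintype.mem_piFinset, Finset.mem_range] at hq
    obtain ⟨hz, ⟨hp1, hp2⟩, hp1', hp2'⟩ := hq
    have hQ : m ^ (13 * k) ≤ m ^ (16 * k) := Nat.pow_le_pow_right (by lia) (by lia)
    have key := hmb (Sum.elim (fun i => (z i : ℝ)) fun i =>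
        ((![m ^ (16 * k) + p.1, m ^ (16 * k) + p'.1, m ^ (13 * k) + p.2, m ^ (13 * k) + p'.2] i : ℕ)
          : ℝ)) ?_ ?_ ?_
    · simp only [hN3, Fintype.sum_sum_type, Sum.elim_inl, Sum.elim_inr, Fin.sum_univ_four,
        Matrix.cons_val, Nat.cast_add] at key
      simp only [hξ, hζ, hω, hω', Fin.sum_univ_four]
      constructor <;> linarith [key.1, key.2]
    · rintro (i | i)
      · simp
      · exact Nat.cast_nonneg _
    · rintro (i | i)
      · have := hz i
        simp only [Sum.elim_inl]
        exact_mod_cast (by lia : z i ≤ 2 * m ^ (16 * k))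
      · simp only [Sum.elim_inr]
        norm_cast
        fin_cases i <;> simp <;> lia
    · simp
  have hcub : C * (m : ℝ) ^ (48 * k) ≤ cubic (a 0) (b 0) (c 0) ((C₁ * m ^ (16 * k) : ℕ) : ℝ) := by
    have h1 := hmc ((C₁ * m ^ (16 * k) : ℕ) : ℝ) (by positivity)
      (by push_cast; nlinarith [(by positivity : 0 ≤ (C₁ : ℝ) * (m : ℝ) ^ (16 * k))])
    have h2 : (((C₁ * m ^ (16 * k) : ℕ) : ℝ)) ^ 3 = C₁ ^ 3 * (m : ℝ) ^ (48 * k) := by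
      rw [← hN3]; push_cast; ring
    rw [mul_pow (C₁ : ℝ), hN3, h2] at h1
    have h3 : (C₁ : ℝ) ≤ C₁ ^ 3 := le_self_pow₀ hC₁R (by lia)
    have h4 : 2 * C * (m : ℝ) ^ (48 * k) ≤ C₁ ^ 3 * a 0 * (m : ℝ) ^ (48 * k) := by
      gcongr ?_ * _; exact hC₁C.trans (by gcongr)
    have := (abs_le.1 h1).1
    nlinarith
  set S : ℝ := (m : ℝ) ^ (48 * k - (2 * B)) with hS
  have hS0 : 0 < S := by positivity
  have hSm : S * (m : ℝ) ^ (2 * B) = (m : ℝ) ^ (48 * k) := by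
    rw [hS, ← pow_add]; congr 1; lia
  set D : ℝ := D₀ * (C₁ * (m : ℝ) ^ (16 * k)) ^ 2 with hD
  have hDeq : D = D₁ * (m : ℝ) ^ (32 * k) := by
    rw [hD, hD₁, mul_pow, ← pow_mul]; ring_nf
  have hD0 : 0 < D := by positivity
  have hDS : D ≤ S := by
    calc D ≤ m * (m : ℝ) ^ (32 * k) := by rw [hDeq]; gcongr
      _ = (m : ℝ) ^ (32 * k + 1) := by ring
      _ ≤ S := pow_le_pow_right₀ hm1 (by lia)
  have hκS : S ≤ κ * (m : ℝ) ^ (48 * k) := by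
    rw [div_le_iff₀ hκ] at hmκ
    calc S = 1 * S := (one_mul _).symm
      _ ≤ (m * κ) * S := by gcongr
      _ ≤ ((m : ℝ) ^ (2 * B) * κ) * S := by gcongr; exact le_self_pow₀ hm1 (by lia)
      _ = _ := by rw [← hSm]; ring
  have hlow := le_sum_exp_of_near (p := cubic (a 0) (b 0) (c 0)) (continuous_cubic _ _ _)
    (by simp [cubic]) (M := C₁ * m ^ (16 * k)) hD0 (fun x x' hx hx' => by
      have h1 : (1 : ℝ) ≤ ((C₁ * m ^ (16 * k) : ℕ) : ℝ) := by
        exact_mod_cast Nat.mul_pos hC₁0 (by positivity)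
      have := abs_cubic_sub_le (a 0) (b 0) (c 0) h1 hx hx'
      push_cast at this
      exact this) hDS t ξ fun q hq =>
      ⟨hκS.trans (hbound q hq).1, (hbound q hq).2.trans hcub⟩
  rw [htc] at hlow
  set s : Finset (ℕ × ((Fin 4 → ℕ) × ((ℕ × ℕ) × (ℕ × ℕ)))) := range (C₁ * m ^ (16 * k)) ×ˢ t with hs
  have hsc : (s.card : ℝ) = C₁ * (m : ℝ) ^ (138 * k) := by
    rw [hs, Finset.card_product, htc, Finset.card_range]
    push_cast
    rw [mul_assoc, ← pow_add]; congr 2; ring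
  have hup := mul_sum_exp_le (δ := ((m : ℝ) ^ (48 * k - B))⁻¹) hm0 (by positivity)
    (inv_pos.2 hS0) ((inv_le_one_of_one_le₀ (one_le_pow₀ hm1)).trans hm1) s
    (fun q => cubic (a 0) (b 0) (c 0) (q.1 : ℕ) + ξ q.2) hFc hF0 hFK fun α hα hαm => by
      refine le_of_eq_of_le ?_ (hF α ?_ hαm)
      · rw [hs, ← expSum_mul (range _) t (fun x : ℕ => cubic (a 0) (b 0) (c 0) x) ξ, hξ,
          norm_mul, norm_expSum_sub_const, ht,
          ← expSum_mul _ _ ζ (fun r : (ℕ × ℕ) × (ℕ × ℕ) => ω r.1 + ω' r.2), ← expSum_mul _ _ ω ω',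
          norm_mul, norm_mul, hζ,
          ← prod_expSum (fun _ => range (m ^ (16 * k)))
            (fun (i : Fin 4) (x : ℕ) => cubic (a i.succ) (b i.succ) (c i.succ) x), norm_prod,
          Fin.prod_univ_succ
            (fun i => ‖expSum (range (W i * _)) (fun x : ℕ => cubic (a i) _ _ x) α‖), hW]
        simp only [Fin.cons_zero, Fin.cons_succ, one_mul]
        ring
      · rw [inv_le_iff_one_le_mul₀ (by positivity)] at hα
        calc (m : ℝ) ^ B = (m : ℝ) ^ B * 1 := (mul_one _).symm
          _ ≤ (m : ℝ) ^ B * (|α| * (m : ℝ) ^ (48 * k - B)) :=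
            mul_le_mul_of_nonneg_left hα (by positivity)
          _ = |α| * ((m : ℝ) ^ (B + (48 * k - B))) := by rw [pow_add]; ring
          _ = _ := by congr 2; lia
  have hfar : ∀ q ∈ s, Real.exp (-Real.pi * (m : ℝ) ^ 2 *
      (cubic (a 0) (b 0) (c 0) (q.1 : ℕ) + ξ q.2) ^ 2) ≤
      Real.exp (-(Real.pi * η ^ 2 * (m : ℝ) ^ 2)) := by
    rintro ⟨x, z, p, p'⟩ -
    have h1 := hcon (Fin.cons x z)
      ![m ^ (16 * k) + p.1, m ^ (16 * k) + p'.1, m ^ (13 * k) + p.2, m ^ (13 * k) + p'.2]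
    have h2 : (∑ i, cubic (a i) (b i) (c i) ((Fin.cons x z : Fin 5 → ℕ) i : ℕ)) +
        ∑ i, cubic (a' i) (b' i) (c' i)
          ((![m ^ (16 * k) + p.1, m ^ (16 * k) + p'.1, m ^ (13 * k) + p.2,
            m ^ (13 * k) + p'.2] i : ℕ) : ℝ) - τ =
        cubic (a 0) (b 0) (c 0) x + ξ (z, p, p') := by
      rw [Fin.sum_univ_succ, Fin.sum_univ_four (fun i => cubic (a' i) (b' i) (c' i) _)]
      simp only [Matrix.cons_val, Fin.cons_zero, Fin.cons_succ, hξ, hζ, hω, hω']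
      push_cast
      ring
    rw [h2] at h1
    have h3 : η ^ 2 ≤ (cubic (a 0) (b 0) (c 0) x + ξ (z, p, p')) ^ 2 := by
      rw [← sq_abs (cubic _ _ _ _ + _)]; gcongr
    refine Real.exp_le_exp.2 ?_
    have : Real.pi * (m : ℝ) ^ 2 * η ^ 2 ≤
      Real.pi * (m : ℝ) ^ 2 * (cubic (a 0) (b 0) (c 0) x + ξ (z, p, p')) ^ 2 := by gcongr
    simp only
    linarith
  have hfar' := Finset.sum_le_card_nsmul s _ _ hfar
  rw [nsmul_eq_mul, hsc] at hfar'
  rw [hsc] at hup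
  set P : ℝ := (m : ℝ) ^ (90 * k - 1) with hP
  have hP0 : 0 < P := by positivity
  have hPm : m * P = (m : ℝ) ^ (90 * k) := by rw [hP, ← pow_succ']; congr 1; lia
  have hbig : (m : ℝ) * (C₁ * (m : ℝ) ^ (138 * k)) = C₁ * P * (m : ℝ) ^ (48 * k + 2) := by
    have : (m : ℝ) * (m : ℝ) ^ (138 * k) = P * (m : ℝ) ^ (48 * k + 2) := by
      rw [hP, ← pow_succ', ← pow_add]; congr 1; lia
    linear_combination C₁ * this
  have hmain : P * (m * (Real.exp (-Real.pi) / (2 * D₁))) ≤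
      S⁻¹ * ∑ q ∈ s, Real.exp (-Real.pi * S⁻¹ ^ 2 * (cubic (a 0) (b 0) (c 0) (q.1 : ℕ) + ξ q.2) ^ 2)
      := by
    refine le_trans (le_of_eq ?_) (mul_le_mul_of_nonneg_left hlow (inv_pos.2 hS0).le)
    have : (m : ℝ) ^ (122 * k) = m * P * (m : ℝ) ^ (32 * k) := by
      rw [hPm, ← pow_add]; congr 1; ring
    push_cast
    rw [hDeq, this]
    field_simp
  have hpeak : m * ∑ q ∈ s, Real.exp (-Real.pi * (m : ℝ) ^ 2 *
      (cubic (a 0) (b 0) (c 0) (q.1 : ℕ) + ξ q.2) ^ 2) ≤ C₁ * P := by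
    refine (mul_le_mul_of_nonneg_left hfar' hm0.le).trans ?_
    rw [← mul_assoc, hbig, mul_assoc]
    exact mul_le_of_le_one_right (by positivity) hme
  have hmajor : C₁ * (m : ℝ) ^ (138 * k) * (Real.pi * ((m : ℝ) ^ (48 * k - B))⁻¹ ^ 2 / S⁻¹ ^ 2) *
      (2 * ((m : ℝ) ^ (48 * k - B))⁻¹) ≤ 2 * Real.pi * C₁ * P := by
    have h1 : (m : ℝ) ^ (48 * k - B) = S * (m : ℝ) ^ B := by rw [hS, ← pow_add]; congr 1; lia
    have h2 : (m : ℝ) ^ (138 * k) = m * P * (S * (m : ℝ) ^ (2 * B)) := by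
      rw [hPm, hSm, ← pow_add]; congr 1; ring
    have h3 : C₁ * (m : ℝ) ^ (138 * k) *
        (Real.pi * ((m : ℝ) ^ (48 * k - B))⁻¹ ^ 2 / S⁻¹ ^ 2) *
        (2 * ((m : ℝ) ^ (48 * k - B))⁻¹) = 2 * Real.pi * C₁ * P * (m / (m : ℝ) ^ B) := by
      rw [h1, h2, pow_mul']
      field_simp
    rw [h3]
    refine mul_le_of_le_one_right (by positivity) ((div_le_one (by positivity)).2 ?_)
    exact le_self_pow₀ hm1 (by lia)
  have hminor : m * ∫ α, F α ∂gaussProb m ≤ P := by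
    calc _ ≤ m * (m : ℝ) ^ (90 * k - 8) := by gcongr
      _ = (m : ℝ) ^ (90 * k - 8 + 1) := (pow_succ' _ _).symm
      _ ≤ P := pow_le_pow_right₀ hm1 (by lia)
  have htail : C₁ * (m : ℝ) ^ (138 * k) * Real.exp (-Real.pi * (m : ℝ) ^ 2 / 2) * (2 * m) ≤
      2 * C₁ * P := by
    rw [show -Real.pi * (m : ℝ) ^ 2 / 2 = -(Real.pi / 2 * (m : ℝ) ^ 2) by ring]
    calc _ = 2 * (m * (C₁ * (m : ℝ) ^ (138 * k))) * Real.exp (-(Real.pi / 2 * (m : ℝ) ^ 2)) := by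
          ring
      _ = 2 * C₁ * P * ((m : ℝ) ^ (48 * k + 2) * Real.exp (-(Real.pi / 2 * (m : ℝ) ^ 2))) := by
          rw [hbig]; ring
      _ ≤ _ := mul_le_of_le_one_right (by positivity) hme'
  rw [div_lt_iff₀ (by positivity)] at hmfin
  have hfinal := mul_lt_mul_of_pos_left hmfin hP0
  linarith

theorem eval_eq_cubic_add {p : Polynomial ℝ} (hp : p.degree = 3) (x : ℝ) :
    p.eval x = cubic (p.coeff 3) (p.coeff 2) (p.coeff 1) x + p.coeff 0 := by
  have h3 : p.natDegree = 3 := Polynomial.natDegree_eq_of_degree_eq_some hp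
  rw [Polynomial.eval_eq_sum_range, h3]
  simp only [Finset.sum_range_succ, Finset.sum_range_zero, cubic]
  ring

theorem exists_embedding_of_two_values {ι κ : Type*} [DecidableEq κ] (f : ι ↪ κ) {i i' : ι}
    (hi : i ≠ i') (k k' : κ) : ∃ e : ι ↪ κ, e i = k ∧ (e i = k' ∨ e i' = k') := by
  obtain ⟨g, hg⟩ : ∃ g : ι ↪ κ, g i = k :=
    ⟨f.trans (Equiv.swap (f i) k).toEmbedding, by simp⟩
  by_cases hk : k = k'
  · exact ⟨g, hg, Or.inl (hg.trans hk)⟩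
  · refine ⟨g.trans (Equiv.swap (g i') k').toEmbedding, ?_, Or.inr (by simp)⟩
    have : k ≠ g i' := hg ▸ fun h => hi (g.injective h)
    simp [hg, Equiv.swap_apply_of_ne_of_ne this hk]

theorem exists_sign_mul_pos {x : ℝ} (hx : x ≠ 0) : ∃ u : ℤ, u ^ 2 = 1 ∧ 0 < u * x := by
  rcases hx.lt_or_gt with h | h
  · exact ⟨-1, by norm_num, by simpa using h⟩
  · exact ⟨1, by norm_num, by simpa using h⟩

theorem cubic_mul_of_sq_eq_one {u : ℝ} (hu : u ^ 2 = 1) (a b c x : ℝ) :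
    cubic a b c (u * x) = cubic (u * a) b (u * c) x := by
  simp only [cubic]
  linear_combination (u * a * x ^ 3 + b * x ^ 2) * hu

theorem irrational_mul_div_of_sq_eq_one {u v : ℤ} (hu : u ^ 2 = 1) (hv : v ^ 2 = 1) {x y : ℝ}
    (h : Irrational (x / y)) : Irrational (u * x / (v * y)) := by
  rcases mul_self_eq_one_iff.1 ((sq u).symm.trans hu) with rfl | rfl <;>
    rcases mul_self_eq_one_iff.1 ((sq v).symm.trans hv) with rfl | rfl <;>
    simpa [neg_div, div_neg] using h

/-- **Sums of nine cubic polynomials.**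
If `s ≥ 9`, `η > 0`, `τ ∈ ℝ` and `h₁, …, h_s` are cubic real polynomials
satisfying the irrationality condition (some ratio `β_{i₁ j₁}/β_{i₂ j₂}` of
non-constant coefficients, with `β_{i₂ j₂} ≠ 0`, is irrational), then
`|H(x) - τ| < η` has an integral solution, where `H(x) = ∑ᵢ hᵢ(xᵢ)`. -/
theorem sums_of_cubic_polynomials
    (s : ℕ) (hs : 9 ≤ s) (η : ℝ) (hη : 0 < η) (τ : ℝ)
    (h : Fin s → Polynomial ℝ) (hdeg : ∀ i, (h i).degree = 3)
    (hirr : ∃ i₁ i₂ : Fin s, ∃ j₁ j₂ : ℕ,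
      1 ≤ j₁ ∧ j₁ ≤ 3 ∧ 1 ≤ j₂ ∧ j₂ ≤ 3 ∧
      (h i₂).coeff j₂ ≠ 0 ∧
      Irrational ((h i₁).coeff j₁ / (h i₂).coeff j₂)) :
    ∃ x : Fin s → ℤ, |(∑ i, (h i).eval ((x i : ℝ))) - τ| < η := by
  have hA : ∀ i, (h i).coeff 3 ≠ 0 := fun i =>
    Polynomial.coeff_ne_zero_of_eq_degree (hdeg i)
  obtain ⟨i₀, i₁, j, hj1, hj3, hij⟩ : ∃ i₀ i₁ : Fin s, ∃ j : ℕ, 1 ≤ j ∧ j ≤ 3 ∧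
      Irrational ((h i₁).coeff j / (h i₀).coeff 3) := by
    obtain ⟨i₁, i₂, j₁, j₂, h1, h2, h3, h4, -, h6⟩ := hirr
    by_contra! hrat
    obtain ⟨q₁, hq₁⟩ := not_not.1 (hrat i₂ i₁ j₁ h1 h2)
    obtain ⟨q₂, hq₂⟩ := not_not.1 (hrat i₂ i₂ j₂ h3 h4)
    rw [← div_div_div_cancel_right₀ (hA i₂), ← hq₁, ← hq₂] at h6
    exact h6 ⟨q₁ / q₂, by push_cast; rfl⟩
  obtain ⟨f⟩ : Nonempty (Fin 5 ⊕ Fin 4 ↪ Fin s) :=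
    Function.Embedding.nonempty_of_card_le (by simpa using hs)
  obtain ⟨e, he₀, he₁⟩ := exists_embedding_of_two_values f
    (i := Sum.inl 0) (i' := Sum.inl 1) (by decide) i₀ i₁
  obtain ⟨l, hl⟩ : ∃ l, e (Sum.inl l) = i₁ := he₁.elim (⟨0, ·⟩) (⟨1, ·⟩)
  have hsign : ∀ q, ∃ u : ℤ, u ^ 2 = 1 ∧
      0 < u * (if q = Sum.inl 0 then (h (e q)).coeff 3 else -(h (e q)).coeff 3) := fun q =>
    exists_sign_mul_pos (by split_ifs; exacts [hA _, neg_ne_zero.2 (hA _)])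
  choose u hu hupos using hsign
  have huR : ∀ q, (u q : ℝ) ^ 2 = 1 := fun q => by exact_mod_cast hu q
  have hneg : ∀ q, q ≠ Sum.inl 0 → u q * (h (e q)).coeff 3 < 0 := fun q hq => by
    have := hupos q
    rw [if_neg hq] at this
    linarith
  have hpos : 0 < u (Sum.inl 0) * (h (e (Sum.inl 0))).coeff 3 := by simpa using hupos (Sum.inl 0)
  obtain ⟨x, y, hxy⟩ := exists_abs_sum_cubic_sub_lt
    (a := fun i => u (Sum.inl i) * (h (e (Sum.inl i))).coeff 3)
    (b := fun i => (h (e (Sum.inl i))).coeff 2)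
    (c := fun i => u (Sum.inl i) * (h (e (Sum.inl i))).coeff 1)
    (a' := fun i => u (Sum.inr i) * (h (e (Sum.inr i))).coeff 3)
    (b' := fun i => (h (e (Sum.inr i))).coeff 2)
    (c' := fun i => u (Sum.inr i) * (h (e (Sum.inr i))).coeff 1)
    (μ := (if j = 2 then 1 else u (Sum.inl l) : ℤ) * (h i₁).coeff j /
      (u (Sum.inl 0) * (h i₀).coeff 3)) (i₁ := l) hpos
    (fun i => hneg _ (by simp [Fin.succ_ne_zero])) (fun i => hneg _ (by simp))
    (irrational_mul_div_of_sq_eq_one (by split_ifs; exacts [one_pow 2, hu _]) (hu _) hij)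
    (by
      simp only [he₀, hl]
      rw [he₀] at hpos
      rw [div_mul_cancel₀ _ hpos.ne']
      interval_cases j <;> simp) (τ - ∑ i, (h i).coeff 0) hη
  set X : Fin 5 ⊕ Fin 4 → ℤ := fun q => u q * (Sum.elim x y q : ℕ) with hX
  refine ⟨Function.extend e X 0, ?_⟩
  have hsum : ∑ q, cubic ((h (e q)).coeff 3) ((h (e q)).coeff 2) ((h (e q)).coeff 1) (X q) =
      ∑ i, cubic ((h i).coeff 3) ((h i).coeff 2) ((h i).coeff 1) (Function.extend e X 0 i : ℤ) := by
    refine Fintype.sum_of_injective e e.injective _ _ (fun i hi => ?_) fun q => ?_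
    · rw [Function.extend_apply' _ _ _ (by simpa using hi)]
      simp [cubic]
    · rw [e.injective.extend_apply]
  simp only [eval_eq_cubic_add (hdeg _), Finset.sum_add_distrib]
  rw [← hsum, Fintype.sum_sum_type]
  simp only [hX, Sum.elim_inl, Sum.elim_inr, Int.cast_mul, Int.cast_natCast,
    cubic_mul_of_sq_eq_one (huR _)]
  convert hxy using 2
  ring
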